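/- Let p be a prime with p ≡ 1 (mod 4) and let d = p + 1. Then for every real ε > 0 and every integer g₀ there exists a finite connected d-regular graph X whose girth g is finite and satisfies g ≥ g₀, and whose cop number satisfies c(X) ≤ p^{(3/8)·(1 + 2·log_p 4 + ε)·g}. -/

import Mathlib

/-!
The game of cops and robbers on a (finite connected) simple graph `G`:
first the `k` cops choose starting vertices, then the robber chooses a starting
vertex (knowing the cops' positions); the players alternate turns (cops first),
each cop may stay or move to an adjacent vertex, and the robber may stay or move
to an adjacent vertex.  The cops win if at some moment a cop occupies the same
vertex as the robber.  The cop number is the least `k` for which the cops have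
a winning strategy.
-/

variable {V : Type*}

/-- A (positional) strategy for a team of `k` cops on the graph `G`: an initial
placement, and a move function which, given the current cop positions and the
robber's position, tells each cop to stay or move to an adjacent vertex. -/
structure CopStrategy (G : SimpleGraph V) (k : ℕ) where
  init : Fin k → V
  move : (Fin k → V) → V → (Fin k → V)
  valid : ∀ c r i, move c r i = c i ∨ G.Adj (c i) (move c r i)

/-- A (positional) strategy for the robber on the graph `G` against `k` cops:
an initial placement depending on the cops' initial positions, and a move
function which, given the current cop positions and the robber's position,
makes the robber stay or move to an adjacent vertex. -/
structure RobberStrategy (G : SimpleGraph V) (k : ℕ) where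
  init : (Fin k → V) → V
  move : (Fin k → V) → V → V
  valid : ∀ c r, move c r = r ∨ G.Adj r (move c r)

/-- The sequence of game positions (cop positions, robber position) produced by a
cop strategy and a robber strategy; `play CS RS n` is the position after `n`
full rounds (a round being a cop move followed by a robber move). -/
def play {G : SimpleGraph V} {k : ℕ} (CS : CopStrategy G k) (RS : RobberStrategy G k) :
    ℕ → (Fin k → V) × V
  | 0 => (CS.init, RS.init CS.init)
  | n + 1 =>
      (CS.move (play CS RS n).1 (play CS RS n).2,
       RS.move (CS.move (play CS RS n).1 (play CS RS n).2) (play CS RS n).2)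

/-- The cops win with `k` cops if they have a strategy capturing the robber
(occupying the robber's vertex, either right after the robber's move or right
after the cops' own move) against every robber strategy. -/
def CopsWin (G : SimpleGraph V) (k : ℕ) : Prop :=
  ∃ CS : CopStrategy G k, ∀ RS : RobberStrategy G k,
    ∃ n, (∃ i, (play CS RS n).1 i = (play CS RS n).2) ∨
         (∃ i, (play CS RS (n + 1)).1 i = (play CS RS n).2)

/-- The cop number of `G`: the least number of cops having a winning strategy. -/
noncomputable def copNumber (G : SimpleGraph V) : ℕ := sInf {k | CopsWin G k}


section
open Polynomial

/-- `s` has at most `k` elements. -/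
def CardLE {α : Type*} (s : Set α) (k : ℕ) : Prop := s.Finite ∧ s.ncard ≤ k

theorem CardLE.mono {α : Type*} {s t : Set α} {k l : ℕ} (h : CardLE t k) (hs : s ⊆ t)
    (hk : k ≤ l) : CardLE s l :=
  ⟨h.1.subset hs, (Set.ncard_le_ncard hs h.1).trans (h.2.trans hk)⟩

theorem CardLE.inj {α β : Type*} {s : Set α} {t : Set β} {k : ℕ} (h : CardLE t k) (f : α → β)
    (hm : ∀ x ∈ s, f x ∈ t) (hi : ∀ x ∈ s, ∀ y ∈ s, f x = f y → x = y) : CardLE s k := by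
  have hinj : Set.InjOn f s := fun x hx y hy => hi x hx y hy
  have hfin : s.Finite := Set.Finite.of_injOn (f := f) hm hinj h.1
  refine ⟨hfin, ?_⟩
  exact (Set.ncard_le_ncard_of_injOn f hm hinj h.1).trans h.2

theorem CardLE.biUnion {ι α : Type*} {t : Set ι} {k l : ℕ} (h : CardLE t k) {g : ι → Set α}
    (hg : ∀ i ∈ t, CardLE (g i) l) {s : Set α} (hs : ∀ x ∈ s, ∃ i ∈ t, x ∈ g i) :
    CardLE s (k * l) := by
  classical
  have hfin : (⋃ i ∈ t, g i).Finite := h.1.biUnion fun i hi => (hg i hi).1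
  have hsub : s ⊆ ⋃ i ∈ t, g i := by
    intro x hx
    obtain ⟨i, hi, hx⟩ := hs x hx
    simp only [Set.mem_iUnion]
    exact ⟨i, hi, hx⟩
  refine CardLE.mono ⟨hfin, ?_⟩ hsub le_rfl
  have h1 : (⋃ i ∈ t, g i) = ⋃ i ∈ h.1.toFinset, g i := by simp
  rw [h1]
  refine (Finset.set_ncard_biUnion_le _ _).trans ?_
  refine (Finset.sum_le_card_nsmul _ _ l ?_).trans ?_
  · intro i hi
    exact (hg i (by simpa using hi)).2
  · rw [smul_eq_mul, ← Set.ncard_eq_toFinset_card t h.1]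
    exact Nat.mul_le_mul_right _ h.2

theorem CardLE.sum {ι α : Type*} (t : Finset ι) {l : ι → ℕ} {g : ι → Set α}
    (hg : ∀ i ∈ t, CardLE (g i) (l i)) {s : Set α} (hs : ∀ x ∈ s, ∃ i ∈ t, x ∈ g i) :
    CardLE s (∑ i ∈ t, l i) := by
  classical
  have hfin : (⋃ i ∈ t, g i).Finite := t.finite_toSet.biUnion fun i hi => (hg i hi).1
  have hsub : s ⊆ ⋃ i ∈ t, g i := by
    intro x hx
    obtain ⟨i, hi, hx⟩ := hs x hx
    simp only [Set.mem_iUnion]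
    exact ⟨i, hi, hx⟩
  refine CardLE.mono ⟨hfin, ?_⟩ hsub le_rfl
  refine (Finset.set_ncard_biUnion_le _ _).trans ?_
  exact Finset.sum_le_sum fun i hi => (hg i hi).2

theorem CardLE.fiber {α β : Type*} {s : Set α} {t : Set β} {k l : ℕ} (h : CardLE t k)
    (f : α → β) (hm : ∀ x ∈ s, f x ∈ t) (hf : ∀ y ∈ t, CardLE {x | x ∈ s ∧ f x = y} l) :
    CardLE s (k * l) :=
  CardLE.biUnion h (g := fun y => {x | x ∈ s ∧ f x = y}) hf fun x hx => ⟨f x, hm x hx, hx, rfl⟩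

theorem CardLE.union {α : Type*} {s t u : Set α} {k l : ℕ} (h : CardLE t k) (h' : CardLE u l)
    (hs : ∀ x ∈ s, x ∈ t ∨ x ∈ u) : CardLE s (k + l) :=
  CardLE.mono ⟨h.1.union h'.1, (Set.ncard_union_le _ _).trans (add_le_add h.2 h'.2)⟩ hs le_rfl

theorem CardLE.subsingleton {α : Type*} {s : Set α} (h : ∀ x ∈ s, ∀ y ∈ s, x = y) :
    CardLE s 1 := by
  have hs : s.Subsingleton := fun x hx y hy => h x hx y hy
  exact ⟨hs.finite, (Set.ncard_le_one hs.finite).2 h⟩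

theorem CardLE.empty {α : Type*} {s : Set α} (h : ∀ x ∈ s, False) (k : ℕ) : CardLE s k := by
  have : s = ∅ := Set.eq_empty_iff_forall_notMem.2 h
  subst this
  exact ⟨Set.finite_empty, by simp⟩

theorem CardLE.univ {α : Type*} [Fintype α] (s : Set α) : CardLE s (Fintype.card α) := by
  refine ⟨Set.toFinite _, ?_⟩
  rw [← Nat.card_eq_fintype_card, ← Set.ncard_univ]
  exact Set.ncard_le_ncard (Set.subset_univ _) Set.finite_univ

theorem CardLE.prod {α β : Type*} {s : Set α} {t : Set β} {k l : ℕ} (h : CardLE s k)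
    (h' : CardLE t l) : CardLE (s ×ˢ t) (k * l) :=
  ⟨h.1.prod h'.1, by rw [Set.ncard_prod]; exact Nat.mul_le_mul h.2 h'.2⟩

/-- A set is of size at most `l * k` if it is empty or, for some base point ... -/
theorem CardLE.of_base {α : Type*} {s : Set α} {k : ℕ} (h : ∀ x ∈ s, CardLE s k) : CardLE s k := by
  by_cases hs : ∃ x, x ∈ s
  · obtain ⟨x, hx⟩ := hs
    exact h x hx
  · exact CardLE.empty (fun x hx => hs ⟨x, hx⟩) k

theorem monic_divisors_card {K : Type*} [Field K] (n : ℕ) : ∀ f : K[X], f ≠ 0 → f.natDegree ≤ n →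
    CardLE {d : K[X] | d.Monic ∧ d ∣ f} (2 ^ n) := by
  induction n with
  | zero =>
    intro f hf hn
    refine CardLE.mono (k := 1) (t := {d : K[X] | d.Monic ∧ d ∣ f}) ?_ subset_rfl (by simp)
    apply CardLE.subsingleton
    have key : ∀ x ∈ {d : K[X] | d.Monic ∧ d ∣ f}, x = 1 := by
      rintro x ⟨hx, hd⟩
      have := natDegree_le_of_dvd hd hf
      exact eq_one_of_monic_natDegree_zero hx (by omega)
    intro x hx y hy
    rw [key x hx, key y hy]
  | succ n ih =>
    intro f hf hn
    by_cases hu : IsUnit f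
    · exact (ih f hf (by rw [natDegree_eq_zero_of_isUnit hu]; omega)).mono subset_rfl
        (Nat.pow_le_pow_right (by norm_num) (by omega))
    obtain ⟨l, hl, hlm, hlf⟩ : ∃ l : K[X], Irreducible l ∧ l.Monic ∧ l ∣ f := by
      obtain ⟨l, hlm, hl, h⟩ := exists_monic_irreducible_factor f hu
      exact ⟨l, hl, hlm, h⟩
    obtain ⟨f', rfl⟩ := hlf
    have hf' : f' ≠ 0 := right_ne_zero_of_mul hf
    have hdeg : f'.natDegree ≤ n := by
      rw [natDegree_mul hl.ne_zero hf'] at hn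
      have := hl.natDegree_pos
      omega
    have h1 := ih f' hf' hdeg
    have h2 : CardLE {d : K[X] | d.Monic ∧ d ∣ l * f' ∧ l ∣ d} (2 ^ n) := by
      refine CardLE.inj h1 (fun d => d /ₘ l) ?_ ?_
      · rintro x ⟨hx, hd, y, rfl⟩
        simp only [Set.mem_ofPred_eq]
        rw [mul_divByMonic_cancel_left y hlm]
        exact ⟨Monic.of_mul_monic_left hlm hx, (mul_dvd_mul_iff_left hl.ne_zero).1 hd⟩
      · rintro x ⟨hx, hd, y, rfl⟩ x' ⟨hx', hd', y', rfl⟩ h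
        simp only [mul_divByMonic_cancel_left _ hlm] at h
        rw [h]
    have h3 := CardLE.union (s := {d : K[X] | d.Monic ∧ d ∣ l * f'}) h1 h2 (by
      rintro d ⟨hd, hdv⟩
      by_cases hld : l ∣ d
      · right; exact ⟨hd, hdv, hld⟩
      · left
        exact ⟨hd, ((hl.coprime_iff_not_dvd.2 hld).symm).dvd_of_dvd_mul_left hdv⟩)
    exact h3.mono subset_rfl (by rw [pow_succ]; omega)

section
variable {F : Type*} [Field F] [Fintype F]

theorem card_degree_lt (n : ℕ) : CardLE {f : F[X] | f.degree < n} (Fintype.card F ^ n) := by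
  have h := CardLE.univ (Set.univ : Set (Fin n → F))
  rw [Fintype.card_fun, Fintype.card_fin] at h
  refine CardLE.inj h (fun f i => f.coeff i) (fun _ _ => trivial) ?_
  intro f hf g hg hfg
  ext i
  by_cases hi : i < n
  · exact congrFun hfg ⟨i, hi⟩
  · rw [coeff_eq_zero_of_degree_lt, coeff_eq_zero_of_degree_lt]
    · exact lt_of_lt_of_le hg (by exact_mod_cast not_lt.1 hi)
    · exact lt_of_lt_of_le hf (by exact_mod_cast not_lt.1 hi)

theorem card_monic (n : ℕ) : CardLE {f : F[X] | f.Monic ∧ f.natDegree = n} (Fintype.card F ^ n) := by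
  refine CardLE.inj (card_degree_lt (F := F) n) (fun f => f - X ^ n) ?_ ?_
  · rintro f ⟨hf, hn⟩
    have : (f - X ^ n).degree < f.degree := by
      apply degree_sub_lt_left
      · rw [degree_X_pow, degree_eq_natDegree hf.ne_zero, hn]
      · exact hf.ne_zero
      · rw [hf.leadingCoeff, (monic_X_pow n).leadingCoeff]
    rw [degree_eq_natDegree hf.ne_zero, hn] at this
    exact this
  · intro f _ g _ h
    exact sub_left_injective h

theorem card_residue (n : ℕ) (h : F[X]) (hh : h ≠ 0) (s : Set F[X])
    (h1 : ∀ f ∈ s, f.degree < n) (h2 : ∀ f ∈ s, ∀ g ∈ s, h ∣ f - g) :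
    CardLE s (Fintype.card F ^ (n - h.natDegree)) := by
  apply CardLE.of_base
  intro f0 hf0
  refine CardLE.inj (card_degree_lt (F := F) (n - h.natDegree)) (fun f => (f - f0) / h) ?_ ?_
  · intro f hf
    obtain ⟨c, hc⟩ := h2 f hf f0 hf0
    simp only [Set.mem_ofPred_eq, hc, mul_div_cancel_left₀ c hh]
    have hd : (h * c).degree < n := by
      rw [← hc]
      exact lt_of_le_of_lt (degree_sub_le _ _) (max_lt (h1 f hf) (h1 f0 hf0))
    by_cases hc0 : c = 0
    · subst hc0; simp
    rw [degree_eq_natDegree (mul_ne_zero hh hc0), natDegree_mul hh hc0, Nat.cast_lt] at hd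
    rw [degree_eq_natDegree hc0, Nat.cast_lt]
    omega
  · intro f hf g hg hfg
    obtain ⟨c, hc⟩ := h2 f hf f0 hf0
    obtain ⟨c', hc'⟩ := h2 g hg f0 hf0
    simp only [hc, hc', mul_div_cancel_left₀ _ hh] at hfg
    rw [hfg, ← hc'] at hc
    exact sub_left_injective hc

end

end

section
open Polynomial Quaternion

section generic
variable {S : Type*} [CommRing S] {a c : S}

/-- The reduced norm. -/
def qN (x : ℍ[S,a,0,c]) : S :=
  x.re ^ 2 - a * x.imI ^ 2 - c * x.imJ ^ 2 + a * c * x.imK ^ 2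

theorem qN_mul (x y : ℍ[S,a,0,c]) : qN (x * y) = qN x * qN y := by
  simp only [qN, QuaternionAlgebra.re_mul, QuaternionAlgebra.imI_mul, QuaternionAlgebra.imJ_mul,
    QuaternionAlgebra.imK_mul]
  ring

theorem qN_star (x : ℍ[S,a,0,c]) : qN (star x) = qN x := by
  simp [qN]

theorem qN_one : qN (1 : ℍ[S,a,0,c]) = 1 := by
  simp [qN]

theorem qN_zero : qN (0 : ℍ[S,a,0,c]) = 0 := by
  simp [qN]

theorem qN_smul (f : S) (x : ℍ[S,a,0,c]) : qN (f • x) = f ^ 2 * qN x := by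
  simp [qN]; ring

theorem qN_neg (x : ℍ[S,a,0,c]) : qN (-x) = qN x := by
  simp [qN]

theorem mul_star_qN (x : ℍ[S,a,0,c]) : x * star x = qN x • (1 : ℍ[S,a,0,c]) := by
  ext <;> simp [qN] <;> ring

theorem star_mul_qN (x : ℍ[S,a,0,c]) : star x * x = qN x • (1 : ℍ[S,a,0,c]) := by
  ext <;> simp [qN] <;> ring

theorem re_mul_comm' (x y : ℍ[S,a,0,c]) : (x * y).re = (y * x).re := by
  simp only [QuaternionAlgebra.re_mul]; ring

theorem re_conj (x y : ℍ[S,a,0,c]) : (x * y * star x).re = qN x * y.re := by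
  simp [qN]; ring

theorem star_pure {x : ℍ[S,a,0,c]} (h : x.re = 0) : star x = -x := by
  ext <;> simp [h]

theorem pure_of_star {x : ℍ[S,a,0,c]} (h2 : ∀ s : S, 2 * s = 0 → s = 0) (h : star x = -x) :
    x.re = 0 := by
  have := congrArg QuaternionAlgebra.re h
  simp at this
  exact h2 _ (by linear_combination this)

theorem sq_pure {x : ℍ[S,a,0,c]} (h : x.re = 0) : x * x = -(qN x • (1 : ℍ[S,a,0,c])) := by
  rw [← mul_star_qN, star_pure h]; simp

/-- divisibility by a scalar, coordinatewise -/
def SDvd (f : S) (x : ℍ[S,a,0,c]) : Prop := ∃ y : ℍ[S,a,0,c], x = f • y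

theorem sdvd_iff (f : S) (x : ℍ[S,a,0,c]) :
    SDvd f x ↔ f ∣ x.re ∧ f ∣ x.imI ∧ f ∣ x.imJ ∧ f ∣ x.imK := by
  constructor
  · rintro ⟨y, rfl⟩
    simp
  · rintro ⟨⟨y1, h1⟩, ⟨y2, h2⟩, ⟨y3, h3⟩, ⟨y4, h4⟩⟩
    exact ⟨⟨y1, y2, y3, y4⟩, by ext <;> simp [*]⟩

theorem SDvd.add {f : S} {x y : ℍ[S,a,0,c]} (hx : SDvd f x) (hy : SDvd f y) : SDvd f (x + y) := by
  obtain ⟨x', rfl⟩ := hx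
  obtain ⟨y', rfl⟩ := hy
  exact ⟨x' + y', by rw [smul_add]⟩

theorem SDvd.neg {f : S} {x : ℍ[S,a,0,c]} (hx : SDvd f x) : SDvd f (-x) := by
  obtain ⟨x', rfl⟩ := hx
  exact ⟨-x', by rw [smul_neg]⟩

theorem SDvd.sub {f : S} {x y : ℍ[S,a,0,c]} (hx : SDvd f x) (hy : SDvd f y) : SDvd f (x - y) := by
  rw [sub_eq_add_neg]; exact hx.add hy.neg

theorem SDvd.mul_left {f : S} {x : ℍ[S,a,0,c]} (hx : SDvd f x) (y : ℍ[S,a,0,c]) :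
    SDvd f (y * x) := by
  obtain ⟨x', rfl⟩ := hx
  exact ⟨y * x', by rw [mul_smul_comm]⟩

theorem SDvd.mul_right {f : S} {x : ℍ[S,a,0,c]} (hx : SDvd f x) (y : ℍ[S,a,0,c]) :
    SDvd f (x * y) := by
  obtain ⟨x', rfl⟩ := hx
  exact ⟨x' * y, by rw [smul_mul_assoc]⟩

theorem SDvd.star {f : S} {x : ℍ[S,a,0,c]} (hx : SDvd f x) : SDvd f (star x) := by
  obtain ⟨x', rfl⟩ := hx
  exact ⟨Star.star x', by ext <;> simp⟩

theorem SDvd.smul {f g : S} (h : f ∣ g) (x : ℍ[S,a,0,c]) : SDvd f (g • x) := by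
  obtain ⟨g', rfl⟩ := h
  exact ⟨g' • x, by rw [mul_smul]⟩

theorem SDvd.qN {f : S} {x : ℍ[S,a,0,c]} (hx : SDvd f x) : f ^ 2 ∣ qN x := by
  obtain ⟨x', rfl⟩ := hx
  rw [qN_smul]
  exact dvd_mul_right _ _

end generic

section deg
variable {F : Type*} [Field F] {δ : F}

/-- The quaternion order over `F[X]`. -/
abbrev HQ (F : Type*) [Field F] (δ : F) := ℍ[F[X], (C δ : F[X]), (0 : F[X]), (X : F[X])]

theorem norm_form_deg (hδ : ¬ IsSquare δ) (x y : F[X]) (h : x ≠ 0 ∨ y ≠ 0) :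
    x ^ 2 - C δ * y ^ 2 ≠ 0 ∧
      (x ^ 2 - C δ * y ^ 2).natDegree = 2 * max x.natDegree y.natDegree := by
  set n := max x.natDegree y.natDegree with hn
  have hx : x.natDegree ≤ n := le_max_left _ _
  have hy : y.natDegree ≤ n := le_max_right _ _
  have hcoeff : (x ^ 2 - C δ * y ^ 2).coeff (n + n) = x.coeff n ^ 2 - δ * y.coeff n ^ 2 := by
    rw [coeff_sub, coeff_C_mul, sq, sq, coeff_mul_add_eq_of_natDegree_le hx hx,
      coeff_mul_add_eq_of_natDegree_le hy hy]
    ring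
  have hne : x.coeff n ^ 2 - δ * y.coeff n ^ 2 ≠ 0 := by
    intro h0
    by_cases hyn : y.coeff n = 0
    · rw [hyn] at h0
      have hxn : x.coeff n = 0 := by
        have : x.coeff n ^ 2 = 0 := by linear_combination h0
        exact pow_eq_zero_iff (two_ne_zero) |>.1 this
      rcases max_choice x.natDegree y.natDegree with hc | hc
      · rw [← hn] at hc
        rw [hc, coeff_natDegree, leadingCoeff_eq_zero] at hxn
        rcases h with h | h
        · exact h hxn
        · subst hxn
          simp only [natDegree_zero] at hc
          have hy0 : y.natDegree = 0 := by omega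
          rw [hc, ← hy0, coeff_natDegree, leadingCoeff_eq_zero] at hyn
          exact h hyn
      · rw [← hn] at hc
        rw [hc, coeff_natDegree, leadingCoeff_eq_zero] at hyn
        rcases h with h | h
        · subst hyn
          simp only [natDegree_zero] at hc
          have hy0 : x.natDegree = 0 := by omega
          rw [hc, ← hy0, coeff_natDegree, leadingCoeff_eq_zero] at hxn
          exact h hxn
        · exact h hyn
    · apply hδ
      refine ⟨x.coeff n / y.coeff n, ?_⟩
      field_simp
      linear_combination -h0
  refine ⟨?_, ?_⟩
  · intro h0
    rw [h0] at hcoeff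
    exact hne (by rw [← hcoeff]; simp)
  · apply le_antisymm
    · refine (natDegree_sub_le _ _).trans (max_le ?_ ?_)
      · exact (natDegree_pow_le).trans (by omega)
      · refine (natDegree_C_mul_le _ _).trans ((natDegree_pow_le).trans (by omega))
    · rw [two_mul]
      apply le_natDegree_of_ne_zero
      rw [hcoeff]
      exact hne

theorem qN_eq (z : HQ F δ) : qN z = (z.re ^ 2 - C δ * z.imI ^ 2) - X * (z.imJ ^ 2 - C δ * z.imK ^ 2) := by
  simp only [qN]; ring

theorem qN_deg_aux (hδ : ¬ IsSquare δ) (x y z w : F[X]) :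
    ((x ^ 2 - C δ * y ^ 2) - X * (z ^ 2 - C δ * w ^ 2) = 0 → x = 0 ∧ y = 0 ∧ z = 0 ∧ w = 0) ∧
    (x ^ 2 - C δ * y ^ 2).natDegree ≤ ((x ^ 2 - C δ * y ^ 2) - X * (z ^ 2 - C δ * w ^ 2)).natDegree ∧
    ((z ≠ 0 ∨ w ≠ 0) → (z ^ 2 - C δ * w ^ 2).natDegree + 1 ≤
      ((x ^ 2 - C δ * y ^ 2) - X * (z ^ 2 - C δ * w ^ 2)).natDegree) := by
  by_cases hxy : x ≠ 0 ∨ y ≠ 0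
  · obtain ⟨hf0, hfd⟩ := norm_form_deg hδ x y hxy
    by_cases hzw : z ≠ 0 ∨ w ≠ 0
    · obtain ⟨hg0, hgd⟩ := norm_form_deg hδ z w hzw
      have hXd : (X * (z ^ 2 - C δ * w ^ 2)).natDegree = 2 * max z.natDegree w.natDegree + 1 := by
        rw [natDegree_X_mul hg0, hgd]
      rcases lt_trichotomy (x ^ 2 - C δ * y ^ 2).natDegree (X * (z ^ 2 - C δ * w ^ 2)).natDegree
        with hlt | heq | hgt
      · have h1 := natDegree_sub_eq_right_of_natDegree_lt hlt
        refine ⟨?_, by omega, fun _ => by omega⟩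
        intro h0
        rw [h0, natDegree_zero] at h1
        omega
      · omega
      · have h1 := natDegree_sub_eq_left_of_natDegree_lt hgt
        refine ⟨?_, by omega, fun _ => by omega⟩
        intro h0
        rw [h0, natDegree_zero] at h1
        omega
    · have hz : z = 0 ∧ w = 0 := by tauto
      obtain ⟨rfl, rfl⟩ := hz
      have : X * ((0 : F[X]) ^ 2 - C δ * 0 ^ 2) = 0 := by ring
      rw [this, sub_zero]
      exact ⟨fun h => absurd h hf0, le_rfl, fun h => absurd h hzw⟩
  · have hz : x = 0 ∧ y = 0 := by tauto
    obtain ⟨rfl, rfl⟩ := hz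
    have h0 : (0 : F[X]) ^ 2 - C δ * 0 ^ 2 = 0 := by ring
    rw [h0, zero_sub]
    by_cases hzw : z ≠ 0 ∨ w ≠ 0
    · obtain ⟨hg0, hgd⟩ := norm_form_deg hδ z w hzw
      refine ⟨?_, by simp, fun _ => ?_⟩
      · intro h
        rw [neg_eq_zero] at h
        exact absurd h (mul_ne_zero X_ne_zero hg0)
      · rw [natDegree_neg, natDegree_X_mul hg0]
    · have hz : z = 0 ∧ w = 0 := by tauto
      obtain ⟨rfl, rfl⟩ := hz
      exact ⟨fun _ => ⟨rfl, rfl, rfl, rfl⟩, by simp, fun h => absurd h hzw⟩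

theorem qN_eq_zero (hδ : ¬ IsSquare δ) {z : HQ F δ} (h : qN z = 0) : z = 0 := by
  rw [qN_eq] at h
  obtain ⟨h1, h2, h3, h4⟩ := (qN_deg_aux hδ _ _ _ _).1 h
  ext1 <;> simpa

theorem qN_ne_zero (hδ : ¬ IsSquare δ) {z : HQ F δ} (h : z ≠ 0) : qN z ≠ 0 :=
  fun h0 => h (qN_eq_zero hδ h0)

theorem norm_form_natDegree_le (hδ : ¬ IsSquare δ) {x y : F[X]} {k : ℕ}
    (h : (x ^ 2 - C δ * y ^ 2).natDegree ≤ k) : 2 * x.natDegree ≤ k ∧ 2 * y.natDegree ≤ k := by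
  by_cases hxy : x ≠ 0 ∨ y ≠ 0
  · have := (norm_form_deg hδ x y hxy).2
    have h1 := le_max_left x.natDegree y.natDegree
    have h2 := le_max_right x.natDegree y.natDegree
    omega
  · have hz : x = 0 ∧ y = 0 := by tauto
    obtain ⟨rfl, rfl⟩ := hz
    simp

theorem qN_deg (hδ : ¬ IsSquare δ) (z : HQ F δ) {k : ℕ} (hk : (qN z).natDegree ≤ k) :
    2 * z.re.natDegree ≤ k ∧ 2 * z.imI.natDegree ≤ k ∧
      (z.imJ ≠ 0 → 2 * z.imJ.natDegree + 1 ≤ k) ∧ (z.imK ≠ 0 → 2 * z.imK.natDegree + 1 ≤ k) := by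
  rw [qN_eq] at hk
  obtain ⟨-, h2, h3⟩ := qN_deg_aux hδ z.re z.imI z.imJ z.imK
  have h4 := norm_form_natDegree_le hδ (h2.trans hk)
  refine ⟨h4.1, h4.2, fun h => ?_, fun h => ?_⟩
  · have h5 := norm_form_natDegree_le hδ (le_refl (z.imJ ^ 2 - C δ * z.imK ^ 2).natDegree)
    have := h3 (Or.inl h)
    omega
  · have h5 := norm_form_natDegree_le hδ (le_refl (z.imJ ^ 2 - C δ * z.imK ^ 2).natDegree)
    have := h3 (Or.inr h)
    omega

theorem HQ_mul_eq_zero (hδ : ¬ IsSquare δ) {x y : HQ F δ} (h : x * y = 0) : x = 0 ∨ y = 0 := by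
  have := congrArg qN h
  rw [qN_mul, qN_zero, mul_eq_zero] at this
  exact this.imp (qN_eq_zero hδ) (qN_eq_zero hδ)

theorem HQ_cancel_right (hδ : ¬ IsSquare δ) {x y z : HQ F δ} (hz : z ≠ 0) (h : x * z = y * z) :
    x = y := by
  have : (x - y) * z = 0 := by rw [sub_mul, h, sub_self]
  exact sub_eq_zero.1 ((HQ_mul_eq_zero hδ this).resolve_right hz)

theorem HQ_cancel_left (hδ : ¬ IsSquare δ) {x y z : HQ F δ} (hz : z ≠ 0) (h : z * x = z * y) :
    x = y := by
  have : z * (x - y) = 0 := by rw [mul_sub, h, sub_self]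
  exact sub_eq_zero.1 ((HQ_mul_eq_zero hδ this).resolve_left hz)

theorem HQ_smul_cancel {f : F[X]} (hf : f ≠ 0) {x y : HQ F δ} (h : f • x = f • y) : x = y := by
  have h1 := congrArg QuaternionAlgebra.re h
  have h2 := congrArg QuaternionAlgebra.imI h
  have h3 := congrArg QuaternionAlgebra.imJ h
  have h4 := congrArg QuaternionAlgebra.imK h
  simp only [QuaternionAlgebra.re_smul, QuaternionAlgebra.imI_smul, QuaternionAlgebra.imJ_smul,
    QuaternionAlgebra.imK_smul, smul_eq_mul] at h1 h2 h3 h4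
  ext1
  · exact mul_left_cancel₀ hf h1
  · exact mul_left_cancel₀ hf h2
  · exact mul_left_cancel₀ hf h3
  · exact mul_left_cancel₀ hf h4

theorem HQ_divmod (hδ : ¬ IsSquare δ) (x y : HQ F δ) (hy : y ≠ 0) :
    ∃ q r : HQ F δ, x = q * y + r ∧ (r = 0 ∨ (qN r).natDegree < (qN y).natDegree) := by
  have hN := qN_ne_zero hδ hy
  set n := qN y with hn
  set u := x * star y with hu
  let q : HQ F δ := ⟨u.re / n, u.imI / n, u.imJ / n, u.imK / n⟩
  let v : HQ F δ := ⟨u.re % n, u.imI % n, u.imJ % n, u.imK % n⟩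
  have huv : u = n • q + v := by
    ext1 <;> simp [q, v, EuclideanDomain.div_add_mod]
  refine ⟨q, x - q * y, by abel, ?_⟩
  have hr : (x - q * y) * star y = v := by
    rw [sub_mul, mul_assoc, mul_star_qN, ← hu, ← hn, huv]
    simp
  by_cases h0 : n.natDegree = 0
  · left
    have hv : v = 0 := by
      have key : ∀ f : F[X], f % n = 0 := by
        intro f
        have := degree_mod_lt f hN
        rw [degree_eq_natDegree hN, h0] at this
        by_contra hne
        rw [degree_eq_natDegree hne] at this
        have := Nat.cast_lt.1 this
        omega
      ext1 <;> simp [v, key]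
    rw [hv] at hr
    refine (HQ_mul_eq_zero hδ hr).resolve_right ?_
    intro h
    apply hy
    rw [← star_star y, h, star_zero]
  · right
    have hd : ∀ f : F[X], (f % n).natDegree ≤ n.natDegree - 1 := by
      intro f
      have := natDegree_mod_lt f h0
      omega
    have hv : (qN v).natDegree ≤ 2 * (n.natDegree - 1) + 1 := by
      rw [qN_eq]
      have hsq : ∀ f : F[X], ((f % n) ^ 2).natDegree ≤ 2 * (n.natDegree - 1) := fun f =>
        natDegree_pow_le.trans (Nat.mul_le_mul_left 2 (hd f))
      have hf : ∀ f g : F[X], ((f % n) ^ 2 - C δ * (g % n) ^ 2).natDegree ≤ 2 * (n.natDegree - 1) := by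
        intro f g
        refine (natDegree_sub_le _ _).trans (max_le (hsq f) ?_)
        exact (natDegree_C_mul_le _ _).trans (hsq g)
      refine (natDegree_sub_le _ _).trans (max_le ((hf _ _).trans (by omega)) ?_)
      refine natDegree_mul_le.trans ?_
      rw [natDegree_X]
      have := hf u.imJ u.imK
      simp only [v]
      omega
    by_cases hr0 : x - q * y = 0
    · rw [hr0, qN_zero, natDegree_zero]; omega
    have := congrArg qN hr
    rw [qN_mul, qN_star] at this
    have h3 := congrArg natDegree this
    rw [natDegree_mul (qN_ne_zero hδ hr0) hN] at h3
    omega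

theorem HQ_gcd (hδ : ¬ IsSquare δ) (k : ℕ) : ∀ x y : HQ F δ, (qN y).natDegree < k →
    ∃ ρ s r x' y' : HQ F δ, ρ = s * x + r * y ∧ x = x' * ρ ∧ y = y' * ρ := by
  induction k with
  | zero => intro x y h; omega
  | succ k ih =>
    intro x y h
    by_cases hy : y = 0
    · subst hy
      exact ⟨x, 1, 0, 1, 0, by simp, by simp, by simp⟩
    obtain ⟨q, r, hx, hr⟩ := HQ_divmod hδ x y hy
    rcases hr with rfl | hr
    · exact ⟨y, 0, 1, q, 1, by simp, by simpa using hx, by simp⟩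
    · obtain ⟨ρ, s, t, y', r', h1, h2, h3⟩ := ih y r (by omega)
      refine ⟨ρ, t, s - t * q, q * y' + r', y', ?_, ?_, h2⟩
      · rw [h1, hx]
        noncomm_ring
      · rw [add_mul, mul_assoc, ← h2, ← h3, hx]

theorem HQ_unit (z : HQ F δ) {d : F} (hd : d ≠ 0) (h : qN z = C d) :
    ∃ w : HQ F δ, w * z = 1 ∧ z * w = 1 := by
  refine ⟨C d⁻¹ • star z, ?_, ?_⟩
  · rw [smul_mul_assoc, star_mul_qN, h, smul_smul, ← C_mul, inv_mul_cancel₀ hd]; simp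
  · rw [mul_smul_comm, mul_star_qN, h, smul_smul, ← C_mul, inv_mul_cancel₀ hd]; simp

end deg

end

section
open Polynomial Quaternion

section
variable {F : Type*} [Field F] [Fintype F] {δ : F}

theorem card_norm_form (hδ : ¬ IsSquare δ) (f : F[X]) (n : ℕ) (hn : f.natDegree ≤ n) :
    CardLE {u : F[X] × F[X] | u.1 ^ 2 - C δ * u.2 ^ 2 = f} (Fintype.card F ^ 2 * 2 ^ n) := by
  classical
  by_cases hf : f = 0
  · subst hf
    refine CardLE.mono (k := 1) (CardLE.subsingleton ?_) subset_rfl ?_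
    · have key : ∀ u ∈ {u : F[X] × F[X] | u.1 ^ 2 - C δ * u.2 ^ 2 = 0}, u = 0 := by
        intro u hu
        by_contra hne
        have : u.1 ≠ 0 ∨ u.2 ≠ 0 := by
          by_contra h
          push Not at h
          exact hne (Prod.ext h.1 h.2)
        exact (norm_form_deg hδ _ _ this).1 hu
      intro x hx y hy
      rw [key x hx, key y hy]
    · exact Nat.mul_pos (pow_pos Fintype.card_pos _) (by positivity)
  let K := AlgebraicClosure F
  obtain ⟨s, hs⟩ : ∃ s : K, s ^ 2 = algebraMap F K δ :=
    IsAlgClosed.exists_pow_nat_eq _ (by norm_num)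
  let φ : F[X] → K[X] := Polynomial.map (algebraMap F K)
  have hsF : ∀ a b : F, algebraMap F K a + s * algebraMap F K b = 0 → a = 0 ∧ b = 0 := by
    intro a b h
    have h1 : algebraMap F K (a ^ 2 - δ * b ^ 2) = 0 := by
      rw [map_sub, map_mul, map_pow, map_pow, ← hs]
      linear_combination (algebraMap F K a - s * algebraMap F K b) * h
    have h2 : a ^ 2 - δ * b ^ 2 = 0 := (map_eq_zero_iff _ (algebraMap F K).injective).1 h1
    by_cases hb : b = 0
    · subst hb
      refine ⟨?_, rfl⟩
      have : a ^ 2 = 0 := by linear_combination h2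
      exact pow_eq_zero_iff two_ne_zero |>.1 this
    · exfalso
      apply hδ
      refine ⟨a / b, ?_⟩
      field_simp
      linear_combination -h2
  let Z : F[X] × F[X] → K[X] := fun u => φ u.1 + C s * φ u.2
  have hZc : ∀ u i, (Z u).coeff i = algebraMap F K (u.1.coeff i) + s * algebraMap F K (u.2.coeff i) := by
    intro u i
    simp [Z, φ]
  have hZinj : ∀ u v, Z u = Z v → u = v := by
    intro u v h
    have key : ∀ i, u.1.coeff i = v.1.coeff i ∧ u.2.coeff i = v.2.coeff i := by
      intro i
      have h1 := congrArg (fun g => g.coeff i) h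
      simp only [hZc] at h1
      have := hsF (u.1.coeff i - v.1.coeff i) (u.2.coeff i - v.2.coeff i) (by
        rw [map_sub, map_sub]; linear_combination h1)
      exact ⟨sub_eq_zero.1 this.1, sub_eq_zero.1 this.2⟩
    ext i
    · exact (key i).1
    · exact (key i).2
  have hφf : φ f ≠ 0 := by
    simp only [φ]
    exact (Polynomial.map_ne_zero_iff (algebraMap F K).injective).2 hf
  have hdvd : ∀ u : F[X] × F[X], u.1 ^ 2 - C δ * u.2 ^ 2 = f → Z u ∣ φ f := by
    intro u hu
    refine ⟨φ u.1 - C s * φ u.2, ?_⟩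
    rw [← hu]
    simp only [φ, Z, Polynomial.map_sub, Polynomial.map_mul, Polynomial.map_pow, map_C, ← hs, C_pow]
    ring
  have hD := monic_divisors_card n (φ f) hφf (by
    simp only [φ]
    rw [natDegree_map]; exact hn)
  have hFF := CardLE.univ (Set.univ : Set (F × F))
  rw [Fintype.card_prod, ← sq] at hFF
  refine CardLE.inj (hFF.prod hD)
    (fun u => ((u.1.coeff (Z u).natDegree, u.2.coeff (Z u).natDegree),
      C (Z u).leadingCoeff⁻¹ * Z u)) ?_ ?_
  · intro u hu
    have hd := hdvd u hu
    have hZ0 : Z u ≠ 0 := fun h => hφf (by rw [h] at hd; exact zero_dvd_iff.1 hd)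
    refine ⟨trivial, ?_, ?_⟩
    · rw [mul_comm]
      exact monic_mul_leadingCoeff_inv hZ0
    · have hlc : (Z u).leadingCoeff⁻¹ ≠ 0 := inv_ne_zero (leadingCoeff_ne_zero.2 hZ0)
      exact (C_mul_dvd hlc).2 hd
  · intro u hu v hv h
    simp only [Prod.mk.injEq] at h
    obtain ⟨⟨h1, h2⟩, h3⟩ := h
    have hlc : ∀ u : F[X] × F[X], u.1 ^ 2 - C δ * u.2 ^ 2 = f → (Z u).leadingCoeff ≠ 0 := by
      intro u hu
      have hd := hdvd u hu
      exact leadingCoeff_ne_zero.2 fun h => hφf (by rw [h] at hd; exact zero_dvd_iff.1 hd)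
    have e : ∀ u : F[X] × F[X], (Z u).leadingCoeff = algebraMap F K (u.1.coeff (Z u).natDegree)
        + s * algebraMap F K (u.2.coeff (Z u).natDegree) := fun u => hZc u _
    have e2 : (Z u).leadingCoeff = (Z v).leadingCoeff := by rw [e u, e v, h1, h2]
    apply hZinj
    rw [e2] at h3
    exact mul_left_cancel₀ (by simpa using hlc v hv) h3

theorem degree_lt_of_natDegree_lt {f : F[X]} {n : ℕ} (h : f ≠ 0 → f.natDegree < n) : f.degree < n := by
  by_cases hf : f = 0
  · subst hf; simp
  · rw [degree_eq_natDegree hf]; exact_mod_cast h hf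

/-- elements of given norm -/
theorem card_norm_eq (hδ : ¬ IsSquare δ) (h : F[X]) (e : ℕ) (he : h.natDegree ≤ e) :
    CardLE {ρ : HQ F δ | qN ρ = h} (Fintype.card F ^ (e + 3) * 2 ^ e) := by
  set q := Fintype.card F with hq
  have hq0 : 0 < q := Fintype.card_pos
  have h1 := (card_degree_lt (F := F) ((e + 1) / 2)).prod (card_degree_lt (F := F) ((e + 1) / 2))
  have h2 : CardLE {ρ : HQ F δ | qN ρ = h}
      (q ^ ((e + 1) / 2) * q ^ ((e + 1) / 2) * (q ^ 2 * 2 ^ e)) := by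
    refine CardLE.fiber h1 (fun ρ => (ρ.imJ, ρ.imK)) ?_ ?_
    · intro ρ hρ
      obtain ⟨-, -, h3, h4⟩ := qN_deg hδ ρ (k := e) (by rw [show qN ρ = h from hρ]; exact he)
      constructor
      · exact degree_lt_of_natDegree_lt fun hh => by have := h3 hh; show ρ.imJ.natDegree < _; omega
      · exact degree_lt_of_natDegree_lt fun hh => by have := h4 hh; show ρ.imK.natDegree < _; omega
    · rintro ⟨z, w⟩ -
      by_cases hne : ∃ ρ : HQ F δ, qN ρ = h ∧ (ρ.imJ, ρ.imK) = (z, w)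
      · obtain ⟨ρ, hρ, hzw⟩ := hne
        have hdeg : (h + X * (z ^ 2 - C δ * w ^ 2)).natDegree ≤ e := by
          obtain ⟨-, h5, -⟩ := qN_deg_aux hδ ρ.re ρ.imI ρ.imJ ρ.imK
          rw [← qN_eq, hρ] at h5
          rw [qN_eq] at hρ
          simp only [Prod.mk.injEq] at hzw
          rw [hzw.1, hzw.2] at hρ
          rw [← hρ]
          simp only [sub_add_cancel]
          exact h5.trans he
        refine CardLE.inj (card_norm_form hδ _ e hdeg) (fun ρ => (ρ.re, ρ.imI)) ?_ ?_
        · rintro ρ' ⟨h6, h7⟩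
          simp only [Prod.mk.injEq] at h7
          have h6' : qN ρ' = h := h6
          rw [qN_eq, h7.1, h7.2] at h6'
          simp only [Set.mem_ofPred_eq]
          linear_combination h6'
        · rintro ρ1 ⟨-, h7⟩ ρ2 ⟨-, h8⟩ h9
          simp only [Prod.mk.injEq] at h7 h8 h9
          ext1
          · exact h9.1
          · exact h9.2
          · rw [h7.1, h8.1]
          · rw [h7.2, h8.2]
      · refine CardLE.empty ?_ _
        rintro ρ ⟨h6, h7⟩
        exact hne ⟨ρ, h6, h7⟩
  refine h2.mono subset_rfl ?_
  rw [← pow_add, ← mul_assoc, ← pow_add]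
  exact Nat.mul_le_mul_right _ (Nat.pow_le_pow_right hq0 (by omega))

theorem card_units (hδ : ¬ IsSquare δ) :
    CardLE {u : HQ F δ | (qN u).natDegree = 0} (Fintype.card F ^ 2) := by
  have hFF := CardLE.univ (Set.univ : Set (F × F))
  rw [Fintype.card_prod, ← sq] at hFF
  have key : ∀ u : HQ F δ, (qN u).natDegree = 0 → u = ⟨C (u.re.coeff 0), C (u.imI.coeff 0), 0, 0⟩ := by
    intro u hu
    obtain ⟨h1, h2, h3, h4⟩ := qN_deg hδ u (k := 0) (by omega)
    ext1
    · exact eq_C_of_natDegree_eq_zero (by omega)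
    · exact eq_C_of_natDegree_eq_zero (by omega)
    · by_contra hh; have := h3 hh; omega
    · by_contra hh; have := h4 hh; omega
  refine CardLE.inj hFF (fun u => (u.re.coeff 0, u.imI.coeff 0)) (fun _ _ => trivial) ?_
  intro u hu v hv h
  simp only [Prod.mk.injEq] at h
  rw [key u hu, key v hv, h.1, h.2]

end

end

section
open Polynomial Quaternion

section
variable {F : Type*} [Field F] {δ : F}

/-- Pairs of pure quaternions with given Gram matrix. -/
def GPairs (δ : F) (DA DB E : F[X]) : Set (HQ F δ × HQ F δ) :=
  {u | u.1.re = 0 ∧ u.2.re = 0 ∧ qN u.1 = DA ∧ qN u.2 = DB ∧ (u.1 * star u.2).re = E}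

/-- the pure part of the product -/
noncomputable def crossQ (A B : HQ F δ) : HQ F δ := A * B + (A * star B).re • (1 : HQ F δ)

theorem crossQ_re {A B : HQ F δ} (hA : A.re = 0) (hB : B.re = 0) : (crossQ A B).re = 0 := by
  simp [crossQ, hA, hB]; ring

theorem crossQ_anti {A B : HQ F δ} (hA : A.re = 0) (hB : B.re = 0) :
    A * crossQ A B = -(crossQ A B * A) := by
  ext1 <;> simp [crossQ, hA, hB] <;> ring

theorem qN_crossQ {A B : HQ F δ} (hA : A.re = 0) (hB : B.re = 0) :
    qN (crossQ A B) = qN A * qN B - (A * star B).re ^ 2 := by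
  simp [crossQ, hA, hB, qN]; ring

theorem crossQ_mul {A B : HQ F δ} (hA : A.re = 0) (hB : B.re = 0) :
    qN A • B = crossQ A B * A + (A * star B).re • A := by
  ext1 <;> simp [crossQ, hA, hB, qN] <;> ring

theorem smul_two_zero (h2 : (2 : F) ≠ 0) {x : HQ F δ} (h : x + x = 0) : x = 0 := by
  have h2' : (2 : F[X]) ≠ 0 := by
    rw [show (2 : F[X]) = C 2 from (map_ofNat C 2).symm]; exact C_ne_zero.2 h2
  apply HQ_smul_cancel h2'
  rw [smul_zero, ← h]
  module

theorem skolem (hδ : ¬ IsSquare δ) (h2 : (2 : F) ≠ 0) {DA DB E : F[X]} {A B A0 B0 : HQ F δ}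
    (h : (A, B) ∈ GPairs δ DA DB E) (h0 : (A0, B0) ∈ GPairs δ DA DB E)
    (hΔ : DA * DB - E ^ 2 ≠ 0) : ∃ ρ : HQ F δ, ρ ≠ 0 ∧ A * ρ = ρ * A0 ∧ B * ρ = ρ * B0 := by
  obtain ⟨hA, hB, hDA, hDB, hE⟩ := h
  obtain ⟨hA0, hB0, hDA0, hDB0, hE0⟩ := h0
  simp only at hA hB hDA hDB hE hA0 hB0 hDA0 hDB0 hE0
  set n := crossQ A B with hn
  set n0 := crossQ A0 B0 with hn0
  have hnn : n * n = -((DA * DB - E ^ 2) • (1 : HQ F δ)) := by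
    rw [sq_pure (crossQ_re hA hB), qN_crossQ hA hB, hDA, hDB, hE]
  have hnn0 : n0 * n0 = -((DA * DB - E ^ 2) • (1 : HQ F δ)) := by
    rw [sq_pure (crossQ_re hA0 hB0), qN_crossQ hA0 hB0, hDA0, hDB0, hE0]
  have hAA : A * A = -(DA • (1 : HQ F δ)) := by rw [sq_pure hA, hDA]
  have hAA0 : A0 * A0 = -(DA • (1 : HQ F δ)) := by rw [sq_pure hA0, hDA0]
  have hAn : A * n = -(n * A) := crossQ_anti hA hB
  have hAn0 : A0 * n0 = -(n0 * A0) := crossQ_anti hA0 hB0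
  have hn_ne : n ≠ 0 := by
    intro h
    have : qN n = 0 := by rw [h, qN_zero]
    rw [hn, qN_crossQ hA hB, hDA, hDB, hE] at this
    exact hΔ this
  have hA_ne : A ≠ 0 := by
    intro h
    apply hn_ne
    rw [hn, crossQ, h]; simp
  have hDA_ne : DA ≠ 0 := by rw [← hDA]; exact qN_ne_zero hδ hA_ne
  let f : HQ F δ → HQ F δ := fun x => A * x - x * A0
  have hfA : ∀ x, A * f x = -(f x * A0) := by
    intro x
    simp only [f, mul_sub, sub_mul]
    rw [← mul_assoc, hAA, mul_assoc x, hAA0]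
    simp only [neg_mul, smul_mul_assoc, one_mul, mul_neg, mul_smul_comm, mul_one]
    noncomm_ring
  have hfA2 : ∀ x, f (A * x) = A * f x := by
    intro x
    simp only [f]; noncomm_ring
  obtain ⟨x, hx⟩ : ∃ x, n * f x + f x * n0 ≠ 0 := by
    by_contra hall
    push Not at hall
    have hf0 : ∀ x, f x = 0 := by
      intro x
      have e1 := hall (A * x)
      rw [hfA2] at e1
      have e2 := hall x
      have e3 : f x * n0 = -(n * f x) := by
        rw [eq_neg_iff_add_eq_zero, add_comm]; exact e2
      rw [mul_assoc A, e3, mul_neg, ← mul_assoc, ← mul_assoc, hAn, neg_mul, neg_neg] at e1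
      have e4 := smul_two_zero h2 e1
      rcases HQ_mul_eq_zero hδ e4 with h | h
      · rcases HQ_mul_eq_zero hδ h with h | h
        · exact absurd h hn_ne
        · exact absurd h hA_ne
      · exact h
    have e1 : A = A0 := by
      have := hf0 1
      simp only [f, mul_one, one_mul] at this
      exact sub_eq_zero.1 this
    have e2 : A * n = n * A := by
      have := hf0 n
      simp only [f, ← e1] at this
      exact sub_eq_zero.1 this
    have e3 : n * A + n * A = 0 := by
      nth_rewrite 1 [← e2]
      rw [hAn]; simp
    rcases HQ_mul_eq_zero hδ (smul_two_zero h2 e3) with h | h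
    · exact hn_ne h
    · exact hA_ne h
  refine ⟨n * f x + f x * n0, hx, ?_, ?_⟩
  all_goals
    have hg1 : A * (n * f x + f x * n0) = (n * f x + f x * n0) * A0 := by
      rw [mul_add, add_mul, ← mul_assoc, hAn, neg_mul, mul_assoc, hfA, ← mul_assoc, hfA,
        mul_assoc (f x) n0, mul_neg, neg_neg, neg_mul, mul_assoc (f x) A0, hAn0]
      noncomm_ring
  · exact hg1
  have hg2 : n * (n * f x + f x * n0) = (n * f x + f x * n0) * n0 := by
    rw [mul_add, add_mul, ← mul_assoc, hnn, mul_assoc (f x) n0, hnn0]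
    simp only [neg_mul, smul_mul_assoc, one_mul, mul_neg, mul_smul_comm, mul_one]
    rw [mul_assoc]; abel
  generalize n * f x + f x * n0 = g at hg1 hg2 hx
  apply HQ_smul_cancel hDA_ne
  rw [← smul_mul_assoc, ← mul_smul_comm]
  have e1 := crossQ_mul hA hB
  have e2 := crossQ_mul hA0 hB0
  rw [hDA, hE, ← hn] at e1
  rw [hDA0, hE0, ← hn0] at e2
  rw [e1, e2, add_mul, mul_assoc, hg1, ← mul_assoc, hg2, mul_add, mul_assoc, smul_mul_assoc, hg1,
    mul_smul_comm]

/-- conjugation by `j` -/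
noncomputable def jconj (A : HQ F δ) : HQ F δ := ⟨A.re, -A.imI, A.imJ, -A.imK⟩

/-- the element `j` -/
noncomputable def jQ (δ : F) : HQ F δ := ⟨0, 0, 1, 0⟩

theorem mul_jQ (A : HQ F δ) : A * jQ δ = jQ δ * jconj A := by
  ext1 <;> simp [jQ, jconj]

theorem jconj_jconj (A : HQ F δ) : jconj (jconj A) = A := by
  ext1 <;> simp [jconj]

theorem qN_jQ : qN (jQ δ) = -X := by simp [qN, jQ]

theorem jQ_ne : jQ δ ≠ 0 := by
  intro h
  have := congrArg QuaternionAlgebra.imJ h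
  simp [jQ] at this

/-- A minimal intertwiner. -/
theorem exists_good_rho (hδ : ¬ IsSquare δ) (h2 : (2 : F) ≠ 0) {DA DB E : F[X]}
    {A B A0 B0 : HQ F δ}
    (h : (A, B) ∈ GPairs δ DA DB E) (h0 : (A0, B0) ∈ GPairs δ DA DB E)
    (hΔ : DA * DB - E ^ 2 ≠ 0) :
    ∃ (ρ c : HQ F δ), ρ ≠ 0 ∧
      ((A * ρ = ρ * A0 ∧ B * ρ = ρ * B0) ∨ (jconj A * ρ = ρ * A0 ∧ jconj B * ρ = ρ * B0)) ∧
      (c * ρ).re = 1 := by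
  classical
  let Q : HQ F δ → Prop := fun ρ => ρ ≠ 0 ∧
      ((A * ρ = ρ * A0 ∧ B * ρ = ρ * B0) ∨ (jconj A * ρ = ρ * A0 ∧ jconj B * ρ = ρ * B0))
  have hex : ∃ k, ∃ ρ, Q ρ ∧ (qN ρ).natDegree = k := by
    obtain ⟨ρ, h1, h3⟩ := skolem hδ h2 h h0 hΔ
    exact ⟨_, ρ, ⟨h1, Or.inl h3⟩, rfl⟩
  obtain ⟨ρ, hρ, hk⟩ := Nat.find_spec hex
  have hmin : ∀ ρ', Q ρ' → (qN ρ).natDegree ≤ (qN ρ').natDegree := by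
    intro ρ' h'
    rw [hk]
    exact Nat.find_min' hex ⟨ρ', h', rfl⟩
  suffices hgc : ∃ c0 c1 c2 c3 : F[X], c0 * ρ.re + c1 * ρ.imI + c2 * (X * ρ.imJ) + c3 * (X * ρ.imK) = 1 by
    obtain ⟨c0, c1, c2, c3, hc⟩ := hgc
    have hδ0 : δ ≠ 0 := fun h => hδ (by rw [h]; exact ⟨0, by simp⟩)
    refine ⟨ρ, ⟨c0, C δ⁻¹ * c1, c2, -C δ⁻¹ * c3⟩, hρ.1, hρ.2, ?_⟩
    have hCC : C δ * C δ⁻¹ = (1 : F[X]) := by rw [← C_mul, mul_inv_cancel₀ hδ0, C_1]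
    simp only [QuaternionAlgebra.re_mul]
    linear_combination hc + (c1 * ρ.imI + c3 * (X * ρ.imK)) * hCC
  set g1 := EuclideanDomain.gcd ρ.re ρ.imI with hg1
  set g2 := EuclideanDomain.gcd (X * ρ.imJ) (X * ρ.imK) with hg2
  set g := EuclideanDomain.gcd g1 g2 with hg
  have b1 := EuclideanDomain.gcd_eq_gcd_ab ρ.re ρ.imI
  have b2 := EuclideanDomain.gcd_eq_gcd_ab (X * ρ.imJ) (X * ρ.imK)
  have b3 := EuclideanDomain.gcd_eq_gcd_ab g1 g2
  rw [← hg1] at b1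
  rw [← hg2] at b2
  rw [← hg] at b3
  by_cases hu : IsUnit g
  · obtain ⟨v, hv⟩ := hu.exists_left_inv
    refine ⟨v * (EuclideanDomain.gcdA g1 g2 * EuclideanDomain.gcdA ρ.re ρ.imI),
      v * (EuclideanDomain.gcdA g1 g2 * EuclideanDomain.gcdB ρ.re ρ.imI),
      v * (EuclideanDomain.gcdB g1 g2 * EuclideanDomain.gcdA (X * ρ.imJ) (X * ρ.imK)),
      v * (EuclideanDomain.gcdB g1 g2 * EuclideanDomain.gcdB (X * ρ.imJ) (X * ρ.imK)), ?_⟩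
    rw [← hv, b3]
    linear_combination (-v * EuclideanDomain.gcdA g1 g2) * b1 - v * EuclideanDomain.gcdB g1 g2 * b2
  exfalso
  have d1 : g ∣ ρ.re := (EuclideanDomain.gcd_dvd_left g1 g2).trans (EuclideanDomain.gcd_dvd_left _ _)
  have d2 : g ∣ ρ.imI := (EuclideanDomain.gcd_dvd_left g1 g2).trans (EuclideanDomain.gcd_dvd_right _ _)
  have d3 : g ∣ X * ρ.imJ := (EuclideanDomain.gcd_dvd_right g1 g2).trans (EuclideanDomain.gcd_dvd_left _ _)
  have d4 : g ∣ X * ρ.imK := (EuclideanDomain.gcd_dvd_right g1 g2).trans (EuclideanDomain.gcd_dvd_right _ _)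
  obtain ⟨l, hlm, hl, hlg⟩ := exists_monic_irreducible_factor g hu
  by_cases hX : l ∣ X
  · -- `ρ = j ρ'`
    have hXl : X ∣ l := (prime_X.irreducible.dvd_symm hl) |> fun h => (hl.dvd_symm prime_X.irreducible hX)
    obtain ⟨r1, hr1⟩ := (hXl.trans hlg).trans d1
    obtain ⟨r2, hr2⟩ := (hXl.trans hlg).trans d2
    let ρ' : HQ F δ := ⟨ρ.imJ, -ρ.imK, r1, -r2⟩
    have hρ' : ρ = jQ δ * ρ' := by
      ext1 <;> simp [jQ, ρ', hr1, hr2]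
    have hne : ρ' ≠ 0 := by
      intro h
      apply hρ.1
      rw [hρ', h, mul_zero]
    have hQ : Q ρ' := by
      refine ⟨hne, ?_⟩
      have key : ∀ Z Z0 : HQ F δ, Z * ρ = ρ * Z0 → jconj Z * ρ' = ρ' * Z0 := by
        intro Z Z0 hZ
        rw [hρ', ← mul_assoc, mul_jQ, mul_assoc, mul_assoc] at hZ
        exact HQ_cancel_left hδ jQ_ne hZ
      rcases hρ.2 with ⟨e1, e2⟩ | ⟨e1, e2⟩
      · exact Or.inr ⟨key _ _ e1, key _ _ e2⟩
      · refine Or.inl ⟨?_, ?_⟩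
        · have := key _ _ e1
          rwa [jconj_jconj] at this
        · have := key _ _ e2
          rwa [jconj_jconj] at this
    have := hmin ρ' hQ
    rw [hρ', qN_mul, qN_jQ, natDegree_mul (by simp) (qN_ne_zero hδ hne), natDegree_neg, natDegree_X] at this
    omega
  · have hd : SDvd l ρ := by
      rw [sdvd_iff]
      exact ⟨hlg.trans d1, hlg.trans d2, (hl.prime.dvd_or_dvd (hlg.trans d3)).resolve_left hX,
        (hl.prime.dvd_or_dvd (hlg.trans d4)).resolve_left hX⟩
    obtain ⟨ρ', hρ'⟩ := hd
    have hne : ρ' ≠ 0 := by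
      intro h
      apply hρ.1
      rw [hρ', h, smul_zero]
    have hQ : Q ρ' := by
      refine ⟨hne, ?_⟩
      have key : ∀ Z Z0 : HQ F δ, Z * ρ = ρ * Z0 → Z * ρ' = ρ' * Z0 := by
        intro Z Z0 hZ
        rw [hρ', mul_smul_comm, smul_mul_assoc] at hZ
        exact HQ_smul_cancel hl.ne_zero hZ
      rcases hρ.2 with ⟨e1, e2⟩ | ⟨e1, e2⟩
      · exact Or.inl ⟨key _ _ e1, key _ _ e2⟩
      · exact Or.inr ⟨key _ _ e1, key _ _ e2⟩
    have := hmin ρ' hQ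
    rw [hρ', qN_smul, natDegree_mul (pow_ne_zero _ hl.ne_zero) (qN_ne_zero hδ hne), natDegree_pow] at this
    have := hl.natDegree_pos
    omega

end

end

section
open Polynomial Quaternion

section
variable {F : Type*} [Field F] {δ : F}

theorem dvd_of_prime_pow {a b : F[X]} (ha : a ≠ 0)
    (h : ∀ l : F[X], Irreducible l → ∀ k : ℕ, l ^ k ∣ a → l ^ k ∣ b) : a ∣ b := by
  rw [UniqueFactorizationMonoid.dvd_iff_emultiplicity_le ha]
  intro p hp
  exact emultiplicity_le_emultiplicity_iff.2 (fun k hk => h p hp.irreducible k hk)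

theorem irr_pow_cases {l x y : F[X]} (hl : Irreducible l) {a : ℕ} (h : l ^ a ∣ x * y)
    (hxy : ¬ (l ∣ x ∧ l ∣ y)) : l ^ a ∣ x ∨ l ^ a ∣ y := by
  by_cases hx : l ∣ x
  · have hy : ¬ l ∣ y := fun hy => hxy ⟨hx, hy⟩
    left
    exact (IsCoprime.pow_left ((hl.coprime_iff_not_dvd).2 hy)).dvd_of_dvd_mul_right h
  · right
    exact (IsCoprime.pow_left ((hl.coprime_iff_not_dvd).2 hx)).dvd_of_dvd_mul_left h

theorem two_ne (h2 : (2 : F) ≠ 0) : (2 : F[X]) ≠ 0 := by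
  rw [show (2 : F[X]) = C 2 from (map_ofNat C 2).symm]; exact C_ne_zero.2 h2

theorem dvd_of_two (h2 : (2 : F) ≠ 0) {l x : F[X]} (h : l ∣ 2 * x) : l ∣ x := by
  have : IsUnit (2 : F[X]) := by
    rw [show (2 : F[X]) = C 2 from (map_ofNat C 2).symm]
    exact isUnit_C.2 (isUnit_iff_ne_zero.2 h2)
  exact (this.dvd_mul_left).1 h

/-- solutions of the lifting system -/
structure IsSol (DA DB E N l m : F[X]) : Prop where
  a : N ∣ l ^ 2 + DA
  b : N ∣ m ^ 2 + DB
  e : N ∣ l * m + E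

theorem IsSol.swap {DA DB E N l m : F[X]} (h : IsSol DA DB E N l m) : IsSol DB DA E N m l :=
  ⟨h.b, h.a, by rw [mul_comm]; exact h.e⟩

/-- no square content -/
def NoSq (DA DB E : F[X]) : Prop :=
  ∀ l : F[X], Irreducible l → l ^ 2 ∣ DA → l ^ 2 ∣ DB → l ^ 2 ∣ E → False

theorem sol_aux (h2 : (2 : F) ≠ 0) {DA DB E N l m l' m' : F[X]} (h : IsSol DA DB E N l m)
    (h' : IsSol DA DB E N l' m') {r : F[X]} (hr : Irreducible r) {a : ℕ} (ha : r ^ a ∣ N)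
    (hl : ¬ r ∣ l) :
    (r ^ a ∣ l - l' ∧ r ^ a ∣ m - m') ∨ (r ^ a ∣ l + l' ∧ r ^ a ∣ m + m') := by
  have e1 : r ^ a ∣ (l - l') * (l + l') := by
    have := dvd_sub (ha.trans h.a) (ha.trans h'.a)
    convert this using 1; ring
  have e2 : r ^ a ∣ l * m - l' * m' := by
    have := dvd_sub (ha.trans h.e) (ha.trans h'.e)
    convert this using 1; ring
  have hcop : IsCoprime (r ^ a) l := IsCoprime.pow_left ((hr.coprime_iff_not_dvd).2 hl)
  rcases irr_pow_cases hr e1 (by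
    rintro ⟨h3, h4⟩
    apply hl
    apply dvd_of_two h2
    have := dvd_add h3 h4
    convert this using 1; ring) with h3 | h3
  · left
    refine ⟨h3, hcop.dvd_of_dvd_mul_left ?_⟩
    have := dvd_sub e2 (h3.mul_right m')
    convert this using 1; ring
  · right
    refine ⟨h3, hcop.dvd_of_dvd_mul_left ?_⟩
    have := dvd_add e2 (h3.mul_right m')
    convert this using 1; ring

theorem sol_dich (h2 : (2 : F) ≠ 0) {DA DB E N l m l' m' : F[X]} (h : IsSol DA DB E N l m)
    (hns : NoSq DA DB E)
    (h' : IsSol DA DB E N l' m') {r : F[X]} (hr : Irreducible r) {a : ℕ} (ha : r ^ a ∣ N) :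
    (r ^ a ∣ l - l' ∧ r ^ a ∣ m - m') ∨ (r ^ a ∣ l + l' ∧ r ^ a ∣ m + m') := by
  by_cases hl : r ∣ l
  swap
  · exact sol_aux h2 h h' hr ha hl
  by_cases hm : r ∣ m
  swap
  · exact (sol_aux h2 h.swap h'.swap hr ha hm).imp And.symm And.symm
  rcases Nat.lt_or_ge a 2 with h3 | h3
  · interval_cases a
    · left; simp
    · rw [pow_one] at ha ⊢
      left
      have hl2 : r ∣ l' := by
        apply hr.prime.dvd_of_dvd_pow (n := 2)
        have := dvd_sub (ha.trans h'.a) (dvd_sub (ha.trans h.a) (hl.mul_right l))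
        convert this using 1; ring
      have hm2 : r ∣ m' := by
        apply hr.prime.dvd_of_dvd_pow (n := 2)
        have := dvd_sub (ha.trans h'.b) (dvd_sub (ha.trans h.b) (hm.mul_right m))
        convert this using 1; ring
      exact ⟨dvd_sub hl hl2, dvd_sub hm hm2⟩
  · exfalso
    have hN : r ^ 2 ∣ N := (pow_dvd_pow r h3).trans ha
    obtain ⟨x, rfl⟩ := hl
    obtain ⟨y, rfl⟩ := hm
    refine hns r hr ?_ ?_ ?_
    · have := dvd_sub (hN.trans h.a) (Dvd.intro (x ^ 2) rfl)
      convert this using 1; ring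
    · have := dvd_sub (hN.trans h.b) (Dvd.intro (y ^ 2) rfl)
      convert this using 1; ring
    · have := dvd_sub (hN.trans h.e) (Dvd.intro (x * y) rfl)
      convert this using 1; ring

theorem sol_inj (h2 : (2 : F) ≠ 0) {DA DB E N l m l' m' l'' m'' : F[X]} (hN : N ≠ 0)
    (h : IsSol DA DB E N l m)
    (hns : NoSq DA DB E) (h' : IsSol DA DB E N l' m') (h'' : IsSol DA DB E N l'' m'')
    (hg : ∀ d, d ∣ N → ((d ∣ l - l' ∧ d ∣ m - m') ↔ (d ∣ l - l'' ∧ d ∣ m - m''))) :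
    N ∣ l' - l'' ∧ N ∣ m' - m'' := by
  have key : ∀ r : F[X], Irreducible r → ∀ k : ℕ, r ^ k ∣ N → (r ^ k ∣ l' - l'' ∧ r ^ k ∣ m' - m'') := by
    intro r hr k hk
    have cmp := hg _ hk
    have A : (r ^ k ∣ l - l' ∧ r ^ k ∣ m - m') → (r ^ k ∣ l' - l'' ∧ r ^ k ∣ m' - m'') := by
      intro h3
      have h4 := cmp.1 h3
      constructor
      · have := dvd_sub h4.1 h3.1
        convert this using 1; ring
      · have := dvd_sub h4.2 h3.2
        convert this using 1; ring
    rcases sol_dich h2 h hns h' hr hk with h3 | h3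
    · exact A h3
    · rcases sol_dich h2 h hns h'' hr hk with h4 | h4
      · exact A (cmp.2 h4)
      · constructor
        · have := dvd_sub h3.1 h4.1
          convert this using 1; ring
        · have := dvd_sub h3.2 h4.2
          convert this using 1; ring
  exact ⟨dvd_of_prime_pow hN fun l hl k hk => (key l hl k hk).1,
    dvd_of_prime_pow hN fun l hl k hk => (key l hl k hk).2⟩

theorem card_sol (h2 : (2 : F) ≠ 0) {DA DB E N : F[X]} (hN : N ≠ 0) (hns : NoSq DA DB E) {k : ℕ}
    (hk : CardLE {d : F[X] | d.Monic ∧ d ∣ N} k) :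
    CardLE {u : F[X] × F[X] | u.1.degree < N.degree ∧ u.2.degree < N.degree ∧
      IsSol DA DB E N u.1 u.2} k := by
  classical
  apply CardLE.of_base
  rintro ⟨l, m⟩ ⟨h1, h3, h4⟩
  refine CardLE.inj hk (fun u => normalize (EuclideanDomain.gcd N
    (EuclideanDomain.gcd (l - u.1) (m - u.2)))) ?_ ?_
  · rintro ⟨l', m'⟩ -
    refine ⟨monic_normalize ?_, ?_⟩
    · intro h
      exact hN (EuclideanDomain.gcd_eq_zero_iff.1 h).1
    · rw [normalize_dvd_iff]; exact EuclideanDomain.gcd_dvd_left _ _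
  · rintro ⟨l', m'⟩ ⟨a1, a2, a3⟩ ⟨l'', m''⟩ ⟨b1, b2, b3⟩ hh
    simp only at a1 a2 a3 b1 b2 b3 hh h1 h3 h4
    have cmp : ∀ d, d ∣ N → ((d ∣ l - l' ∧ d ∣ m - m') ↔ (d ∣ l - l'' ∧ d ∣ m - m'')) := by
      intro d hd
      have e : ∀ x y : F[X], (d ∣ x ∧ d ∣ y) ↔
          d ∣ normalize (EuclideanDomain.gcd N (EuclideanDomain.gcd x y)) := by
        intro x y
        rw [dvd_normalize_iff]
        constructor
        · rintro ⟨hx, hy⟩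
          exact EuclideanDomain.dvd_gcd hd (EuclideanDomain.dvd_gcd hx hy)
        · intro h
          have h' := h.trans (EuclideanDomain.gcd_dvd_right _ _)
          exact ⟨h'.trans (EuclideanDomain.gcd_dvd_left _ _),
            h'.trans (EuclideanDomain.gcd_dvd_right _ _)⟩
      rw [e, e, hh]
    obtain ⟨c1, c2⟩ := sol_inj h2 hN h4 hns a3 b3 cmp
    have z1 : l' - l'' = 0 := eq_zero_of_dvd_of_degree_lt c1 ((degree_sub_le _ _).trans_lt (max_lt a1 b1))
    have z2 : m' - m'' = 0 := eq_zero_of_dvd_of_degree_lt c2 ((degree_sub_le _ _).trans_lt (max_lt a2 b2))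
    rw [sub_eq_zero] at z1 z2
    rw [z1, z2]

/-- left multiples -/
theorem base_left (h2 : (2 : F) ≠ 0) {A0 A1 ρ c : HQ F δ} (hA0 : A0.re = 0)
    (h : A1 * ρ = ρ * A0) (hc : (c * ρ).re = 1) :
    ∃ (s : HQ F δ) (l : F[X]), A0 - l • (1 : HQ F δ) = s * ρ := by
  have key : A0 * (c * ρ) + (c * ρ) * A0 = (2 : F[X]) • A0 + (2 * (A0 * (c * ρ)).re) • (1 : HQ F δ) := by
    generalize c * ρ = w at hc
    ext1 <;> simp [hA0, hc] <;> ring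
  have key2 : (A0 * c + c * A1) * ρ = A0 * (c * ρ) + (c * ρ) * A0 := by
    rw [add_mul, mul_assoc, mul_assoc, mul_assoc, h]
  have hCC : C (2⁻¹ : F) * 2 = 1 := by
    rw [show (2 : F[X]) = C 2 from (map_ofNat C 2).symm, ← C_mul, inv_mul_cancel₀ h2, C_1]
  refine ⟨C (2⁻¹ : F) • (A0 * c + c * A1), -(A0 * (c * ρ)).re, ?_⟩
  rw [smul_mul_assoc, key2, key, smul_add, smul_smul, smul_smul, ← mul_assoc (C (2⁻¹ : F)), hCC, one_smul,
    one_mul, neg_smul, sub_neg_eq_add]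

theorem base_reduce {A0 ρ s : HQ F δ} {l N : F[X]} (h : A0 - l • (1 : HQ F δ) = s * ρ)
    (hN : N.Monic) (hNρ : qN ρ ∣ N) :
    ∃ (s : HQ F δ), A0 - (l %ₘ N) • (1 : HQ F δ) = s * ρ := by
  obtain ⟨c, hc⟩ := hNρ
  refine ⟨s + ((l /ₘ N) * c) • star ρ, ?_⟩
  have e := modByMonic_add_div l N
  rw [add_mul, ← h, smul_mul_assoc, star_mul_qN, smul_smul]
  have : l /ₘ N * c * qN ρ = l - l %ₘ N := by linear_combination e - (l /ₘ N) * hc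
  rw [this]
  module

/-- the data attached to an element -/
structure RData (A0 B0 ρ : HQ F δ) (N l m : F[X]) : Prop where
  ne : ρ ≠ 0
  n1 : qN ρ ∣ N
  n2 : N ∣ qN ρ
  a : ∃ s : HQ F δ, A0 - l • (1 : HQ F δ) = s * ρ
  b : ∃ s : HQ F δ, B0 - m • (1 : HQ F δ) = s * ρ

theorem RData.isSol {DA DB E : F[X]} {A0 B0 ρ : HQ F δ} {N l m : F[X]} (h : RData A0 B0 ρ N l m)
    (h0 : (A0, B0) ∈ GPairs δ DA DB E) : IsSol DA DB E N l m := by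
  obtain ⟨hA0, hB0, hDA0, hDB0, hE0⟩ := h0
  simp only at hA0 hB0 hDA0 hDB0 hE0
  obtain ⟨s, hs⟩ := h.a
  obtain ⟨r, hr⟩ := h.b
  refine ⟨?_, ?_, ?_⟩
  · have e : qN (A0 - l • (1 : HQ F δ)) = l ^ 2 + DA := by
      rw [← hDA0]; simp [qN, hA0]; ring
    rw [← e, hs, qN_mul]
    exact h.n2.mul_left _
  · have e : qN (B0 - m • (1 : HQ F δ)) = m ^ 2 + DB := by
      rw [← hDB0]; simp [qN, hB0]; ring
    rw [← e, hr, qN_mul]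
    exact h.n2.mul_left _
  · have e : ((A0 - l • (1 : HQ F δ)) * star (B0 - m • (1 : HQ F δ))).re = l * m + E := by
      rw [← hE0]; simp [hA0, hB0]; ring
    have e2 : (s * ρ) * star (r * ρ) = qN ρ • (s * star r) := by
      rw [star_mul, ← mul_assoc, mul_assoc s, mul_star_qN, mul_smul_comm, mul_one, smul_mul_assoc]
    rw [← e, hs, hr, e2, QuaternionAlgebra.re_smul, smul_eq_mul]
    exact h.n2.mul_right _

theorem sdvd_shift {A : HQ F δ} {l M : F[X]} (hA : A.re = 0) (h : SDvd M (A - l • (1 : HQ F δ))) :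
    SDvd M A := by
  rw [sdvd_iff] at h ⊢
  simp [hA] at h ⊢
  exact h.2

theorem star_smulQ (f : F[X]) (x : HQ F δ) : star (f • x) = f • star x := by
  ext1 <;> simp

theorem sdvd_re {A : HQ F δ} {M : F[X]} (h : SDvd M A) : M ∣ A.re := by
  obtain ⟨y, rfl⟩ := h
  simp

theorem natDegree_zero_of_isUnit {f : F[X]} (h : IsUnit f) : f.natDegree = 0 :=
  natDegree_eq_zero_of_isUnit h

theorem RData.unique (hδ : ¬ IsSquare δ) {DA DB E : F[X]} {A0 B0 ρ ρ' : HQ F δ} {N l m : F[X]}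
    (h : RData A0 B0 ρ N l m) (h' : RData A0 B0 ρ' N l m)
    (h0 : (A0, B0) ∈ GPairs δ DA DB E) (hns : NoSq DA DB E) :
    ∃ u : HQ F δ, (qN u).natDegree = 0 ∧ ρ' = u * ρ := by
  obtain ⟨hA0, hB0, hDA0, hDB0, hE0⟩ := h0
  simp only at hA0 hB0 hDA0 hDB0 hE0
  obtain ⟨κ, s, r, σ, σ', hκ, e1, e2⟩ := HQ_gcd hδ ((qN ρ').natDegree + 1) ρ ρ' (Nat.lt_succ_self _)
  have hκ0 : κ ≠ 0 := by
    intro h1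
    apply h.ne
    rw [e1, h1, mul_zero]
  have hone : 1 = s * σ + r * σ' := by
    apply HQ_cancel_right hδ hκ0
    rw [add_mul, mul_assoc, mul_assoc, ← e1, ← e2, ← hκ, one_mul]
  have hM : qN σ ∣ qN σ' := by
    have : qN ρ ∣ qN ρ' := h.n1.trans h'.n2
    rw [e1, e2, qN_mul, qN_mul] at this
    exact (mul_dvd_mul_iff_right (qN_ne_zero hδ hκ0)).1 this
  have hM' : qN σ' ∣ qN σ := by
    have : qN ρ' ∣ qN ρ := h'.n1.trans h.n2
    rw [e1, e2, qN_mul, qN_mul] at this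
    exact (mul_dvd_mul_iff_right (qN_ne_zero hδ hκ0)).1 this
  have key : ∀ Z : HQ F δ, (∃ a, Z = a * ρ) → (∃ a, Z = a * ρ') → SDvd (qN σ) Z := by
    rintro Z ⟨a, ha⟩ ⟨b, hb⟩
    have hab : a * σ = b * σ' := by
      apply HQ_cancel_right hδ hκ0
      rw [mul_assoc, mul_assoc, ← e1, ← e2, ← ha, ← hb]
    have h3 : SDvd (qN σ) (a * σ) := by
      have h4 : a * σ = a * σ * star (s * σ + r * σ') := by rw [← hone]; simp
      have h5 : a * σ * star (s * σ + r * σ') = qN σ • (a * star s) + qN σ' • (b * star r) := by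
        rw [star_add, mul_add, star_mul, star_mul, ← mul_assoc, mul_assoc a σ, mul_star_qN,
          ← mul_assoc, hab, mul_assoc b σ', mul_star_qN, mul_smul_comm, mul_smul_comm,
          smul_mul_assoc, smul_mul_assoc, mul_one, mul_one]
      rw [h4, h5]
      exact (SDvd.smul dvd_rfl _).add (SDvd.smul hM _)
    rw [ha, e1, ← mul_assoc]
    exact h3.mul_right _
  have kA := sdvd_shift hA0 (key _ h.a h'.a)
  have kB := sdvd_shift hB0 (key _ h.b h'.b)
  have hunit : IsUnit (qN σ) := by
    by_contra hu
    obtain ⟨l, -, hl, hlg⟩ := exists_monic_irreducible_factor _ hu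
    refine hns l hl ?_ ?_ ?_
    · rw [← hDA0]; exact (pow_dvd_pow_of_dvd hlg 2).trans kA.qN
    · rw [← hDB0]; exact (pow_dvd_pow_of_dvd hlg 2).trans kB.qN
    · obtain ⟨a, ha⟩ := kA
      obtain ⟨b, hb⟩ := kB
      rw [← hE0, ha, hb, star_smulQ, smul_mul_assoc, mul_smul_comm, smul_smul, QuaternionAlgebra.re_smul]
      exact (show l ^ 2 ∣ qN σ * qN σ by rw [pow_two]; exact mul_dvd_mul hlg hlg).mul_right _
  have hunit' : IsUnit (qN σ') := isUnit_of_dvd_unit hM' hunit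
  obtain ⟨d, hd, hd'⟩ := Polynomial.isUnit_iff.1 hunit
  obtain ⟨w, hw, hw'⟩ := HQ_unit σ hd.ne_zero hd'.symm
  refine ⟨σ' * w, ?_, ?_⟩
  · have hw1 : IsUnit (qN w) := by
      have := congrArg qN hw
      rw [qN_mul, qN_one] at this
      exact IsUnit.of_mul_eq_one _ this
    rw [qN_mul]
    exact natDegree_eq_zero_of_isUnit (hunit'.mul hw1)
  · rw [mul_assoc, e1, ← mul_assoc w, hw, one_mul, ← e2]

theorem normalize_dvd_both [DecidableEq F] (f : F[X]) : normalize f ∣ f ∧ f ∣ normalize f :=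
  ⟨(normalize_associated f).dvd, (normalize_associated f).symm.dvd⟩

/-- The main counting lemma. -/
theorem card_GPairs [Fintype F] (hδ : ¬ IsSquare δ) (h2 : (2 : F) ≠ 0) {DA DB E : F[X]}
    (hΔ : DA * DB - E ^ 2 ≠ 0) (hns : NoSq DA DB E) {k : ℕ}
    (hk : CardLE {d : F[X] | d.Monic ∧ d ∣ DA * DB - E ^ 2} k) :
    CardLE (GPairs δ DA DB E) (2 * (k * k) * Fintype.card F ^ 2) := by
  classical
  apply CardLE.of_base
  rintro ⟨A0, B0⟩ h0
  have hA0 := h0.1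
  have hB0 := h0.2.1
  simp only at hA0 hB0
  have hB := CardLE.univ (Set.univ : Set Bool)
  rw [Fintype.card_bool] at hB
  have hΛ : CardLE {u : F[X] × F[X] × F[X] | u.1.Monic ∧ u.1 ∣ DA * DB - E ^ 2 ∧
      u.2.1.degree < u.1.degree ∧ u.2.2.degree < u.1.degree ∧ IsSol DA DB E u.1 u.2.1 u.2.2} (k * k) := by
    refine CardLE.fiber hk (fun u => u.1) (fun u hu => ⟨hu.1, hu.2.1⟩) ?_
    rintro N ⟨hN, hNd⟩
    have hkN : CardLE {d : F[X] | d.Monic ∧ d ∣ N} k :=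
      hk.mono (fun d hd => ⟨hd.1, hd.2.trans hNd⟩) le_rfl
    refine CardLE.inj (card_sol h2 hN.ne_zero hns hkN) (fun u => u.2) ?_ ?_
    · rintro ⟨N', l, m⟩ ⟨hu, rfl⟩
      exact ⟨hu.2.2.1, hu.2.2.2.1, hu.2.2.2.2⟩
    · rintro ⟨N', l, m⟩ ⟨hu, rfl⟩ ⟨N'', l', m'⟩ ⟨hu', h3⟩ h4
      simp only at h3 h4
      rw [h3, h4]
  let cj : Bool → HQ F δ → HQ F δ := fun b A => if b then A else jconj A
  have hcj : ∀ b A A', cj b A = cj b A' → A = A' := by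
    intro b A A' h
    cases b
    · have := congrArg jconj h
      simpa [cj, jconj_jconj] using this
    · simpa [cj] using h
  refine CardLE.biUnion (hB.prod hΛ) (g := fun i => {u | ∃ ρ : HQ F δ, cj i.1 u.1 * ρ = ρ * A0 ∧
    cj i.1 u.2 * ρ = ρ * B0 ∧ RData A0 B0 ρ i.2.1 i.2.2.1 i.2.2.2}) ?_ ?_
  · rintro ⟨b, N, l, m⟩ -
    apply CardLE.of_base
    rintro ⟨A1, B1⟩ ⟨ρ, -, -, hρ⟩
    simp only at hρ
    have h1 : ∀ u ∈ {u : HQ F δ | (qN u).natDegree = 0},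
      CardLE {v : HQ F δ × HQ F δ | u * ρ ≠ 0 ∧ cj b v.1 * (u * ρ) = (u * ρ) * A0 ∧
        cj b v.2 * (u * ρ) = (u * ρ) * B0} 1 := by
      intro u _
      apply CardLE.subsingleton
      rintro ⟨x, y⟩ ⟨hne, hx1, hx2⟩ ⟨x', y'⟩ ⟨-, hy1, hy2⟩
      simp only at hx1 hx2 hy1 hy2
      have e1 := hcj b _ _ (HQ_cancel_right hδ hne (hx1.trans hy1.symm))
      have e2 := hcj b _ _ (HQ_cancel_right hδ hne (hx2.trans hy2.symm))
      rw [e1, e2]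
    have := CardLE.biUnion (card_units hδ) h1 (s := {u | ∃ ρ : HQ F δ, cj b u.1 * ρ = ρ * A0 ∧
      cj b u.2 * ρ = ρ * B0 ∧ RData A0 B0 ρ N l m}) (by
        rintro ⟨x, y⟩ ⟨ρ', e1, e2, hρ'⟩
        obtain ⟨u, hu, rfl⟩ := hρ.unique hδ hρ' h0 hns
        exact ⟨u, hu, hρ'.ne, e1, e2⟩)
    rwa [mul_one] at this
  · rintro ⟨A, B⟩ h
    obtain ⟨ρ, c, hρ, hor, hc⟩ := exists_good_rho hδ h2 h h0 hΔ
    obtain ⟨b, hb1, hb2⟩ : ∃ b, cj b A * ρ = ρ * A0 ∧ cj b B * ρ = ρ * B0 := by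
      rcases hor with h3 | h3
      · exact ⟨true, by simpa [cj] using h3⟩
      · exact ⟨false, by simpa [cj] using h3⟩
    have hNm : (normalize (qN ρ)).Monic := monic_normalize (qN_ne_zero hδ hρ)
    obtain ⟨s, l, hs⟩ := base_left h2 hA0 hb1 hc
    obtain ⟨r, m, hr⟩ := base_left h2 hB0 hb2 hc
    have hD : RData A0 B0 ρ (normalize (qN ρ)) (l %ₘ normalize (qN ρ)) (m %ₘ normalize (qN ρ)) :=
      ⟨hρ, (normalize_dvd_both _).2, (normalize_dvd_both _).1,
        base_reduce hs hNm (normalize_dvd_both _).2, base_reduce hr hNm (normalize_dvd_both _).2⟩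
    have hS := hD.isSol h0
    refine ⟨(b, normalize (qN ρ), l %ₘ normalize (qN ρ), m %ₘ normalize (qN ρ)),
      ⟨trivial, hNm, ?_, degree_modByMonic_lt _ hNm, degree_modByMonic_lt _ hNm, hS⟩, ρ, hb1, hb2, hD⟩
    generalize normalize (qN ρ) = N at hS
    generalize l %ₘ N = l at hS
    generalize m %ₘ N = m at hS
    obtain ⟨x, hx⟩ := hS.a
    obtain ⟨y, hy⟩ := hS.b
    obtain ⟨z, hz⟩ := hS.e
    refine ⟨x * DB - l ^ 2 * y - z * (E - l * m), ?_⟩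
    linear_combination DB * hx - l ^ 2 * hy - (E - l * m) * hz

/-- divisors of `(X - 1)^j * f`. -/
theorem card_divisors_mul {f g : F[X]} {a b : ℕ} (hf : f ≠ 0) (hg : g ≠ 0)
    (ha : CardLE {d : F[X] | d.Monic ∧ d ∣ f} a)
    (hb : CardLE {d : F[X] | d.Monic ∧ d ∣ g} b) : CardLE {d : F[X] | d.Monic ∧ d ∣ f * g} (a * b) := by
  classical
  have h1 : ∀ i ∈ {d : F[X] | d.Monic ∧ d ∣ f} ×ˢ {d : F[X] | d.Monic ∧ d ∣ g},
      CardLE ({i.1 * i.2} : Set F[X]) 1 := by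
    intro i _
    apply CardLE.subsingleton
    simp
  have := CardLE.biUnion (ha.prod hb) h1 (s := {d : F[X] | d.Monic ∧ d ∣ f * g}) (by
    rintro d ⟨hd, hdd⟩
    obtain ⟨d1, d2, h3, h4, rfl⟩ := exists_dvd_and_dvd_of_dvd_mul hdd
    refine ⟨(normalize d1, normalize d2), ⟨⟨monic_normalize ?_, ?_⟩, ⟨monic_normalize ?_, ?_⟩⟩, ?_⟩
    · exact ne_zero_of_dvd_ne_zero hf h3
    · exact (normalize_dvd_both _).1.trans h3
    · exact ne_zero_of_dvd_ne_zero hg h4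
    · exact (normalize_dvd_both _).1.trans h4
    · simp only [Set.mem_singleton_iff]
      rw [← hd.normalize_eq_self, normalize_mul])
  rwa [mul_one] at this

theorem card_divisors_pow {l : F[X]} (hl : Irreducible l) (j : ℕ) :
    CardLE {d : F[X] | d.Monic ∧ d ∣ l ^ j} (j + 1) := by
  classical
  have h1 : ∀ i ∈ Finset.range (j + 1), CardLE ({d : F[X] | d.Monic ∧ Associated d (l ^ i)}) 1 := by
    intro i _
    apply CardLE.subsingleton
    rintro x ⟨hx, hx'⟩ y ⟨hy, hy'⟩
    exact eq_of_monic_of_associated hx hy (hx'.trans hy'.symm)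
  have := CardLE.sum (Finset.range (j + 1)) h1 (s := {d : F[X] | d.Monic ∧ d ∣ l ^ j}) (by
    rintro d ⟨hd, hdd⟩
    obtain ⟨i, hi, h3⟩ := (dvd_prime_pow hl.prime j).1 hdd
    exact ⟨i, by simp; omega, hd, h3⟩)
  simpa using this

end

end

section
open Polynomial Quaternion

section
variable {F : Type*} [Field F] {δ : F}

theorem sdvd_smul_irr {l f : F[X]} (hl : Irreducible l) {x : HQ F δ} (h : SDvd l (f • x)) :
    l ∣ f ∨ SDvd l x := by
  by_cases hf : l ∣ f
  · exact Or.inl hf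
  · right
    rw [sdvd_iff] at h ⊢
    simp only [QuaternionAlgebra.re_smul, QuaternionAlgebra.imI_smul, QuaternionAlgebra.imJ_smul,
      QuaternionAlgebra.imK_smul, smul_eq_mul] at h
    exact ⟨(hl.prime.dvd_or_dvd h.1).resolve_left hf, (hl.prime.dvd_or_dvd h.2.1).resolve_left hf,
      (hl.prime.dvd_or_dvd h.2.2.1).resolve_left hf, (hl.prime.dvd_or_dvd h.2.2.2).resolve_left hf⟩

theorem sdvd_X_of_sq (hδ : ¬ IsSquare δ) {A : HQ F δ} (hA : A.re = 0) (h : (X : F[X]) ^ 2 ∣ qN A) :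
    SDvd X A := by
  have hδ0 : δ ≠ 0 := fun h => hδ (by rw [h]; exact ⟨0, by simp⟩)
  have h1 : (X : F[X]) ∣ A.imI := by
    have h3 : (X : F[X]) ∣ qN A := (dvd_pow_self X two_ne_zero).trans h
    rw [qN_eq, hA] at h3
    have h4 := dvd_add h3 (Dvd.intro (A.imJ ^ 2 - C δ * A.imK ^ 2) rfl)
    have h5 : (X : F[X]) ∣ C δ * A.imI ^ 2 := by
      rw [← dvd_neg]; convert h4 using 1; ring
    rcases prime_X.dvd_or_dvd h5 with h6 | h6
    · rw [X_dvd_iff, coeff_C_zero] at h6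
      exact absurd h6 hδ0
    · exact prime_X.dvd_of_dvd_pow h6
  have h2 : (X : F[X]) ∣ A.imJ ^ 2 - C δ * A.imK ^ 2 := by
    obtain ⟨y, hy⟩ := h1
    rw [qN_eq, hA, hy] at h
    have h3 := dvd_add h (Dvd.intro (C δ * y ^ 2) rfl)
    have h4 : (X : F[X]) * X ∣ X * (A.imJ ^ 2 - C δ * A.imK ^ 2) := by
      rw [← dvd_neg]; convert h3 using 1 <;> ring
    exact (mul_dvd_mul_iff_left X_ne_zero).1 h4
  rw [X_dvd_iff, coeff_zero_eq_eval_zero] at h2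
  simp only [eval_sub, eval_mul, eval_pow, eval_C] at h2
  have h3 : eval 0 A.imK = 0 := by
    by_contra hk
    apply hδ
    refine ⟨eval 0 A.imJ / eval 0 A.imK, ?_⟩
    field_simp
    linear_combination -h2
  have h4 : eval 0 A.imJ = 0 := by
    rw [h3] at h2
    simpa using h2
  rw [sdvd_iff]
  refine ⟨by simp [hA], h1, ?_, ?_⟩
  · rw [X_dvd_iff, coeff_zero_eq_eval_zero, h4]
  · rw [X_dvd_iff, coeff_zero_eq_eval_zero, h3]

theorem exists_trace_ne (hδ : ¬ IsSquare δ) (h2 : (2 : F) ≠ 0) {A : HQ F δ} (hA : A.re = 0)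
    {l : F[X]} (hl : Irreducible l) (hsq : l ^ 2 ∣ qN A) (hAl : ¬ SDvd l A) :
    ∃ h : HQ F δ, ¬ l ∣ 2 * (h * A).re := by
  have hδ0 : δ ≠ 0 := fun h => hδ (by rw [h]; exact ⟨0, by simp⟩)
  by_contra hall
  push Not at hall
  have hX : ¬ l ∣ X := by
    intro hlX
    have has : Associated l X := hl.associated_of_dvd prime_X.irreducible hlX
    apply hAl
    obtain ⟨y, hy⟩ := sdvd_X_of_sq hδ hA ((pow_dvd_pow_of_dvd has.symm.dvd 2).trans hsq)
    rw [hy]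
    exact SDvd.smul has.dvd _
  have hCd : ¬ l ∣ C δ := fun h => hl.not_isUnit (isUnit_of_dvd_unit h (isUnit_C.2 (isUnit_iff_ne_zero.2 hδ0)))
  apply hAl
  have k1 := dvd_of_two h2 (hall ⟨0, 1, 0, 0⟩)
  have k2 := dvd_of_two h2 (hall ⟨0, 0, 1, 0⟩)
  have k3 := dvd_of_two h2 (hall ⟨0, 0, 0, 1⟩)
  simp at k1 k2 k3
  rw [sdvd_iff]
  refine ⟨by simp [hA], (hl.prime.dvd_or_dvd k1).resolve_left hCd,
    (hl.prime.dvd_or_dvd k2).resolve_left hX, ?_⟩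
  exact (hl.prime.dvd_or_dvd k3).resolve_left fun h => (hl.prime.dvd_or_dvd h).elim hCd hX

theorem sandwich {A : HQ F δ} (hA : A.re = 0) (y : HQ F δ) :
    A * y * A = (2 * (y * A).re) • A - qN A • star y := by
  ext1 <;> simp [hA, qN] <;> ring

theorem anticomm {A B : HQ F δ} (hA : A.re = 0) (hB : B.re = 0) :
    B * A = -(A * B) - (2 * (A * star B).re) • (1 : HQ F δ) := by
  ext1 <;> simp [hA, hB] <;> ring

theorem sdvd_AB (hδ : ¬ IsSquare δ) (h2 : (2 : F) ≠ 0) {A B : HQ F δ} (hA : A.re = 0)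
    (hB : B.re = 0)
    {l : F[X]} (hl : Irreducible l) (hsA : l ^ 2 ∣ qN A) (hsB : l ^ 2 ∣ qN B)
    (hsE : l ^ 2 ∣ (A * star B).re) (hAl : ¬ SDvd l A) : SDvd l (A * B) := by
  have hll : l ∣ l ^ 2 := dvd_pow_self l two_ne_zero
  obtain ⟨h, hθ⟩ := exists_trace_ne hδ h2 hA hl hsA hAl
  have e1 : (2 * (h * A).re) • (A * B) + (2 * (h * B * A).re) • A =
      qN A • (star h * B) + qN A • star (h * B) - (2 * (A * star B).re) • (A * h) := by
    have s1 := sandwich hA h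
    have s2 := sandwich hA (h * B)
    have s3 := anticomm hA hB
    have : (2 * (h * A).re) • (A * B) = A * h * A * B + qN A • (star h * B) := by
      rw [s1]; simp [sub_mul]
    rw [this]
    have t : (2 * (h * B * A).re) • A = A * (h * B) * A + qN A • star (h * B) := by
      rw [s2]; simp
    rw [t]
    have t2 : A * (h * B) * A = - (A * h * A * B) - (2 * (A * star B).re) • (A * h) := by
      rw [mul_assoc, mul_assoc, s3]
      simp only [mul_sub, mul_neg, mul_smul_comm, mul_one, ← mul_assoc]
    rw [t2]; abel
  have e2 : SDvd l ((2 * (h * A).re) • (A * B) + (2 * (h * B * A).re) • A) := by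
    rw [e1]
    refine SDvd.sub (SDvd.add (SDvd.smul (hll.trans hsA) _) (SDvd.smul (hll.trans hsA) _))
      (SDvd.smul ((hll.trans hsE).mul_left _) _)
  have hκ : l ∣ 2 * (h * B * A).re := by
    by_contra hκ
    have e3 := e2.mul_right B
    rw [add_mul, smul_mul_assoc, smul_mul_assoc, mul_assoc A, sq_pure hB, mul_neg, mul_smul_comm,
      mul_one] at e3
    have e4 : SDvd l ((2 * (h * A).re) • -(qN B • A)) := by
      rw [smul_neg, smul_smul]
      exact (SDvd.smul ((hll.trans hsB).mul_left _) _).neg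
    have e5 := e3.sub e4
    rw [add_sub_cancel_left] at e5
    have e6 := (sdvd_smul_irr hl e5).resolve_left hκ
    have e7 : SDvd l ((2 * (h * A).re) • (A * B)) := by
      obtain ⟨y, hy⟩ := e6
      rw [hy, smul_smul, mul_comm, mul_smul]
      exact ⟨_, rfl⟩
    have e8 := e2.sub e7
    rw [add_sub_cancel_left] at e8
    exact hAl ((sdvd_smul_irr hl e8).resolve_left hκ)
  have e9 := e2.sub (SDvd.smul hκ A)
  rw [add_sub_cancel_right] at e9
  exact (sdvd_smul_irr hl e9).resolve_left hθ

theorem exists_rho_l (hδ : ¬ IsSquare δ) {A : HQ F δ}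
    {l : F[X]} (hl : Irreducible l) (hlm : l.Monic) (hsA : l ^ 2 ∣ qN A) (hAl : ¬ SDvd l A) :
    ∃ (ρ s r : HQ F δ) (c : F), c ≠ 0 ∧ qN ρ = C c * l ∧ ρ = s * A + l • r := by
  have hl0 : l ≠ 0 := hl.ne_zero
  obtain ⟨ρ, s, r, x', y', e1, e2, e3⟩ := HQ_gcd hδ ((qN (l • (1 : HQ F δ))).natDegree + 1) A
    (l • (1 : HQ F δ)) (Nat.lt_succ_self _)
  rw [mul_smul_comm, mul_one] at e1
  have hN1 : l ∣ qN ρ := by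
    have hA : l ∣ qN A := (dvd_pow_self l two_ne_zero).trans hsA
    have e4 : qN ρ • (1 : HQ F δ) = qN A • (s * star s) + l • (s * A * star r + r * star (s * A)
        + l • (r * star r)) := by
      rw [← mul_star_qN, e1, star_add, add_mul, mul_add, mul_add, star_smulQ, star_mul]
      have : s * A * (star A * star s) = qN A • (s * star s) := by
        rw [← mul_assoc, mul_assoc s, mul_star_qN, mul_smul_comm, mul_one, smul_mul_assoc]
      rw [this]
      simp only [mul_smul_comm, smul_mul_assoc, smul_add]
      abel
    have e5 : SDvd l (qN ρ • (1 : HQ F δ)) := by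
      rw [e4]
      exact (SDvd.smul hA _).add (SDvd.smul dvd_rfl _)
    have := sdvd_re e5
    simpa using this
  have hN2 : qN y' * qN ρ = l ^ 2 := by
    rw [← qN_mul, ← e3, qN_smul, qN_one, mul_one]
  obtain ⟨f, hf⟩ := hN1
  have hyf : qN y' * f = l := by
    apply mul_left_cancel₀ hl0
    rw [hf] at hN2
    linear_combination hN2
  rcases hl.isUnit_or_isUnit hyf.symm with hu | hu
  · exfalso
    apply hAl
    obtain ⟨d, hd, hd'⟩ := Polynomial.isUnit_iff.1 hu
    obtain ⟨w, hw, hw'⟩ := HQ_unit y' hd.ne_zero hd'.symm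
    have : ρ = l • w := by
      rw [← one_mul ρ, ← hw, mul_assoc, ← e3, mul_smul_comm, mul_one]
    rw [e2, this, mul_smul_comm]
    exact ⟨_, rfl⟩
  · obtain ⟨d, hd, hd'⟩ := Polynomial.isUnit_iff.1 hu
    exact ⟨ρ, s, r, d, hd.ne_zero, by rw [hf, ← hd', mul_comm], e1⟩

theorem conj_dvd {A Z ρ s r : HQ F δ} {l : F[X]} (hA : A.re = 0) (hρ : ρ = s * A + l • r)
    (h1 : SDvd (l ^ 2) (A * Z * A)) (h3 : SDvd l (A * Z)) (h4 : SDvd l (Z * A)) :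
    SDvd (l ^ 2) (ρ * Z * star ρ) := by
  obtain ⟨u, hu⟩ := h1
  obtain ⟨v, hv⟩ := h3
  obtain ⟨w, hw⟩ := h4
  refine ⟨-(s * u * star s) - r * w * star s + s * v * star r + r * Z * star r, ?_⟩
  have e : ρ * Z * star ρ = -(s * (A * Z * A) * star s) - l • (r * (Z * A) * star s)
      + l • (s * (A * Z) * star r) + l • l • (r * Z * star r) := by
    have e0 : ∀ p q p' q' : HQ F δ, (p + q) * Z * (p' + q') = p * Z * p' + q * Z * p' + p * Z * q'
        + q * Z * q' := by
      intro p q p' q'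
      rw [add_mul, add_mul, mul_add, mul_add]; exact (by intro a b c d; abel : ∀ a b c d : HQ F δ, a + b + (c + d) = a + c + b + d) _ _ _ _
    have e1 : star ρ = -(A * star s) + l • star r := by
      rw [hρ, star_add, star_smulQ, star_mul, star_pure hA, neg_mul]
    rw [e1, hρ, e0]
    have f1 : s * A * Z * -(A * star s) = -(s * (A * Z * A) * star s) := by
      rw [mul_neg]; simp only [mul_assoc]
    have f2 : l • r * Z * -(A * star s) = - (l • (r * (Z * A) * star s)) := by
      rw [mul_neg, smul_mul_assoc, smul_mul_assoc]; simp only [mul_assoc]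
    have f3 : s * A * Z * l • star r = l • (s * (A * Z) * star r) := by
      rw [mul_smul_comm]; simp only [mul_assoc]
    have f4 : l • r * Z * l • star r = l • l • (r * Z * star r) := by
      rw [mul_smul_comm, smul_mul_assoc, smul_mul_assoc]
    rw [f1, f2, f3, f4, ← sub_eq_add_neg]
  rw [e, hu, hv, hw]
  simp only [mul_smul_comm, smul_mul_assoc, smul_smul, smul_add, smul_sub, smul_neg, ← sq]

theorem lemmaQ_aux (hδ : ¬ IsSquare δ) (h2 : (2 : F) ≠ 0) {DA DB E l : F[X]}
    (hl : Irreducible l) (hlm : l.Monic) {A B : HQ F δ}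
    (h : (A, B) ∈ GPairs δ (l ^ 2 * DA) (l ^ 2 * DB) (l ^ 2 * E)) (hAl : ¬ SDvd l A) :
    ∃ (ρ : HQ F δ) (c : F) (A1 B1 : HQ F δ), c ≠ 0 ∧ qN ρ = C c * l ∧
      (A1, B1) ∈ GPairs δ DA DB E ∧ C c • A = star ρ * A1 * ρ ∧ C c • B = star ρ * B1 * ρ := by
  obtain ⟨hA, hB, hDA, hDB, hE⟩ := h
  simp only at hA hB hDA hDB hE
  have hl0 := hl.ne_zero
  have hll : l ∣ l ^ 2 := dvd_pow_self l two_ne_zero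
  have hsA : l ^ 2 ∣ qN A := by rw [hDA]; exact dvd_mul_right _ _
  have hsB : l ^ 2 ∣ qN B := by rw [hDB]; exact dvd_mul_right _ _
  have hsE : l ^ 2 ∣ (A * star B).re := by rw [hE]; exact dvd_mul_right _ _
  obtain ⟨ρ, s, r, c, hc, hρN, hρ⟩ := exists_rho_l hδ hl hlm hsA hAl
  have hAB := sdvd_AB hδ h2 hA hB hl hsA hsB hsE hAl
  have hBA : SDvd l (B * A) := by
    rw [anticomm hA hB]
    exact hAB.neg.sub (SDvd.smul ((hll.trans hsE).mul_left _) _)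
  have hAA : A * A = -(qN A • 1) := sq_pure hA
  have kA : SDvd (l ^ 2) (ρ * A * star ρ) := by
    have h1 : SDvd l (A * A) := by
      rw [hAA]; exact (SDvd.smul (hll.trans hsA) _).neg
    refine conj_dvd hA hρ ?_ h1 h1
    rw [hAA]
    exact (SDvd.smul hsA _).neg.mul_right _
  have kB : SDvd (l ^ 2) (ρ * B * star ρ) := by
    refine conj_dvd hA hρ ?_ hAB hBA
    rw [mul_assoc, anticomm hA hB, mul_sub, mul_neg, ← mul_assoc, hAA, mul_smul_comm]
    exact ((SDvd.smul hsA _).neg.mul_right _).neg.sub (SDvd.smul (hsE.mul_left _) _)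
  obtain ⟨A1, hA1⟩ := kA
  obtain ⟨B1, hB1⟩ := kB
  have hCC : C c * C c⁻¹ = (1 : F[X]) := by rw [← C_mul, mul_inv_cancel₀ hc, C_1]
  have hc0 : (C c : F[X]) ≠ 0 := C_ne_zero.2 hc
  have hcl : C c * l ^ 2 ≠ 0 := mul_ne_zero hc0 (pow_ne_zero _ hl0)
  have hA1' : ρ * A * star ρ = (C c * l ^ 2) • (C c⁻¹ • A1) := by
    rw [hA1, smul_smul]; congr 1; linear_combination (-l ^ 2) * hCC
  have hB1' : ρ * B * star ρ = (C c * l ^ 2) • (C c⁻¹ • B1) := by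
    rw [hB1, smul_smul]; congr 1; linear_combination (-l ^ 2) * hCC
  generalize C c⁻¹ • A1 = A1 at hA1'
  generalize C c⁻¹ • B1 = B1 at hB1'
  have pure' : ∀ Z Z1 : HQ F δ, Z.re = 0 → ρ * Z * star ρ = (C c * l ^ 2) • Z1 → Z1.re = 0 := by
    intro Z Z1 hZ h
    have := congrArg QuaternionAlgebra.re h
    rw [re_conj, hZ, mul_zero, QuaternionAlgebra.re_smul, smul_eq_mul] at this
    exact (mul_eq_zero.1 this.symm).resolve_left hcl
  have norm' : ∀ (Z Z1 : HQ F δ) (D : F[X]), qN Z = l ^ 2 * D →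
      ρ * Z * star ρ = (C c * l ^ 2) • Z1 → qN Z1 = D := by
    intro Z Z1 D hZ h
    have := congrArg qN h
    rw [qN_mul, qN_mul, qN_star, qN_smul, hρN, hZ] at this
    apply mul_left_cancel₀ (pow_ne_zero 2 hcl)
    linear_combination -this
  have eq' : ∀ (Z Z1 : HQ F δ), ρ * Z * star ρ = (C c * l ^ 2) • Z1 → C c • Z = star ρ * Z1 * ρ := by
    intro Z Z1 h
    have e : star ρ * (ρ * Z * star ρ) * ρ = (qN ρ * qN ρ) • Z := by
      have : star ρ * (ρ * Z * star ρ) * ρ = (star ρ * ρ) * Z * (star ρ * ρ) := by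
        simp only [mul_assoc]
      rw [this, star_mul_qN, smul_mul_assoc, smul_mul_assoc, mul_smul_comm, one_mul, mul_one, smul_smul]
    rw [h, hρN] at e
    apply HQ_smul_cancel hcl
    rw [smul_smul]
    rw [mul_smul_comm, smul_mul_assoc] at e
    rw [e]
    congr 1; ring
  refine ⟨ρ, c, A1, B1, hc, hρN, ⟨pure' _ _ hA hA1', pure' _ _ hB hB1', norm' _ _ _ hDA hA1',
    norm' _ _ _ hDB hB1', ?_⟩, eq' _ _ hA1', eq' _ _ hB1'⟩
  simp only
  have e : (ρ * A * star ρ) * star (ρ * B * star ρ) = qN ρ • (ρ * (A * star B) * star ρ) := by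
    have : (ρ * A * star ρ) * star (ρ * B * star ρ) = ρ * A * (star ρ * ρ) * (star B * star ρ) := by
      simp only [star_mul, star_star, mul_assoc]
    rw [this, star_mul_qN, mul_smul_comm, mul_one, smul_mul_assoc]
    simp only [mul_assoc]
  have e' := congrArg QuaternionAlgebra.re e
  rw [hA1', hB1', star_smulQ, smul_mul_assoc, mul_smul_comm, QuaternionAlgebra.re_smul,
    QuaternionAlgebra.re_smul, QuaternionAlgebra.re_smul, re_conj, hE, hρN] at e'
  simp only [smul_eq_mul] at e'
  apply mul_left_cancel₀ (pow_ne_zero 2 hcl)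
  linear_combination e'

theorem GPairs_swap {DA DB E : F[X]} {A B : HQ F δ} (h : (A, B) ∈ GPairs δ DA DB E) :
    (B, A) ∈ GPairs δ DB DA E := by
  obtain ⟨hA, hB, hDA, hDB, hE⟩ := h
  refine ⟨hB, hA, hDB, hDA, ?_⟩
  simp only at hE ⊢
  rw [← hE]; simp; ring

theorem lemmaQ (hδ : ¬ IsSquare δ) (h2 : (2 : F) ≠ 0) {DA DB E l : F[X]}
    (hl : Irreducible l) (hlm : l.Monic) {A B : HQ F δ}
    (h : (A, B) ∈ GPairs δ (l ^ 2 * DA) (l ^ 2 * DB) (l ^ 2 * E)) :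
    (∃ A1 B1, (A1, B1) ∈ GPairs δ DA DB E ∧ A = l • A1 ∧ B = l • B1) ∨
    ∃ (ρ : HQ F δ) (c : F) (A1 B1 : HQ F δ), c ≠ 0 ∧ qN ρ = C c * l ∧
      (A1, B1) ∈ GPairs δ DA DB E ∧ C c • A = star ρ * A1 * ρ ∧ C c • B = star ρ * B1 * ρ := by
  by_cases hA : SDvd l A
  · by_cases hB : SDvd l B
    · left
      obtain ⟨A1, rfl⟩ := hA
      obtain ⟨B1, rfl⟩ := hB
      have hl0 := hl.ne_zero
      refine ⟨A1, B1, ?_, rfl, rfl⟩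
      obtain ⟨hA, hB, hDA, hDB, hE⟩ := h
      simp only at hA hB hDA hDB hE
      rw [QuaternionAlgebra.re_smul, smul_eq_mul] at hA hB
      rw [qN_smul] at hDA hDB
      rw [star_smulQ, smul_mul_assoc, mul_smul_comm, QuaternionAlgebra.re_smul,
        QuaternionAlgebra.re_smul, smul_eq_mul, smul_eq_mul, ← mul_assoc, ← sq] at hE
      exact ⟨(mul_eq_zero.1 hA).resolve_left hl0, (mul_eq_zero.1 hB).resolve_left hl0,
        mul_left_cancel₀ (pow_ne_zero 2 hl0) hDA, mul_left_cancel₀ (pow_ne_zero 2 hl0) hDB,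
        mul_left_cancel₀ (pow_ne_zero 2 hl0) hE⟩
    · right
      obtain ⟨ρ, c, B1, A1, h3, h4, h5, h6, h7⟩ := lemmaQ_aux hδ h2 hl hlm (GPairs_swap h) hB
      exact ⟨ρ, c, A1, B1, h3, h4, GPairs_swap h5, h7, h6⟩
  · exact Or.inr (lemmaQ_aux hδ h2 hl hlm h hA)

theorem lemmaQ_iter (hδ : ¬ IsSquare δ) (h2 : (2 : F) ≠ 0) {DA DB E : F[X]} (n : ℕ) :
    ∀ g : F[X], g.Monic → g.natDegree ≤ n → ∀ A B : HQ F δ,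
    (A, B) ∈ GPairs δ (g ^ 2 * DA) (g ^ 2 * DB) (g ^ 2 * E) →
    ∃ (g1 g2 : F[X]) (ρ : HQ F δ) (c : F) (A1 B1 : HQ F δ), g2.Monic ∧ g = g1 * g2 ∧ c ≠ 0 ∧
      qN ρ = C c * g2 ∧
      (A1, B1) ∈ GPairs δ DA DB E ∧ C c • A = g1 • (star ρ * A1 * ρ) ∧
      C c • B = g1 • (star ρ * B1 * ρ) := by
  induction n with
  | zero =>
    intro g hg hn A B h
    have : g = 1 := eq_one_of_monic_natDegree_zero hg (by omega)
    subst this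
    refine ⟨1, 1, 1, 1, A, B, monic_one, by simp, one_ne_zero, by simp [qN_one], by simpa using h, ?_, ?_⟩
    · simp
    · simp
  | succ n ih =>
    intro g hg hn A B h
    by_cases hu : IsUnit g
    · exact ih g hg (by rw [natDegree_eq_zero_of_isUnit hu]; omega) A B h
    obtain ⟨l, hlm, hl, g', rfl⟩ := exists_monic_irreducible_factor g hu
    have hg' : g'.Monic := hlm.of_mul_monic_left hg
    rw [natDegree_mul hlm.ne_zero hg'.ne_zero] at hn
    have hlp := hl.natDegree_pos
    have h' : (A, B) ∈ GPairs δ (l ^ 2 * (g' ^ 2 * DA)) (l ^ 2 * (g' ^ 2 * DB)) (l ^ 2 * (g' ^ 2 * E)) := by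
      rw [← mul_assoc, ← mul_assoc, ← mul_assoc, ← mul_pow]; exact h
    rcases lemmaQ hδ h2 hl hlm h' with ⟨A1, B1, h3, rfl, rfl⟩ | ⟨ρ, c, A1, B1, hc, hρ, h3, hA, hB⟩
    · obtain ⟨g1, g2, ρ, c, A2, B2, k1, k2, k3, k4, k5, k6, k7⟩ := ih g' hg' (by omega) A1 B1 h3
      refine ⟨l * g1, g2, ρ, c, A2, B2, k1, by rw [k2]; ring, k3, k4, k5, ?_, ?_⟩
      · rw [smul_comm, k6, smul_smul]
      · rw [smul_comm, k7, smul_smul]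
    · obtain ⟨g1, g2, ρ', c', A2, B2, k1, k2, k3, k4, k5, k6, k7⟩ := ih g' hg' (by omega) A1 B1 h3
      refine ⟨g1, l * g2, ρ' * ρ, c * c', A2, B2, hlm.mul k1, by rw [k2]; ring, mul_ne_zero hc k3,
        by rw [qN_mul, hρ, k4, C_mul]; ring, k5, ?_, ?_⟩
      · rw [C_mul, mul_comm, mul_smul, hA, ← smul_mul_assoc, ← mul_smul_comm, k6]
        simp only [star_mul, mul_smul_comm, smul_mul_assoc, mul_assoc]
      · rw [C_mul, mul_comm, mul_smul, hB, ← smul_mul_assoc, ← mul_smul_comm, k7]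
        simp only [star_mul, mul_smul_comm, smul_mul_assoc, mul_assoc]

theorem card_GPairs_sq [Fintype F] (hδ : ¬ IsSquare δ) (h2 : (2 : F) ≠ 0) {DA DB E g : F[X]}
    (hg : g.Monic) {e k : ℕ} (he : g.natDegree ≤ e) (hk : CardLE (GPairs δ DA DB E) k) :
    CardLE (GPairs δ (g ^ 2 * DA) (g ^ 2 * DB) (g ^ 2 * E))
      (2 ^ e * (Fintype.card F * (Fintype.card F ^ (e + 3) * 2 ^ e)) * k) := by
  classical
  have hd := monic_divisors_card e g hg.ne_zero he
  have hF := CardLE.univ (Set.univ : Set F)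
  have hT : CardLE {t : F[X] × F × HQ F δ | t.1.Monic ∧ t.1 ∣ g ∧ qN t.2.2 = C t.2.1 * t.1}
      (2 ^ e * (Fintype.card F * (Fintype.card F ^ (e + 3) * 2 ^ e))) := by
    refine CardLE.fiber hd (fun t => t.1) (fun t ht => ⟨ht.1, ht.2.1⟩) ?_
    rintro g2 ⟨hg2, hg2d⟩
    refine CardLE.fiber hF (fun t => t.2.1) (fun t ht => trivial) ?_
    rintro c -
    have hdeg : (C c * g2).natDegree ≤ e :=
      (natDegree_C_mul_le _ _).trans ((natDegree_le_of_dvd hg2d hg.ne_zero).trans he)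
    refine CardLE.inj (card_norm_eq hδ (C c * g2) e hdeg) (fun t => t.2.2) ?_ ?_
    · rintro ⟨a, b, ρ⟩ ⟨⟨h3, rfl⟩, rfl⟩
      exact h3.2.2
    · rintro ⟨a, b, ρ⟩ ⟨⟨h3, rfl⟩, rfl⟩ ⟨a', b', ρ'⟩ ⟨⟨h3', h4⟩, h5⟩ h6
      simp only at h4 h5 h6
      rw [h4, h5, h6]
  have h1 : ∀ i ∈ {t : F[X] × F × HQ F δ | t.1.Monic ∧ t.1 ∣ g ∧ qN t.2.2 = C t.2.1 * t.1} ×ˢ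
      (GPairs δ DA DB E), CardLE {u : HQ F δ × HQ F δ | i.1.2.1 ≠ 0 ∧ ∃ g1, g = g1 * i.1.1 ∧
        C i.1.2.1 • u.1 = g1 • (star i.1.2.2 * i.2.1 * i.1.2.2) ∧
        C i.1.2.1 • u.2 = g1 • (star i.1.2.2 * i.2.2 * i.1.2.2)} 1 := by
    rintro ⟨⟨g2, c, ρ⟩, A1, B1⟩ ⟨⟨hg2, -, -⟩, -⟩
    simp only at hg2 ⊢
    apply CardLE.subsingleton
    rintro ⟨A, B⟩ ⟨hc, g1, e1, e2, e3⟩ ⟨A', B'⟩ ⟨hc', g1', e1', e2', e3'⟩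
    simp only at e1 e2 e3 e1' e2' e3'
    have : g1 = g1' := mul_right_cancel₀ hg2.ne_zero (e1.symm.trans e1')
    subst this
    rw [HQ_smul_cancel (C_ne_zero.2 hc) (e2.trans e2'.symm),
      HQ_smul_cancel (C_ne_zero.2 hc) (e3.trans e3'.symm)]
  have := CardLE.biUnion (hT.prod hk) h1 (s := GPairs δ (g ^ 2 * DA) (g ^ 2 * DB) (g ^ 2 * E)) (by
    rintro ⟨A, B⟩ h
    obtain ⟨g1, g2, ρ, c, A1, B1, k1, k2, k3, k4, k5, k6, k7⟩ := lemmaQ_iter hδ h2 _ g hg le_rfl A B h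
    exact ⟨((g2, c, ρ), (A1, B1)), ⟨⟨k1, ⟨g1, by rw [k2]; ring⟩, k4⟩, k5⟩, k3, g1, k2, k6, k7⟩)
  rwa [mul_one] at this

end

end

section
open Polynomial Quaternion

section
variable {F : Type*} [Field F] {δ : F}

theorem CardLE.image {α β : Type*} {t : Set β} {k : ℕ} (h : CardLE t k) (f : β → α) {s : Set α}
    (hs : ∀ x ∈ s, ∃ y ∈ t, x = f y) : CardLE s k := by
  have h1 : ∀ i ∈ t, CardLE ({f i} : Set α) 1 := by
    intro i _
    apply CardLE.subsingleton
    simp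
  have := CardLE.biUnion h h1 (s := s) (by
    intro x hx
    obtain ⟨y, hy, rfl⟩ := hs x hx
    exact ⟨y, hy, rfl⟩)
  rwa [mul_one] at this

/-- Gram entries -/
noncomputable def dD (P θ u : F[X]) : F[X] := -(u * (2 * P + θ * u))
noncomputable def dE (Q P θ u v k : F[X]) : F[X] := Q * k - P * (u + v) - θ * u * v

theorem disc_eq {P Q R θ u v k : F[X]} (h : P ^ 2 = Q * R) :
    dD P θ u * dD P θ v - dE Q P θ u v k ^ 2 =
      Q * (-R * (u - v) ^ 2 + 2 * k * (P * (u + v) + θ * u * v) - Q * k ^ 2) := by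
  unfold dD dE
  linear_combination (-(u - v) ^ 2) * h

theorem card_u [Fintype F] (h2 : (2 : F) ≠ 0) {g P θ : F[X]} (hg : g.Monic) {e : ℕ}
    (he : g.natDegree = e)
    (hcop : ∀ l : F[X], Irreducible l → l ∣ g → ¬ l ∣ P) (n : ℕ) :
    CardLE {u : F[X] | u.degree < n ∧ g ^ 2 ∣ dD P θ u}
      (2 ^ (2 * e) * Fintype.card F ^ (n - 2 * e)) := by
  classical
  have hg2 : (g ^ 2).Monic := hg.pow 2
  have hdeg : (g ^ 2).natDegree = 2 * e := by rw [hg.natDegree_pow, he]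
  have hd := monic_divisors_card (2 * e) (g ^ 2) hg2.ne_zero hdeg.le
  refine CardLE.fiber hd (fun u => normalize (EuclideanDomain.gcd (g ^ 2) u)) ?_ ?_
  · intro u hu
    refine ⟨monic_normalize ?_, ?_⟩
    · intro h
      exact hg2.ne_zero (EuclideanDomain.gcd_eq_zero_iff.1 h).1
    · rw [normalize_dvd_iff]; exact EuclideanDomain.gcd_dvd_left _ _
  · rintro h -
    rw [← hdeg]
    refine card_residue n (g ^ 2) hg2.ne_zero _ (fun f hf => hf.1.1) ?_
    rintro u ⟨⟨-, hu⟩, hu'⟩ v ⟨⟨-, hv⟩, hv'⟩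
    have cmp : ∀ d, d ∣ g ^ 2 → (d ∣ u ↔ d ∣ v) := by
      intro d hd
      have e : ∀ x : F[X], d ∣ x ↔ d ∣ normalize (EuclideanDomain.gcd (g ^ 2) x) := by
        intro x
        rw [dvd_normalize_iff]
        exact ⟨fun h => EuclideanDomain.dvd_gcd hd h, fun h => h.trans (EuclideanDomain.gcd_dvd_right _ _)⟩
      rw [e u, e v, hu', hv']
    have key : ∀ w : F[X], g ^ 2 ∣ dD P θ w → ∀ l : F[X], Irreducible l → ∀ k : ℕ, k ≠ 0 →
        l ^ k ∣ g ^ 2 → l ^ k ∣ w ∨ (l ^ k ∣ 2 * P + θ * w ∧ ¬ l ∣ θ) := by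
      intro w hw l hl k hk hlk
      have hlg : l ∣ g := hl.prime.dvd_of_dvd_pow ((dvd_pow_self l hk).trans hlk)
      have hlP := hcop l hl hlg
      have h1 : l ^ k ∣ w * (2 * P + θ * w) := by
        have := hlk.trans hw
        unfold dD at this
        rwa [dvd_neg] at this
      rcases irr_pow_cases hl h1 (by
        rintro ⟨h3, h4⟩
        apply hlP
        apply dvd_of_two h2
        have := dvd_sub h4 (h3.mul_left θ)
        simpa using this) with h3 | h3
      · exact Or.inl h3
      · refine Or.inr ⟨h3, ?_⟩
        intro h4
        apply hlP
        apply dvd_of_two h2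
        have := dvd_sub ((dvd_pow_self l hk).trans h3) (h4.mul_right w)
        simpa using this
    apply dvd_of_prime_pow hg2.ne_zero
    intro l hl k hlk
    by_cases hk : k = 0
    · subst hk; simp
    rcases key u hu l hl k hk hlk with h3 | ⟨h3, h5⟩
    · exact dvd_sub h3 ((cmp _ hlk).1 h3)
    · rcases key v hv l hl k hk hlk with h4 | ⟨h4, -⟩
      · exact dvd_sub ((cmp _ hlk).2 h4) h4
      · have h6 : l ^ k ∣ θ * (u - v) := by
          have := dvd_sub h3 h4
          convert this using 1; ring
        exact (IsCoprime.pow_left ((hl.coprime_iff_not_dvd).2 h5)).dvd_of_dvd_mul_left h6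

/-- index set for the Gram sum -/
def TT (P Q θ : F[X]) (n n' e : ℕ) : Set (F[X] × F[X] × F[X] × F[X]) :=
  {t | t.1.Monic ∧ t.1.natDegree = e ∧ (∀ l : F[X], Irreducible l → l ∣ t.1 → ¬ l ∣ P) ∧
    IsCoprime t.1 Q ∧
    t.2.1.degree < n ∧ t.2.2.1.degree < n ∧ t.2.2.2.degree < n' ∧ t.1 ^ 2 ∣ dD P θ t.2.1 ∧
    t.1 ^ 2 ∣ dD P θ t.2.2.1 ∧ t.1 ^ 2 ∣ dE Q P θ t.2.1 t.2.2.1 t.2.2.2}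

theorem card_TT [Fintype F] (h2 : (2 : F) ≠ 0) (P Q θ : F[X]) (n n' e : ℕ) :
    CardLE (TT P Q θ n n' e) (Fintype.card F ^ e * ((2 ^ (2 * e) * Fintype.card F ^ (n - 2 * e)) *
      ((2 ^ (2 * e) * Fintype.card F ^ (n - 2 * e)) * Fintype.card F ^ (n' - 2 * e)))) := by
  refine CardLE.fiber (card_monic e) (fun t => t.1) (fun t ht => ⟨ht.1, ht.2.1⟩) ?_
  rintro g ⟨hg, he⟩
  have hdeg : (g ^ 2).natDegree = 2 * e := by rw [hg.natDegree_pow, he]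
  by_cases hcop : (∀ l : F[X], Irreducible l → l ∣ g → ¬ l ∣ P) ∧ IsCoprime g Q
  swap
  · apply CardLE.empty
    rintro t ⟨ht, rfl⟩
    exact hcop ⟨ht.2.2.1, ht.2.2.2.1⟩
  have hu := card_u h2 (θ := θ) hg he hcop.1 n
  refine CardLE.fiber hu (fun t => t.2.1) ?_ ?_
  · rintro t ⟨⟨h1, h2, h3, h4, h5, h6, h7, h8, h9, h10⟩, rfl⟩
    exact ⟨h5, h8⟩
  rintro u -
  refine CardLE.fiber hu (fun t => t.2.2.1) ?_ ?_
  · rintro t ⟨⟨⟨h1, h2, h3, h4, h5, h6, h7, h8, h9, h10⟩, rfl⟩, -⟩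
    exact ⟨h6, h9⟩
  rintro v -
  have hk : CardLE {k : F[X] | k.degree < n' ∧ g ^ 2 ∣ dE Q P θ u v k}
      (Fintype.card F ^ (n' - (g ^ 2).natDegree)) := by
    refine card_residue n' (g ^ 2) (hg.pow 2).ne_zero _ (fun f hf => hf.1) ?_
    rintro k ⟨-, hk⟩ k' ⟨-, hk'⟩
    have : g ^ 2 ∣ Q * (k - k') := by
      have := dvd_sub hk hk'
      unfold dE at this
      convert this using 1; ring
    exact (hcop.2.pow_left).dvd_of_dvd_mul_left this
  rw [hdeg] at hk
  refine CardLE.inj hk (fun t => t.2.2.2) ?_ ?_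
  · rintro t ⟨⟨⟨⟨h1, h2, h3, h4, h5, h6, h7, h8, h9, h10⟩, rfl⟩, rfl⟩, rfl⟩
    exact ⟨h7, h10⟩
  · rintro ⟨g1, u1, v1, k1⟩ ⟨⟨⟨h1, rfl⟩, rfl⟩, rfl⟩ ⟨g2, u2, v2, k2⟩ ⟨⟨⟨h1', h3⟩, h4⟩, h5⟩ h6
    simp only at h3 h4 h5 h6
    rw [h3, h4, h5, h6]

theorem card_gram [Fintype F] (hδ : ¬ IsSquare δ) (h2 : (2 : F) ≠ 0) {g l0 DA DB E Δ2 : F[X]}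
    {τ D e : ℕ} (hg : g.Monic) (he : g.natDegree = e) (hl0 : Irreducible l0)
    (hcop : IsCoprime g (l0 ^ (2 * τ)))
    (hDA : g ^ 2 ∣ DA) (hDB : g ^ 2 ∣ DB) (hE : g ^ 2 ∣ E)
    (hns : ∀ l : F[X], Irreducible l → g ^ 2 * l ^ 2 ∣ DA → g ^ 2 * l ^ 2 ∣ DB →
      g ^ 2 * l ^ 2 ∣ E → False)
    (hΔ : DA * DB - E ^ 2 = l0 ^ (2 * τ) * Δ2) (hΔ0 : Δ2 ≠ 0) (hD : Δ2.natDegree ≤ D) :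
    4 * e ≤ D ∧ CardLE (GPairs δ DA DB E)
      (2 ^ e * (Fintype.card F * (Fintype.card F ^ (e + 3) * 2 ^ e)) *
        (2 * (((2 * τ + 1) * 2 ^ (D - 4 * e)) * ((2 * τ + 1) * 2 ^ (D - 4 * e))) *
          Fintype.card F ^ 2)) := by
  obtain ⟨DA, rfl⟩ := hDA
  obtain ⟨DB, rfl⟩ := hDB
  obtain ⟨E, rfl⟩ := hE
  have hg0 : g ^ 2 ≠ 0 := (hg.pow 2).ne_zero
  have hg4 : g ^ 4 ∣ l0 ^ (2 * τ) * Δ2 := ⟨DA * DB - E ^ 2, by rw [← hΔ]; ring⟩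
  obtain ⟨Δ3, rfl⟩ := (hcop.pow_left (m := 4)).dvd_of_dvd_mul_left hg4
  have hΔ3 : Δ3 ≠ 0 := right_ne_zero_of_mul hΔ0
  have hΔ' : DA * DB - E ^ 2 = l0 ^ (2 * τ) * Δ3 := by
    apply mul_left_cancel₀ (pow_ne_zero 2 hg0)
    linear_combination hΔ
  rw [natDegree_mul (hg.pow 4).ne_zero hΔ3, hg.natDegree_pow, he] at hD
  refine ⟨by omega, ?_⟩
  refine card_GPairs_sq hδ h2 hg he.le (card_GPairs hδ h2 ?_ ?_ ?_)
  · rw [hΔ']; exact mul_ne_zero (pow_ne_zero _ hl0.ne_zero) hΔ3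
  · intro l hl h3 h4 h5
    exact hns l hl (mul_dvd_mul_left _ h3) (mul_dvd_mul_left _ h4) (mul_dvd_mul_left _ h5)
  · rw [hΔ']
    exact card_divisors_mul (pow_ne_zero _ hl0.ne_zero) hΔ3 (card_divisors_pow hl0 (2 * τ))
      (monic_divisors_card (D - 4 * e) Δ3 hΔ3 (by omega))

/-- maximal square content -/
theorem exists_max_g {DA DB E : F[X]} (hDA : DA ≠ 0) : ∃ g : F[X], g.Monic ∧ g ^ 2 ∣ DA ∧ g ^ 2 ∣ DB ∧
    g ^ 2 ∣ E ∧ ∀ l : F[X], Irreducible l → g ^ 2 * l ^ 2 ∣ DA → g ^ 2 * l ^ 2 ∣ DB →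
      g ^ 2 * l ^ 2 ∣ E → False := by
  classical
  let Pr : ℕ → Prop := fun e => ∃ g : F[X], g.Monic ∧ g ^ 2 ∣ DA ∧ g ^ 2 ∣ DB ∧ g ^ 2 ∣ E ∧ g.natDegree = e
  have hb : ∀ e, Pr e → e ≤ DA.natDegree := by
    rintro e ⟨g, hg, h1, -, -, h4⟩
    have := natDegree_le_of_dvd h1 hDA
    rw [hg.natDegree_pow] at this
    omega
  have h0 : Pr 0 := ⟨1, monic_one, by simp⟩
  obtain ⟨g, hg, h1, h2, h3, h4⟩ := Nat.findGreatest_spec (P := Pr) (Nat.zero_le DA.natDegree) h0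
  refine ⟨g, hg, h1, h2, h3, ?_⟩
  intro l hl k1 k2 k3
  have hn := monic_normalize hl.ne_zero
  have ha : g ^ 2 * l ^ 2 = (g * l) ^ 2 := by ring
  have hd : (g * normalize l) ^ 2 ∣ g ^ 2 * l ^ 2 := by
    rw [ha]
    exact pow_dvd_pow_of_dvd (mul_dvd_mul_left _ (normalize_dvd_both l).1) 2
  have h5 : Pr (g * normalize l).natDegree := ⟨g * normalize l, hg.mul hn, hd.trans k1, hd.trans k2, hd.trans k3, rfl⟩
  have h6 := Nat.le_findGreatest (hb _ h5) h5
  rw [hg.natDegree_mul hn, h4] at h6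
  have h7 : 0 < (normalize l).natDegree := by
    have : natDegree (normalize l) = natDegree l := natDegree_eq_of_degree_eq degree_normalize
    rw [this]
    exact hl.natDegree_pos
  omega

end

end

section
open Polynomial Quaternion

section
variable {F : Type*} [Field F] {δ : F}

theorem l0_irr : Irreducible (1 - X : F[X]) := by
  have h : (1 - X : F[X]) = -(X - C 1) := by simp
  rw [h]
  exact (Associated.refl (X - C 1 : F[X])).neg_left.irreducible_iff.2 (irreducible_X_sub_C 1)

theorem l0_natDegree (T : ℕ) : ((1 - X : F[X]) ^ T).natDegree = T := by
  have h : (1 - X : F[X]) = -(X - C 1) := by simp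
  rw [natDegree_pow, h, natDegree_neg, natDegree_X_sub_C, mul_one]

theorem l0_eval (T : ℕ) : ((1 - X : F[X]) ^ T).eval 0 = 1 := by simp

theorem l0_ne (T : ℕ) : ((1 - X : F[X]) ^ T) ≠ 0 := pow_ne_zero _ l0_irr.ne_zero

theorem X_coprime {f : F[X]} (h : f.eval 0 ≠ 0) (n : ℕ) : IsCoprime (X ^ n) f := by
  apply IsCoprime.pow_left
  rw [irreducible_X.coprime_iff_not_dvd, X_dvd_iff, coeff_zero_eq_eval_zero]
  exact h

theorem eval_of_dvd {f g : F[X]} {n : ℕ} (hn : 1 ≤ n) (h : X ^ n ∣ f - g) : f.eval 0 = g.eval 0 := by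
  have h1 : (X : F[X]) ∣ f - g := (dvd_pow_self X (by omega)).trans h
  rw [X_dvd_iff, coeff_zero_eq_eval_zero, eval_sub, sub_eq_zero] at h1
  exact h1

theorem re_congr (h2 : (2 : F) ≠ 0) {f : F[X]} (h0 : f.eval 0 ≠ 0) {m : ℕ} (hm : 1 ≤ m) {z : HQ F δ}
    (hN : qN z = f ^ 2) (hz : SDvd (X ^ m) (z - f • 1)) : X ^ (2 * m) ∣ z.re - f := by
  obtain ⟨y, hy⟩ := hz
  have e1 : z.re = f + X ^ m * y.re := by
    have := congrArg QuaternionAlgebra.re hy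
    simp at this
    linear_combination this
  have e2 : z.imI = X ^ m * y.imI := by
    have := congrArg QuaternionAlgebra.imI hy
    simpa using this
  have e3 : z.imJ = X ^ m * y.imJ := by
    have := congrArg QuaternionAlgebra.imJ hy
    simpa using this
  have e4 : z.imK = X ^ m * y.imK := by
    have := congrArg QuaternionAlgebra.imK hy
    simpa using this
  have hev : z.re.eval 0 = f.eval 0 := eval_of_dvd hm ⟨y.re, by rw [e1]; ring⟩
  have hc : IsCoprime (X ^ (2 * m)) (z.re + f) := by
    apply X_coprime
    rw [eval_add, hev, ← two_mul]
    exact mul_ne_zero h2 h0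
  apply hc.dvd_of_dvd_mul_right
  rw [qN_eq, e2, e3, e4] at hN
  refine ⟨C δ * y.imI ^ 2 + X * (y.imJ ^ 2 - C δ * y.imK ^ 2), ?_⟩
  rw [pow_mul' X 2 m]
  linear_combination hN

theorem decomp (h2 : (2 : F) ≠ 0) {f : F[X]} (h0 : f.eval 0 ≠ 0) {m : ℕ} (hm : 1 ≤ m) {z : HQ F δ}
    (hN : qN z = f ^ 2) (hz : SDvd (X ^ m) (z - f • 1)) :
    ∃ (u : F[X]) (A : HQ F δ), A.re = 0 ∧ z = (f + X ^ (2 * m) * u) • (1 : HQ F δ) + (X ^ m : F[X]) • A ∧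
      qN A = dD f (X ^ (2 * m)) u ∧ z.re = f + X ^ (2 * m) * u := by
  obtain ⟨u, hu⟩ := re_congr h2 h0 hm hN hz
  have hu : z.re = f + X ^ (2 * m) * u := by linear_combination hu
  obtain ⟨y, hy⟩ := hz
  have e2 : z.imI = X ^ m * y.imI := by
    have := congrArg QuaternionAlgebra.imI hy
    simpa using this
  have e3 : z.imJ = X ^ m * y.imJ := by
    have := congrArg QuaternionAlgebra.imJ hy
    simpa using this
  have e4 : z.imK = X ^ m * y.imK := by
    have := congrArg QuaternionAlgebra.imK hy
    simpa using this
  refine ⟨u, ⟨0, y.imI, y.imJ, y.imK⟩, rfl, ?_, ?_, hu⟩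
  · ext1 <;> simp [hu, e2, e3, e4]
  · have hX : (X ^ (2 * m) : F[X]) ≠ 0 := pow_ne_zero _ X_ne_zero
    apply mul_left_cancel₀ hX
    rw [qN_eq] at hN ⊢
    rw [e2, e3, e4, hu] at hN
    unfold dD
    simp only
    rw [pow_mul' X 2 m] at hN ⊢
    linear_combination hN

theorem qN_sub_eq (a b : HQ F δ) : qN (a - b) = qN a + qN b - 2 * (star a * b).re := by
  simp [qN_eq]
  ring

theorem eq_of_re (hδ : ¬ IsSquare δ) {a b : HQ F δ} {f : F[X]} (ha : qN a = f) (hb : qN b = f)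
    (h : (star a * b).re = f) : a = b := by
  have : qN (a - b) = 0 := by rw [qN_sub_eq, ha, hb, h]; ring
  exact sub_eq_zero.1 (qN_eq_zero hδ this)

theorem eq_l0 {T : ℕ} {y : F[X]} (h : (1 - X) ^ T ∣ y) (hd : y.natDegree ≤ T) (h0 : y.eval 0 = 1) :
    y = (1 - X) ^ T := by
  obtain ⟨c, rfl⟩ := h
  have hc : c ≠ 0 := by rintro rfl; simp at h0
  rw [natDegree_mul (l0_ne T) hc, l0_natDegree] at hd
  obtain ⟨d, rfl⟩ := natDegree_eq_zero.1 (show c.natDegree = 0 by omega)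
  rw [eval_mul, l0_eval, one_mul, eval_C] at h0
  simp [h0]

/-- the pairs to be counted -/
def AA (F : Type*) [Field F] (δ : F) (τ s m : ℕ) : Set (HQ F δ × HQ F δ) :=
  {w | qN w.1 = ((1 - X) ^ (τ + s)) ^ 2 ∧ qN w.2 = ((1 - X) ^ (τ + s)) ^ 2 ∧
    SDvd (X ^ m) (w.1 - ((1 - X) ^ (τ + s) : F[X]) • 1) ∧
    SDvd (X ^ m) (w.2 - ((1 - X) ^ (τ + s) : F[X]) • 1) ∧
    ¬ (1 - X) ∣ w.1.re ∧ ¬ (1 - X) ∣ w.2.re ∧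
    ∃ x : F[X], (star w.1 * w.2).re = (1 - X) ^ (2 * τ) * x ∧ x.natDegree ≤ 2 * s}

theorem natDegree_mul_X_le {f : F[X]} {k N : ℕ} (h : (X ^ k * f).natDegree ≤ N) :
    f.natDegree ≤ N - k ∧ (f ≠ 0 → k + f.natDegree ≤ N) := by
  by_cases hf : f = 0
  · subst hf; simp
  · rw [natDegree_mul (pow_ne_zero _ X_ne_zero) hf, natDegree_X_pow] at h
    omega

structure AAData (δ : F) (τ s m : ℕ) (a b : HQ F δ) (u v k : F[X]) (A B : HQ F δ) : Prop where
  hA : A.re = 0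
  hB : B.re = 0
  ha : a = ((1 - X) ^ (τ + s) + X ^ (2 * m) * u) • (1 : HQ F δ) + (X ^ m : F[X]) • A
  hb : b = ((1 - X) ^ (τ + s) + X ^ (2 * m) * v) • (1 : HQ F δ) + (X ^ m : F[X]) • B
  nA : qN A = dD ((1 - X) ^ (τ + s)) (X ^ (2 * m)) u
  nB : qN B = dD ((1 - X) ^ (τ + s)) (X ^ (2 * m)) v
  ra : a.re = (1 - X) ^ (τ + s) + X ^ (2 * m) * u
  rb : b.re = (1 - X) ^ (τ + s) + X ^ (2 * m) * v
  nE : (A * star B).re = dE ((1 - X) ^ (2 * τ)) ((1 - X) ^ (τ + s)) (X ^ (2 * m)) u v k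
  hab : (star a * b).re = (1 - X) ^ (2 * τ) * ((1 - X) ^ (2 * s) + X ^ (2 * m) * k)
  du : 2 * m + u.natDegree ≤ τ + s
  dv : 2 * m + v.natDegree ≤ τ + s
  dk : k ≠ 0 → 2 * m + k.natDegree ≤ 2 * s
  hu : ¬ (1 - X) ∣ u
  hv : ¬ (1 - X) ∣ v
  dA : (qN A).natDegree ≤ 2 * (τ + s) - 2 * m
  dB : (qN B).natDegree ≤ 2 * (τ + s) - 2 * m
  dE' : ((A * star B).re).natDegree ≤ 2 * (τ + s) - 2 * m

theorem star_ab_re {a b A B : HQ F δ} {r r' t : F[X]} (ha : a = r • (1 : HQ F δ) + t • A)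
    (hb : b = r' • (1 : HQ F δ) + t • B) (hA : A.re = 0) (hB : B.re = 0) :
    (star a * b).re = r * r' + t ^ 2 * (A * star B).re := by
  subst ha hb
  simp [hA, hB]
  ring

theorem ab_re {a b A B : HQ F δ} {r r' t : F[X]} (ha : a = r • (1 : HQ F δ) + t • A)
    (hb : b = r' • (1 : HQ F δ) + t • B) (hA : A.re = 0) (hB : B.re = 0) :
    (a * b).re = r * r' - t ^ 2 * (A * star B).re := by
  subst ha hb
  simp [hA, hB]
  ring

theorem AA_data (hδ : ¬ IsSquare δ) (h2 : (2 : F) ≠ 0) {τ s m : ℕ} (hm : 1 ≤ m) (hs : 1 ≤ s)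
    {a b : HQ F δ} (h : (a, b) ∈ AA F δ τ s m) :
    ∃ u v k A B, AAData δ τ s m a b u v k A B := by
  obtain ⟨na, nb, sa, sb, hla, hlb, x, hx, hxd⟩ := h
  simp only at na nb sa sb hla hlb hx hxd
  have hP0 : ((1 - X : F[X]) ^ (τ + s)).eval 0 ≠ 0 := by simp
  obtain ⟨u, A, hA, ea, nA, ra⟩ := decomp h2 hP0 hm na sa
  obtain ⟨v, B, hB, eb, nB, rb⟩ := decomp h2 hP0 hm nb sb
  have hX : (X ^ (2 * m) : F[X]) ≠ 0 := pow_ne_zero _ X_ne_zero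
  have hPP : ((1 - X : F[X]) ^ (τ + s)) ^ 2 = (1 - X) ^ (2 * τ) * (1 - X) ^ (2 * s) := by
    rw [← pow_add, ← pow_mul]; congr 1; ring
  have hPd : (((1 - X : F[X]) ^ (τ + s)) ^ 2).natDegree ≤ 2 * (τ + s) := by
    rw [← pow_mul, l0_natDegree]; omega
  -- k
  have hk : (X ^ (2 * m) : F[X]) ∣ x - (1 - X) ^ (2 * s) := by
    have h3 : SDvd (X ^ m) (star a * b - (((1 - X) ^ (τ + s)) ^ 2 : F[X]) • (1 : HQ F δ)) := by
      have e1 : star a * b - (((1 - X) ^ (τ + s)) ^ 2 : F[X]) • (1 : HQ F δ) =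
          star a * (b - ((1 - X) ^ (τ + s) : F[X]) • 1) +
            star (a - ((1 - X) ^ (τ + s) : F[X]) • 1) * (((1 - X) ^ (τ + s) : F[X]) • 1) := by
        ext1 <;> simp <;> ring
      rw [e1]
      exact (sb.mul_left _).add (sa.star.mul_right _)
    have h4 := re_congr h2 (by simp) hm (z := star a * b) (by rw [qN_mul, qN_star, na, nb, ← sq]) h3
    rw [hx, hPP, ← mul_sub] at h4
    refine IsCoprime.dvd_of_dvd_mul_left ?_ h4
    apply X_coprime; simp
  obtain ⟨k, hk⟩ := hk
  have hxk : x = (1 - X) ^ (2 * s) + X ^ (2 * m) * k := by linear_combination hk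
  have sre := star_ab_re ea eb hA hB
  have hlP : (1 - X : F[X]) ∣ (1 - X) ^ (τ + s) := dvd_pow_self _ (by omega)
  have hlu : ¬ (1 - X) ∣ u := by
    intro h; apply hla; rw [ra]; exact dvd_add hlP (h.mul_left _)
  have hlv : ¬ (1 - X) ∣ v := by
    intro h; apply hlb; rw [rb]; exact dvd_add hlP (h.mul_left _)
  have dga := (qN_deg hδ a (k := 2 * (τ + s)) (by rw [na]; exact hPd)).1
  have dgb := (qN_deg hδ b (k := 2 * (τ + s)) (by rw [nb]; exact hPd)).1
  have du : 2 * m + u.natDegree ≤ τ + s := by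
    apply (natDegree_mul_X_le (f := u) (k := 2 * m) (N := τ + s) ?_).2
    · rintro rfl; simp at hlu
    · have : X ^ (2 * m) * u = a.re - (1 - X) ^ (τ + s) := by rw [ra]; ring
      rw [this]
      refine (natDegree_sub_le _ _).trans (max_le (by omega) ?_)
      rw [l0_natDegree]
  have dv : 2 * m + v.natDegree ≤ τ + s := by
    apply (natDegree_mul_X_le (f := v) (k := 2 * m) (N := τ + s) ?_).2
    · rintro rfl; simp at hlv
    · have : X ^ (2 * m) * v = b.re - (1 - X) ^ (τ + s) := by rw [rb]; ring
      rw [this]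
      refine (natDegree_sub_le _ _).trans (max_le (by omega) ?_)
      rw [l0_natDegree]
  have hsub : ∀ f g : F[X], f.natDegree ≤ 2 * (τ + s) → g.natDegree ≤ 2 * (τ + s) →
      (f - g).natDegree ≤ 2 * (τ + s) := fun f g hf hg =>
    (natDegree_sub_le _ _).trans (max_le hf hg)
  refine ⟨u, v, k, A, B, hA, hB, ea, eb, nA, nB, ra, rb, ?_, by rw [hx, hxk], du, dv, ?_, hlu, hlv, ?_, ?_, ?_⟩
  · apply mul_left_cancel₀ hX
    rw [hx, hxk, mul_add, ← hPP, ← pow_mul X m 2, mul_comm m 2] at sre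
    unfold dE
    linear_combination -sre
  · apply (natDegree_mul_X_le (f := k) (k := 2 * m) (N := 2 * s) ?_).2
    rw [← hk]
    refine (natDegree_sub_le _ _).trans (max_le hxd ?_)
    rw [l0_natDegree]
  · apply (natDegree_mul_X_le (k := 2 * m) ?_).1
    have : X ^ (2 * m) * qN A = ((1 - X) ^ (τ + s)) ^ 2 - a.re ^ 2 := by
      rw [nA, ra]; unfold dD; ring
    rw [this]
    exact hsub _ _ hPd (by rw [natDegree_pow]; omega)
  · apply (natDegree_mul_X_le (k := 2 * m) ?_).1
    have : X ^ (2 * m) * qN B = ((1 - X) ^ (τ + s)) ^ 2 - b.re ^ 2 := by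
      rw [nB, rb]; unfold dD; ring
    rw [this]
    exact hsub _ _ hPd (by rw [natDegree_pow]; omega)
  · apply (natDegree_mul_X_le (k := 2 * m) ?_).1
    have : X ^ (2 * m) * (A * star B).re = (1 - X) ^ (2 * τ) * x - a.re * b.re := by
      rw [hx, ← pow_mul X m 2, mul_comm m 2] at sre
      rw [ra, rb]; linear_combination -sre
    rw [this]
    apply hsub
    · refine natDegree_mul_le.trans ?_
      rw [l0_natDegree]; omega
    · exact natDegree_mul_le.trans (by omega)

end

end

section
open Polynomial Quaternion

section
variable {F : Type*} [Field F] {δ : F}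

theorem AA_dep (hδ : ¬ IsSquare δ) (h2 : (2 : F) ≠ 0) {τ s m : ℕ} (hm : 1 ≤ m) (hs : 1 ≤ s)
    {a b : HQ F δ} (h : (a, b) ∈ AA F δ τ s m) {u v k : F[X]} {A B : HQ F δ}
    (h' : AAData δ τ s m a b u v k A B) (h0 : qN A * qN B = (A * star B).re ^ 2) :
    b = a ∨ b = star a := by
  obtain ⟨na, nb, sa, sb, hla, hlb, x, hx, hxd⟩ := h
  simp only at na nb sa sb hla hlb hx hxd
  have e1 := star_ab_re h'.ha h'.hb h'.hA h'.hB
  have e2 := ab_re h'.ha h'.hb h'.hA h'.hB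
  rw [← pow_mul X m 2, mul_comm m 2, ← h'.ra, ← h'.rb] at e1 e2
  have eA : X ^ (2 * m) * qN A = ((1 - X) ^ (τ + s)) ^ 2 - a.re ^ 2 := by
    rw [h'.nA, h'.ra]; unfold dD; ring
  have eB : X ^ (2 * m) * qN B = ((1 - X) ^ (τ + s)) ^ 2 - b.re ^ 2 := by
    rw [h'.nB, h'.rb]; unfold dD; ring
  have eP : ((1 - X : F[X]) ^ (τ + s)) ^ 2 = (1 - X) ^ (2 * (τ + s)) := by
    rw [← pow_mul]; congr 1; ring
  have hPd : (((1 - X : F[X]) ^ (τ + s)) ^ 2).natDegree ≤ 2 * (τ + s) := by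
    rw [eP, l0_natDegree]
  have dga := (qN_deg hδ a (k := 2 * (τ + s)) (by rw [na]; exact hPd)).1
  have dgb := (qN_deg hδ b (k := 2 * (τ + s)) (by rw [nb]; exact hPd)).1
  have dab : ((a.re) * b.re).natDegree ≤ 2 * (τ + s) := natDegree_mul_le.trans (by omega)
  have dE : (X ^ (2 * m) * (A * star B).re).natDegree ≤ 2 * (τ + s) := by
    refine natDegree_mul_le.trans ?_
    have := h'.dE'
    have := h'.du
    rw [natDegree_X_pow]; omega
  have ev : ∀ y : F[X], (a.re * b.re + X ^ (2 * m) * y).eval 0 = 1 := by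
    intro y
    have hm0 : 2 * m ≠ 0 := by omega
    rw [h'.ra, h'.rb]
    simp [hm0]
  have hprod : (1 - X : F[X]) ^ (2 * (τ + s)) ∣ (star a * b).re * (a * b).re := by
    refine ⟨a.re ^ 2 + b.re ^ 2 - (1 - X) ^ (2 * (τ + s)), ?_⟩
    rw [e1, e2]
    rw [eP] at eA eB
    linear_combination X ^ (4 * m) * h0 - X ^ (2 * m) * qN B * eA - ((1 - X) ^ (2 * (τ + s)) - a.re ^ 2) * eB
  rcases irr_pow_cases l0_irr hprod (by
    rintro ⟨k1, k2⟩
    have k3 := dvd_add k1 k2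
    rw [e1, e2] at k3
    have k4 : (1 - X : F[X]) ∣ 2 * (a.re * b.re) := by convert k3 using 1; ring
    rcases l0_irr.prime.dvd_or_dvd (dvd_of_two h2 k4) with k5 | k5
    · exact hla k5
    · exact hlb k5) with h3 | h3
  · left
    symm
    apply eq_of_re hδ na nb
    rw [eP]
    apply eq_l0 h3
    · rw [e1]; exact (natDegree_add_le _ _).trans (max_le dab dE)
    · rw [e1]; exact ev _
  · right
    symm
    apply eq_of_re hδ (by rw [qN_star]; exact na) nb
    rw [star_star, eP]
    apply eq_l0 h3
    · rw [e2]; exact (natDegree_sub_le _ _).trans (max_le dab dE)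
    · rw [e2]
      have := ev (-(A * star B).re)
      rw [mul_neg, ← sub_eq_add_neg] at this
      exact this

theorem card_single [Fintype F] (hδ : ¬ IsSquare δ) (h2 : (2 : F) ≠ 0) {T m : ℕ} (hm : 1 ≤ m) :
    CardLE {a : HQ F δ | qN a = ((1 - X) ^ T) ^ 2 ∧ SDvd (X ^ m) (a - ((1 - X) ^ T : F[X]) • 1)}
      (Fintype.card F ^ (T + 1 - 2 * m) * (Fintype.card F ^ (T + 1 - m) *
        (Fintype.card F ^ 2 * 2 ^ (2 * T)))) := by
  have eP : ((1 - X : F[X]) ^ T) ^ 2 = (1 - X) ^ (2 * T) := by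
    rw [← pow_mul]; congr 1; ring
  have hdeg : ∀ a : HQ F δ, qN a = ((1 - X) ^ T) ^ 2 → _ := fun a ha =>
    qN_deg hδ a (k := 2 * T) (by rw [ha, eP, l0_natDegree])
  have hX : ∀ k, (X ^ k : F[X]) ≠ 0 := fun k => pow_ne_zero _ X_ne_zero
  have c1 := card_residue (F := F) (T + 1) (X ^ (2 * m)) (hX _)
    {r | r.degree < (T + 1 : ℕ) ∧ X ^ (2 * m) ∣ r - (1 - X) ^ T} (fun f hf => hf.1) (by
      intro f hf g hg
      have := dvd_sub hf.2 hg.2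
      convert this using 1; ring)
  have c2 := card_residue (F := F) (T + 1) (X ^ m) (hX _)
    {r | r.degree < (T + 1 : ℕ) ∧ X ^ m ∣ r} (fun f hf => hf.1) (by
      intro f hf g hg
      exact dvd_sub hf.2 hg.2)
  rw [natDegree_X_pow] at c1 c2
  refine CardLE.fiber c1 (fun a => a.re) ?_ ?_
  · rintro a ⟨na, sa⟩
    refine ⟨degree_lt_of_natDegree_lt fun _ => ?_, re_congr h2 (by simp) hm na sa⟩
    have := (hdeg a na).1
    omega
  rintro r -
  refine CardLE.fiber c2 (fun a => a.imI) ?_ ?_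
  · rintro a ⟨⟨na, sa⟩, -⟩
    refine ⟨degree_lt_of_natDegree_lt fun _ => ?_, ?_⟩
    · have := (hdeg a na).2.1
      omega
    · obtain ⟨y, hy⟩ := sa
      have := congrArg QuaternionAlgebra.imI hy
      exact ⟨y.imI, by simpa using this⟩
  rintro y -
  apply CardLE.of_base
  rintro a0 ⟨⟨⟨na0, sa0⟩, hr0⟩, hy0⟩
  have hf : (a0.imJ ^ 2 - C δ * a0.imK ^ 2).natDegree ≤ 2 * T := by
    obtain ⟨-, -, h3, h4⟩ := hdeg a0 na0
    have h5 : 2 * a0.imJ.natDegree ≤ 2 * T := by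
      by_cases h : a0.imJ = 0
      · rw [h]; simp
      · have := h3 h; omega
    have h6 : 2 * a0.imK.natDegree ≤ 2 * T := by
      by_cases h : a0.imK = 0
      · rw [h]; simp
      · have := h4 h; omega
    refine (natDegree_sub_le _ _).trans (max_le ?_ ?_)
    · rw [natDegree_pow]; omega
    · refine natDegree_mul_le.trans ?_
      rw [natDegree_C, natDegree_pow]; omega
  refine CardLE.inj (card_norm_form hδ _ (2 * T) hf) (fun a => (a.imJ, a.imK)) ?_ ?_
  · rintro a ⟨⟨⟨na, sa⟩, hr⟩, hy⟩
    simp only [Set.mem_ofPred_eq]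
    change a.re = r at hr; change a.imI = y at hy; change a0.re = r at hr0; change a0.imI = y at hy0
    rw [← na0, qN_eq, qN_eq, hr, hy, hr0, hy0] at na
    apply mul_left_cancel₀ (X_ne_zero (R := F))
    linear_combination -na
  · rintro a ⟨⟨⟨na, sa⟩, hr⟩, hy⟩ b ⟨⟨⟨nb, sb⟩, hr'⟩, hy'⟩ hab
    simp only [Prod.mk.injEq] at hab hr hy hr' hy'
    ext1
    · rw [hr, hr']
    · rw [hy, hy']
    · exact hab.1
    · exact hab.2

/-- conditions on an index for the independent part -/
def TCond (τ s m e : ℕ) (t : F[X] × F[X] × F[X] × F[X]) : Prop :=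
  2 * e ≤ 2 * (τ + s + 1 - 2 * m) + (2 * s + 1 - 2 * m) ∧ 2 * m ≤ τ + s ∧ 2 * m ≤ 2 * s ∧
  (∀ l : F[X], Irreducible l → t.1 ^ 2 * l ^ 2 ∣ dD ((1 - X) ^ (τ + s)) (X ^ (2 * m)) t.2.1 →
      t.1 ^ 2 * l ^ 2 ∣ dD ((1 - X) ^ (τ + s)) (X ^ (2 * m)) t.2.2.1 →
      t.1 ^ 2 * l ^ 2 ∣ dE ((1 - X) ^ (2 * τ)) ((1 - X) ^ (τ + s)) (X ^ (2 * m)) t.2.1 t.2.2.1 t.2.2.2 →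
      False) ∧
  ∃ Δ2 : F[X], dD ((1 - X) ^ (τ + s)) (X ^ (2 * m)) t.2.1 * dD ((1 - X) ^ (τ + s)) (X ^ (2 * m)) t.2.2.1 -
    dE ((1 - X) ^ (2 * τ)) ((1 - X) ^ (τ + s)) (X ^ (2 * m)) t.2.1 t.2.2.1 t.2.2.2 ^ 2 =
      (1 - X) ^ (2 * τ) * Δ2 ∧ Δ2 ≠ 0 ∧ Δ2.natDegree ≤ 4 * (τ + s) - 4 * m - 2 * τ

/-- the pieces of the independent part -/
def AAe (F : Type*) [Field F] (δ : F) (τ s m e : ℕ) : Set (HQ F δ × HQ F δ) :=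
  {w | ∃ t ∈ TT (F := F) ((1 - X) ^ (τ + s)) ((1 - X) ^ (2 * τ)) (X ^ (2 * m)) (τ + s + 1 - 2 * m)
      (2 * s + 1 - 2 * m) e, TCond τ s m e t ∧
    ∃ z ∈ GPairs δ (dD ((1 - X) ^ (τ + s)) (X ^ (2 * m)) t.2.1)
        (dD ((1 - X) ^ (τ + s)) (X ^ (2 * m)) t.2.2.1)
        (dE ((1 - X) ^ (2 * τ)) ((1 - X) ^ (τ + s)) (X ^ (2 * m)) t.2.1 t.2.2.1 t.2.2.2),
      w = (((1 - X) ^ (τ + s) + X ^ (2 * m) * t.2.1) • (1 : HQ F δ) + (X ^ m : F[X]) • z.1,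
        ((1 - X) ^ (τ + s) + X ^ (2 * m) * t.2.2.1) • (1 : HQ F δ) + (X ^ m : F[X]) • z.2)}

theorem card_AAe [Fintype F] (hδ : ¬ IsSquare δ) (h2 : (2 : F) ≠ 0) (τ s m e : ℕ) (hm : 1 ≤ m)
    (hs : 1 ≤ s) : CardLE (AAe F δ τ s m e)
      (2 * (2 * τ + 1) ^ 2 * 4 ^ (4 * (τ + s) - 4 * m - 2 * τ) *
        Fintype.card F ^ (2 * τ + 4 * s + 9 - 6 * m)) := by
  set D := 4 * (τ + s) - 4 * m - 2 * τ with hD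
  by_cases hc : 2 * e ≤ 2 * (τ + s + 1 - 2 * m) + (2 * s + 1 - 2 * m) ∧ 2 * m ≤ τ + s ∧ 2 * m ≤ 2 * s ∧
      4 * e ≤ D
  swap
  · apply CardLE.empty
    rintro w ⟨t, ht, ⟨c1, c2, c3, c4, Δ2, c5, c6, c7⟩, -⟩
    obtain ⟨g1, g2, g3, g4, g5, g6, g7, g8, g9, g10⟩ := ht
    exact hc ⟨c1, c2, c3, (card_gram hδ h2 g1 g2 l0_irr g4 g8 g9 g10 c4 c5 c6 c7).1⟩
  obtain ⟨hc1, hc2, hc3, hc4⟩ := hc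
  have hq : 1 ≤ Fintype.card F := Fintype.card_pos
  have main := CardLE.biUnion (card_TT h2 ((1 - X) ^ (τ + s)) ((1 - X) ^ (2 * τ)) (X ^ (2 * m))
      (τ + s + 1 - 2 * m) (2 * s + 1 - 2 * m) e) (s := AAe F δ τ s m e)
    (l := (2 ^ e * (Fintype.card F * (Fintype.card F ^ (e + 3) * 2 ^ e)) *
        (2 * (((2 * τ + 1) * 2 ^ (D - 4 * e)) * ((2 * τ + 1) * 2 ^ (D - 4 * e))) *
          Fintype.card F ^ 2)))
    (g := fun t => {w | TCond τ s m e t ∧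
    ∃ z ∈ GPairs δ (dD ((1 - X) ^ (τ + s)) (X ^ (2 * m)) t.2.1)
        (dD ((1 - X) ^ (τ + s)) (X ^ (2 * m)) t.2.2.1)
        (dE ((1 - X) ^ (2 * τ)) ((1 - X) ^ (τ + s)) (X ^ (2 * m)) t.2.1 t.2.2.1 t.2.2.2),
      w = (((1 - X) ^ (τ + s) + X ^ (2 * m) * t.2.1) • (1 : HQ F δ) + (X ^ m : F[X]) • z.1,
        ((1 - X) ^ (τ + s) + X ^ (2 * m) * t.2.2.1) • (1 : HQ F δ) + (X ^ m : F[X]) • z.2)}) (by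
      intro t ht
      by_cases htc : TCond τ s m e t
      swap
      · apply CardLE.empty
        rintro w ⟨h, -⟩
        exact htc h
      have htc' := htc
      obtain ⟨c1, c2, c3, c4, Δ2, c5, c6, c7⟩ := htc
      obtain ⟨g1, g2, g3, g4, g5, g6, g7, g8, g9, g10⟩ := ht
      exact CardLE.image (card_gram hδ h2 g1 g2 l0_irr g4 g8 g9 g10 c4 c5 c6 c7).2 _ (by
        rintro w ⟨-, z, hz, hw⟩
        exact ⟨z, hz, hw⟩)) (by
      rintro w ⟨t, ht, htc, z, hz, hw⟩
      exact ⟨t, ht, htc, z, hz, hw⟩)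
  refine main.mono subset_rfl ?_
  set q := Fintype.card F
  set n := τ + s + 1 - 2 * m
  set n' := 2 * s + 1 - 2 * m
  have e1 : q ^ e * (2 ^ (2 * e) * q ^ (n - 2 * e) * (2 ^ (2 * e) * q ^ (n - 2 * e) * q ^ (n' - 2 * e))) *
      (2 ^ e * (q * (q ^ (e + 3) * 2 ^ e)) *
        (2 * ((2 * τ + 1) * 2 ^ (D - 4 * e) * ((2 * τ + 1) * 2 ^ (D - 4 * e))) * q ^ 2)) =
      2 * (2 * τ + 1) ^ 2 * 4 ^ (3 * e + (D - 4 * e)) *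
        q ^ (2 * e + 6 + 2 * (n - 2 * e) + (n' - 2 * e)) := by
    rw [show 4 = 2 ^ 2 from rfl, ← pow_mul]
    ring
  rw [e1]
  refine Nat.mul_le_mul (Nat.mul_le_mul le_rfl (Nat.pow_le_pow_right (by norm_num) (by omega)))
    (Nat.pow_le_pow_right hq (by omega))

end

end

section
open Polynomial Quaternion

section
variable {F : Type*} [Field F] {δ : F}

theorem AA_indep [Fintype F] (hδ : ¬ IsSquare δ) (h2 : (2 : F) ≠ 0) {τ s m : ℕ} (hm : 1 ≤ m) (hs : 1 ≤ s)
    {a b : HQ F δ} (h : (a, b) ∈ AA F δ τ s m) {u v k : F[X]} {A B : HQ F δ}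
    (h' : AAData δ τ s m a b u v k A B) (h0 : qN A * qN B ≠ (A * star B).re ^ 2) :
    ∃ e ∈ Finset.range (4 * (τ + s) + 1), (a, b) ∈ AAe F δ τ s m e := by
  obtain ⟨na, nb, sa, sb, hla, hlb, x, hx, hxd⟩ := h
  simp only at na nb sa sb hla hlb hx hxd
  have hP2 : ((1 - X : F[X]) ^ (τ + s)) ^ 2 = (1 - X) ^ (2 * τ) * (1 - X) ^ (2 * s) := by
    rw [← pow_add, ← pow_mul]; congr 1; ring
  have hlP : (1 - X : F[X]) ∣ (1 - X) ^ (τ + s) := dvd_pow_self _ (by omega)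
  have hk0 : k ≠ 0 := by
    intro hk
    have : a = b := by
      apply eq_of_re hδ na nb
      rw [h'.hab, hk, hP2]; ring
    subst this
    apply h0
    have e1 : (X ^ m : F[X]) • A = (X ^ m : F[X]) • B := by
      have hr := h'.ra.symm.trans h'.rb
      have := h'.ha.symm.trans h'.hb
      rw [hr] at this
      exact add_left_cancel this
    have e2 : A = B := HQ_smul_cancel (pow_ne_zero _ X_ne_zero) e1
    subst e2
    rw [mul_star_qN]
    simp; ring
  have hu0 : u ≠ 0 := by rintro rfl; exact h'.hu (dvd_zero _)
  have hv0 : v ≠ 0 := by rintro rfl; exact h'.hv (dvd_zero _)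
  have hA0 : qN A ≠ 0 := by
    intro hA
    have hA' := qN_eq_zero hδ hA
    apply h0
    rw [hA, hA']; simp
  obtain ⟨g, hg, g1, g2, g3, g4⟩ := exists_max_g (DB := qN B) (E := (A * star B).re) hA0
  have hdD : ∀ w : F[X], ¬ (1 - X) ∣ w → ¬ (1 - X) ∣ dD ((1 - X) ^ (τ + s)) (X ^ (2 * m)) w := by
    intro w hw hd
    unfold dD at hd
    rw [dvd_neg] at hd
    rcases l0_irr.prime.dvd_or_dvd hd with h3 | h3
    · exact hw h3
    · have h4 := dvd_sub h3 (hlP.mul_left 2)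
      rw [add_sub_cancel_left] at h4
      rcases l0_irr.prime.dvd_or_dvd h4 with h5 | h5
      · have := l0_irr.prime.dvd_of_dvd_pow h5
        obtain ⟨c, hc⟩ := this
        have := congrArg (eval 1) hc
        simp at this
      · exact hw h5
  have hlg : ¬ (1 - X) ∣ g := by
    intro hd
    apply hdD u h'.hu
    rw [← h'.nA]
    exact (hd.trans (dvd_pow_self g two_ne_zero)).trans g1
  have hgl : IsCoprime g (1 - X) := ((l0_irr.coprime_iff_not_dvd).2 hlg).symm
  have hguvk : g ^ 2 ∣ u * v * k := by
    rw [h'.nA] at g1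
    rw [h'.nB] at g2
    rw [h'.nE] at g3
    have : g ^ 2 ∣ (1 - X) ^ (2 * τ) * (2 * (u * v * k)) := by
      have e1 := dvd_sub (g3.mul_left (2 * u * v)) (dvd_add (g1.mul_left (v ^ 2)) (g2.mul_left (u ^ 2)))
      have e2 : (1 - X) ^ (2 * τ) * (2 * (u * v * k)) = 2 * u * v * dE ((1 - X) ^ (2 * τ)) ((1 - X) ^ (τ + s)) (X ^ (2 * m)) u v k
         - (v ^ 2 * dD ((1 - X) ^ (τ + s)) (X ^ (2 * m)) u + u ^ 2 * dD ((1 - X) ^ (τ + s)) (X ^ (2 * m)) v)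
          := by unfold dE dD; ring
      rw [e2]; exact e1
    exact dvd_of_two h2 ((hgl.pow (m := 2) (n := 2 * τ)).dvd_of_dvd_mul_left this)
  have hdeg : 2 * g.natDegree ≤ u.natDegree + v.natDegree + k.natDegree := by
    have := natDegree_le_of_dvd hguvk (mul_ne_zero (mul_ne_zero hu0 hv0) hk0)
    rwa [hg.natDegree_pow, natDegree_mul (mul_ne_zero hu0 hv0) hk0, natDegree_mul hu0 hv0] at this
  have du := h'.du
  have dv := h'.dv
  have dk := h'.dk hk0
  have hdisc := disc_eq (θ := X ^ (2 * m)) (u := u) (v := v) (k := k) hP2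
  have hDeq := hdisc
  rw [← h'.nA, ← h'.nB, ← h'.nE] at hDeq
  refine ⟨g.natDegree, Finset.mem_range.2 (by omega), (g, u, v, k), ?_, ⟨by omega, by omega, by omega, ?_, ?_⟩,
    (A, B), ?_, ?_⟩
  · refine ⟨hg, rfl, ?_, hgl.pow_right, ?_, ?_, ?_, ?_, ?_, ?_⟩
    · intro l hl hlg' hlP'
      have h3 := hl.prime.dvd_of_dvd_pow hlP'
      exact hl.not_isUnit (hgl.isUnit_of_dvd' hlg' h3)
    · exact degree_lt_of_natDegree_lt fun _ => (by simp only; omega)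
    · exact degree_lt_of_natDegree_lt fun _ => (by simp only; omega)
    · exact degree_lt_of_natDegree_lt fun _ => (by simp only; omega)
    · simp only; rw [← h'.nA]; exact g1
    · simp only; rw [← h'.nB]; exact g2
    · simp only; rw [← h'.nE]; exact g3
  · simp only
    rw [← h'.nA, ← h'.nB, ← h'.nE]
    exact g4
  · refine ⟨_, hdisc, ?_, ?_⟩
    · intro hz
      apply h0
      rw [hz, mul_zero, sub_eq_zero] at hDeq
      exact hDeq
    · set Δ2 := (-(1 - X) ^ (2 * s) * (u - v) ^ 2 + 2 * k * ((1 - X) ^ (τ + s) * (u + v) + X ^ (2 * m) * u * v) -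
        (1 - X) ^ (2 * τ) * k ^ 2) with hΔ
      by_cases hΔ0 : Δ2 = 0
      · rw [hΔ0]; simp
      have h3 : (qN A * qN B - (A * star B).re ^ 2).natDegree ≤ 4 * (τ + s) - 4 * m := by
        have := h'.dA
        have := h'.dB
        have := h'.dE'
        refine (natDegree_sub_le _ _).trans (max_le ?_ ?_)
        · exact natDegree_mul_le.trans (by omega)
        · rw [natDegree_pow]; omega
      rw [hDeq, natDegree_mul (l0_ne _) hΔ0, l0_natDegree] at h3
      omega
  · exact ⟨h'.hA, h'.hB, h'.nA, h'.nB, h'.nE⟩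
  · rw [h'.ha, h'.hb]

theorem card_AA [Fintype F] (hδ : ¬ IsSquare δ) (h2 : (2 : F) ≠ 0) {τ s m i t : ℕ} (hm : 1 ≤ m)
    (hs : 1 ≤ s) (hst : s ≤ t) (ht : 2 * t = 3 * m) (hi : τ + i = t) :
    ∃ K, CardLE (AA F δ τ s m) K ∧ K * Fintype.card F ^ (2 * i) ≤
      1000 * (m + 1) ^ 3 * 1024 ^ m * Fintype.card F ^ 9 * Fintype.card F ^ (2 * s) := by
  by_cases hne : ∃ w, w ∈ AA F δ τ s m
  swap
  · refine ⟨0, CardLE.empty (fun x hx => hne ⟨x, hx⟩) 0, by simp⟩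
  obtain ⟨⟨a0, b0⟩, hw⟩ := hne
  obtain ⟨u0, v0, k0, A0, B0, h0⟩ := AA_data hδ h2 hm hs hw
  have hTm := h0.du
  have hdep := CardLE.biUnion (card_single hδ h2 (T := τ + s) hm)
    (g := fun a => {w : HQ F δ × HQ F δ | w = (a, a) ∨ w = (a, star a)}) (l := 1 + 1)
    (s := {w | w ∈ AA F δ τ s m ∧ (w.2 = w.1 ∨ w.2 = star w.1)}) (by
      intro a ha
      exact CardLE.union (t := {(a, a)}) (u := {(a, star a)}) (CardLE.subsingleton (by simp))
        (CardLE.subsingleton (by simp)) (by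
          rintro x (hx | hx)
          · left; exact hx
          · right; exact hx)) (by
      rintro ⟨a, b⟩ ⟨h, h'⟩
      refine ⟨a, ⟨h.1, h.2.2.1⟩, ?_⟩
      rcases h' with h' | h'
      · left; simp only at h'; rw [h']
      · right; simp only at h'; rw [h'])
  set q := Fintype.card F
  have hq : 1 ≤ q := Fintype.card_pos
  obtain ⟨K2, hind, hK2⟩ : ∃ K2, CardLE {w | ∃ e ∈ Finset.range (4 * (τ + s) + 1), w ∈ AAe F δ τ s m e} K2 ∧
      K2 * q ^ (2 * i) ≤ 640 * (m + 1) ^ 3 * 1024 ^ m * q ^ 9 * q ^ (2 * s) := by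
    by_cases hms : m ≤ s
    swap
    · refine ⟨0, CardLE.empty ?_ 0, by simp⟩
      rintro w ⟨e, -, t, -, ⟨-, -, hc, -⟩, -⟩
      omega
    refine ⟨_, CardLE.sum (Finset.range (4 * (τ + s) + 1)) (g := AAe F δ τ s m)
      (fun e _ => card_AAe hδ h2 τ s m e hm hs) (fun x hx => hx), ?_⟩
    rw [Finset.sum_const, Finset.card_range, smul_eq_mul]
    have e2 : (4 * (τ + s) + 1) * (2 * (2 * τ + 1) ^ 2 * 4 ^ (4 * (τ + s) - 4 * m - 2 * τ) *
        q ^ (2 * τ + 4 * s + 9 - 6 * m)) * q ^ (2 * i) =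
        ((4 * (τ + s) + 1) * (2 * (2 * τ + 1) ^ 2)) * 4 ^ (4 * (τ + s) - 4 * m - 2 * τ) *
        q ^ (2 * τ + 4 * s + 9 - 6 * m + 2 * i) := by ring
    have e3 : 640 * (m + 1) ^ 3 * 1024 ^ m * q ^ 9 * q ^ (2 * s) =
        ((20 * (m + 1)) * (2 * (4 * (m + 1)) ^ 2)) * 4 ^ (5 * m) * q ^ (9 + 2 * s) := by
      rw [show (1024 : ℕ) = 4 ^ 5 by norm_num, ← pow_mul, pow_add]; ring
    rw [e2, e3]
    refine Nat.mul_le_mul (Nat.mul_le_mul (Nat.mul_le_mul (by omega) (Nat.mul_le_mul le_rfl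
      (Nat.pow_le_pow_left (by omega) 2))) (Nat.pow_le_pow_right (by norm_num) (by omega)))
      (Nat.pow_le_pow_right hq (by omega))
  have hall := CardLE.union hdep hind (s := AA F δ τ s m) (by
    rintro ⟨a, b⟩ h
    obtain ⟨u, v, k, A, B, hd⟩ := AA_data hδ h2 hm hs h
    by_cases hz : qN A * qN B = (A * star B).re ^ 2
    · left; exact ⟨h, AA_dep hδ h2 hm hs h hd hz⟩
    · right; exact AA_indep hδ h2 hm hs h hd hz)
  refine ⟨_, hall, ?_⟩
  have e1 : q ^ (τ + s + 1 - 2 * m) * (q ^ (τ + s + 1 - m) * (q ^ 2 * 2 ^ (2 * (τ + s)))) * (1 + 1) * q ^ (2 * i)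
      ≤ 2 * 1024 ^ m * q ^ 9 * q ^ (2 * s) := by
    have e2 : q ^ (τ + s + 1 - 2 * m) * (q ^ (τ + s + 1 - m) * (q ^ 2 * 2 ^ (2 * (τ + s)))) * (1 + 1) * q ^ (2 * i)
      = 2 * 2 ^ (2 * (τ + s)) * q ^ ((τ + s + 1 - 2 * m) + (τ + s + 1 - m) + 2 + 2 * i) := by ring
    have e3 : 2 * 1024 ^ m * q ^ 9 * q ^ (2 * s) = 2 * 2 ^ (10 * m) * q ^ (9 + 2 * s) := by
      rw [show (1024 : ℕ) = 2 ^ 10 by norm_num, ← pow_mul, pow_add]; ring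
    rw [e2, e3]
    exact Nat.mul_le_mul (Nat.mul_le_mul le_rfl (Nat.pow_le_pow_right (by norm_num) (by omega)))
      (Nat.pow_le_pow_right hq (by omega))
  rw [add_mul]
  have e4 : 2 * 1024 ^ m * q ^ 9 * q ^ (2 * s) ≤ 360 * (m + 1) ^ 3 * 1024 ^ m * q ^ 9 * q ^ (2 * s) := by
    gcongr
    have : 1 ≤ (m + 1) ^ 3 := Nat.one_le_pow _ _ (by omega)
    omega
  calc _ ≤ _ := add_le_add (e1.trans e4) hK2
    _ = _ := by ring

end

end

section
open Polynomial Quaternion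

section
variable {F : Type*} [Field F] {δ : F}

/-- letters -/
def Lt (F : Type*) [Field F] (δ : F) : Type _ := {θ : F × F // θ.1 ^ 2 - δ * θ.2 ^ 2 = 1}

/-- the inverse letter -/
def ln (a : Lt F δ) : Lt F δ := ⟨(-a.1.1, -a.1.2), by have := a.2; simpa using this⟩

theorem ln_ln (a : Lt F δ) : ln (ln a) = a := by
  apply Subtype.ext
  simp [ln]

theorem ln_inj {a b : Lt F δ} (h : ln a = ln b) : a = b := by
  rw [← ln_ln a, h, ln_ln]

theorem ln_ne (h2 : (2 : F) ≠ 0) (a : Lt F δ) : ln a ≠ a := by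
  intro h
  have h3 := congrArg Subtype.val h
  have h4 : -a.1.1 = a.1.1 := congrArg Prod.fst h3
  have h5 : -a.1.2 = a.1.2 := congrArg Prod.snd h3
  have e1 : a.1.1 = 0 := by
    have : 2 * a.1.1 = 0 := by linear_combination -h4
    exact (mul_eq_zero.1 this).resolve_left h2
  have e2 : a.1.2 = 0 := by
    have : 2 * a.1.2 = 0 := by linear_combination -h5
    exact (mul_eq_zero.1 this).resolve_left h2
  have := a.2
  rw [e1, e2] at this
  simp at this

/-- the generator attached to a letter -/
noncomputable def xi (a : Lt F δ) : HQ F δ := ⟨1, 0, C a.1.1, C a.1.2⟩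

theorem qN_xi (a : Lt F δ) : qN (xi a) = 1 - X := by
  have := congrArg (C (R := F)) a.2
  simp only [map_sub, map_mul, map_pow, map_one] at this
  rw [qN_eq]
  simp only [xi]
  linear_combination -X * this

theorem star_xi (a : Lt F δ) : star (xi a) = xi (ln a) := by
  ext1 <;> simp [xi, ln]

/-- product of a word -/
noncomputable def pw (w : List (Lt F δ)) : HQ F δ := (w.map xi).prod

theorem pw_nil : pw ([] : List (Lt F δ)) = 1 := rfl
theorem pw_cons (a : Lt F δ) (w) : pw (a :: w) = xi a * pw w := by simp [pw]
theorem pw_append (w w' : List (Lt F δ)) : pw (w ++ w') = pw w * pw w' := by simp [pw]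

theorem qN_pw (w : List (Lt F δ)) : qN (pw w) = (1 - X) ^ w.length := by
  induction w with
  | nil => rw [pw_nil, qN_one]; simp
  | cons a w ih => rw [pw_cons, qN_mul, qN_xi, ih, List.length_cons, pow_succ']

/-- inverse word -/
def winv (w : List (Lt F δ)) : List (Lt F δ) := (w.map ln).reverse

theorem winv_length (w : List (Lt F δ)) : (winv w).length = w.length := by simp [winv]

theorem pw_winv (w : List (Lt F δ)) : pw (winv w) = star (pw w) := by
  induction w with
  | nil => simp [winv, pw_nil]
  | cons a w ih =>
    have : winv (a :: w) = winv w ++ [ln a] := by simp [winv]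
    rw [this, pw_append, ih, pw_cons, pw_nil, pw_cons, star_mul, star_xi, mul_one]

/-- reduced words -/
def Red (w : List (Lt F δ)) : Prop := List.IsChain (fun a b => b ≠ ln a) w

theorem red_winv {w : List (Lt F δ)} (h : Red w) : Red (winv w) := by
  unfold Red winv
  rw [List.isChain_reverse, List.isChain_map]
  refine List.IsChain.imp ?_ h
  intro a b hab hba
  apply hab
  rw [ln_ln] at hba
  exact hba.symm

theorem two_left (hδ : ¬ IsSquare δ) {a b : Lt F δ} (hab : a ≠ b) {y z : HQ F δ}
    (h : xi a * y = xi b * z) : SDvd (1 - X) (xi a * y) := by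
  set w := xi a * y with hw
  have e1 : star (xi a) * w = (1 - X : F[X]) • y := by
    rw [hw, ← mul_assoc, star_mul_qN, qN_xi, smul_mul_assoc, one_mul]
  have e2 : star (xi b) * w = (1 - X : F[X]) • z := by
    rw [h, ← mul_assoc, star_mul_qN, qN_xi, smul_mul_assoc, one_mul]
  set η := xi a - xi b with hη
  have e3 : star η * w = (1 - X : F[X]) • (y - z) := by
    rw [hη, star_sub, sub_mul, e1, e2, smul_sub]
  set κ : F := (a.1.1 - b.1.1) ^ 2 - δ * (a.1.2 - b.1.2) ^ 2 with hκ
  have hκ0 : κ ≠ 0 := by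
    intro hz
    by_cases hd : a.1.2 - b.1.2 = 0
    · rw [hκ, hd] at hz
      have h3 : a.1.1 - b.1.1 = 0 := by simpa using hz
      exact hab (Subtype.ext (Prod.ext (sub_eq_zero.1 h3) (sub_eq_zero.1 hd)))
    · apply hδ
      refine ⟨(a.1.1 - b.1.1) / (a.1.2 - b.1.2), ?_⟩
      field_simp
      linear_combination -hz
  have e4 : qN η = -(X * C κ) := by
    rw [qN_eq, hη]
    simp [xi, hκ]
  have e5 : (X * C κ) • w = (1 - X : F[X]) • (-(η * (y - z))) := by
    have : η * (star η * w) = (1 - X : F[X]) • (η * (y - z)) := by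
      rw [e3, mul_smul_comm]
    rw [← mul_assoc, mul_star_qN, e4, smul_mul_assoc, one_mul, neg_smul] at this
    rw [smul_neg, ← this, neg_neg]
  have hc : IsCoprime (1 - X : F[X]) (X * C κ) := by
    apply IsCoprime.mul_right
    · refine (X_coprime (f := 1 - X) (by simp) 1).symm.of_isCoprime_of_dvd_right ?_
      simp
    · exact isCoprime_one_right.of_isCoprime_of_dvd_right
        (isUnit_iff_dvd_one.1 (isUnit_C.2 (isUnit_iff_ne_zero.2 hκ0)))
  obtain ⟨α, β, hαβ⟩ := hc
  refine ⟨α • w + β • (-(η * (y - z))), ?_⟩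
  calc w = (1 : F[X]) • w := (one_smul _ _).symm
    _ = (α * (1 - X) + β * (X * C κ)) • w := by rw [hαβ]
    _ = (1 - X : F[X]) • α • w + β • ((X * C κ) • w) := by
      rw [add_smul, mul_smul, mul_smul, smul_comm α]
    _ = _ := by rw [e5, smul_comm β, smul_add]

theorem not_sdvd_red (hδ : ¬ IsSquare δ) : ∀ w : List (Lt F δ), Red w → ¬ SDvd (1 - X) (pw w)
  | [], _, h => by
    have h1 := h.qN
    rw [pw_nil, qN_one] at h1
    have := isUnit_of_dvd_one ((dvd_pow_self _ two_ne_zero).trans h1)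
    exact l0_irr.not_isUnit this
  | a :: w, hr, h => by
    obtain ⟨z, hz⟩ := h
    have e1 : pw w = xi (ln a) * z := by
      apply HQ_smul_cancel (f := 1 - X) l0_irr.ne_zero
      rw [pw_cons] at hz
      have := congrArg (fun y => star (xi a) * y) hz
      simp only [← mul_assoc, star_mul_qN, qN_xi, smul_mul_assoc, one_mul, mul_smul_comm] at this
      rw [this, star_xi]
    cases w with
    | nil =>
      rw [pw_nil] at e1
      have h3 := congrArg qN e1
      rw [qN_one, qN_mul, qN_xi] at h3
      exact l0_irr.not_isUnit (IsUnit.of_mul_eq_one _ h3.symm)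
    | cons b w' =>
      unfold Red at hr
      rw [List.isChain_cons_cons] at hr
      refine not_sdvd_red hδ (b :: w') hr.2 ?_
      rw [pw_cons] at e1 ⊢
      exact two_left hδ hr.1 e1

theorem pw_inj (hδ : ¬ IsSquare δ) : ∀ w w' : List (Lt F δ), Red w → Red w' → w.length = w'.length →
    pw w = pw w' → w = w'
  | [], [], _, _, _, _ => rfl
  | [], b :: w', _, _, h, _ => by simp at h
  | a :: w, [], _, _, h, _ => by simp at h
  | a :: w, b :: w', hr, hr', hl, h => by
    by_cases hab : a = b
    · subst hab
      rw [pw_cons, pw_cons] at h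
      have hx : xi a ≠ 0 := by
        intro h0
        have := qN_xi a
        rw [h0, qN_zero] at this
        exact l0_irr.ne_zero this.symm
      have := HQ_cancel_left hδ hx h
      rw [pw_inj hδ w w' hr.of_cons hr'.of_cons (by simpa using hl) this]
    · exfalso
      apply not_sdvd_red hδ _ hr
      rw [pw_cons, pw_cons] at *
      exact two_left hδ hab h

theorem sq_re (a : HQ F δ) : a * a = (2 * a.re) • a - qN a • (1 : HQ F δ) := by
  have : star a = (2 * a.re) • (1 : HQ F δ) - a := by
    ext1 <;> simp
    ring
  rw [← mul_star_qN, this, mul_sub, mul_smul_comm, mul_one]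
  abel

theorem not_dvd_re (hδ : ¬ IsSquare δ) {w : List (Lt F δ)} (hw : w ≠ []) (h : Red (w ++ w)) :
    ¬ (1 - X) ∣ (pw w).re := by
  intro hd
  apply not_sdvd_red hδ _ h
  rw [pw_append, sq_re]
  refine (SDvd.smul (hd.mul_left 2) _).sub (SDvd.smul ?_ _)
  rw [qN_pw]
  exact dvd_pow_self _ (by simpa using hw)

theorem scalar_of_congr (hδ : ¬ IsSquare δ) (h2 : (2 : F) ≠ 0) {T m : ℕ} (hm : 1 ≤ m) (hT : T < 2 * m)
    {z : HQ F δ} (hN : qN z = ((1 - X) ^ T) ^ 2) (hz : SDvd (X ^ m) (z - ((1 - X) ^ T : F[X]) • 1)) :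
    z = ((1 - X) ^ T : F[X]) • 1 := by
  have h1 := re_congr h2 (by simp) hm hN hz
  have hd := (qN_deg hδ z (k := 2 * T) (by rw [hN, ← pow_mul, l0_natDegree, mul_comm])).1
  have h3 : z.re = (1 - X) ^ T := by
    by_contra hne
    have h4 := natDegree_le_of_dvd h1 (sub_ne_zero.2 hne)
    have h5 := natDegree_sub_le z.re ((1 - X) ^ T)
    rw [natDegree_X_pow] at h4
    rw [l0_natDegree] at h5
    have := max_le (show z.re.natDegree ≤ T by omega) (le_refl T)
    omega
  apply eq_of_re hδ hN
  · rw [qN_smul, qN_one, mul_one]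
  · simp [h3]; ring

theorem pw_star_congr {m : ℕ} {u u' : List (Lt F δ)} (hl : u.length = u'.length)
    (h : SDvd (X ^ m) (pw u - pw u')) :
    SDvd (X ^ m) (pw u * star (pw u') - ((1 - X) ^ u.length : F[X]) • (1 : HQ F δ)) := by
  have := h.mul_right (star (pw u'))
  rwa [sub_mul, mul_star_qN (pw u'), qN_pw u', ← hl] at this

theorem word_inj (hδ : ¬ IsSquare δ) (h2 : (2 : F) ≠ 0) {m : ℕ} (hm : 1 ≤ m) {u u' : List (Lt F δ)}
    (hu : Red u) (hu' : Red u') (hl : u.length = u'.length) (hT : u.length < 2 * m)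
    (h : SDvd (X ^ m) (pw u - pw u')) : u = u' := by
  apply pw_inj hδ _ _ hu hu' hl
  have h1 := scalar_of_congr hδ h2 hm hT (z := pw u * star (pw u'))
    (by rw [qN_mul, qN_star, qN_pw, qN_pw, ← hl, sq]) (pw_star_congr hl h)
  have hne : star (pw u') ≠ 0 := by
    intro h0
    have := qN_pw u'
    rw [← qN_star, h0, qN_zero] at this
    exact l0_ne _ this.symm
  apply HQ_cancel_right hδ hne
  rw [h1, mul_star_qN, qN_pw, hl]

theorem girth_word (hδ : ¬ IsSquare δ) (h2 : (2 : F) ≠ 0) {T m : ℕ} (hm : 1 ≤ m) (hT : T < 2 * m)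
    (hT1 : 1 ≤ T) {w : List (Lt F δ)} (hw : Red w) (hl : w.length = 2 * T)
    (h : SDvd (X ^ m) (pw w - ((1 - X) ^ T : F[X]) • 1)) : False := by
  have h1 := scalar_of_congr hδ h2 hm hT (z := pw w) (by rw [qN_pw, hl, ← pow_mul, mul_comm]) h
  apply not_sdvd_red hδ w hw
  rw [h1]
  exact SDvd.smul (dvd_pow_self _ (by omega)) _

end

end

section
open Polynomial Quaternion

section
variable {F : Type*} [Field F] {δ : F}

theorem red_join {a b : List (Lt F δ)} (ha : Red a) (hb : Red b) (hn : a.getLast? ≠ b.getLast?) :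
    Red (a ++ winv b) := by
  unfold Red
  rw [List.isChain_append]
  refine ⟨ha, red_winv hb, ?_⟩
  intro x hx y hy hxy
  apply hn
  simp only [winv, List.head?_reverse, List.getLast?_map, Option.mem_def, Option.map_eq_some_iff] at hy hx
  obtain ⟨c, hc, rfl⟩ := hy
  rw [hx, hc, ln_inj hxy]

theorem red_join2 {a b : List (Lt F δ)} (ha : Red a) (hb : Red b) (hn : a.getLast? ≠ b.getLast?)
    (hh : a.head? ≠ b.head?) (ha0 : a ≠ []) (hb0 : b ≠ []) :
    Red ((a ++ winv b) ++ (a ++ winv b)) := by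
  have h1 := red_join ha hb hn
  unfold Red
  rw [List.isChain_append]
  refine ⟨h1, h1, ?_⟩
  intro x hx y hy hxy
  apply hh
  obtain ⟨a0, a, rfl⟩ := List.exists_cons_of_ne_nil ha0
  obtain ⟨b0, b, rfl⟩ := List.exists_cons_of_ne_nil hb0
  have hx' : (a0 :: a ++ winv (b0 :: b)).getLast? = some (ln b0) := by
    have : a0 :: a ++ winv (b0 :: b) = (a0 :: a ++ winv b) ++ [ln b0] := by simp [winv]
    rw [this, List.getLast?_concat]
  rw [hx'] at hx
  simp at hx hy
  subst hx hy
  rw [hxy, ln_ln]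
  rfl

/-- compatible pairs of extensions -/
def PairOK (m τ s : ℕ) (w w' u u' : List (Lt F δ)) : Prop :=
  w.length = τ ∧ w'.length = τ ∧ u.length = s ∧ u'.length = s ∧ Red (w ++ u) ∧ Red (w' ++ u') ∧
    u.getLast? ≠ u'.getLast? ∧ SDvd (X ^ m) (pw (w ++ u) - pw (w' ++ u'))

theorem append_facts {w u : List (Lt F δ)} (hw : w ≠ []) (hu : u ≠ []) :
    (w ++ u).head? = w.head? ∧ (w ++ u).getLast? = u.getLast? ∧ w ++ u ≠ [] := by
  obtain ⟨a0, a, rfl⟩ := List.exists_cons_of_ne_nil hw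
  refine ⟨rfl, ?_, by simp⟩
  rw [List.getLast?_append]
  have : u.getLast? = some (u.getLast hu) := List.getLast?_eq_some_getLast hu
  rw [this]; rfl

theorem ne_nil_of_len {α : Type*} {w : List α} {n : ℕ} (h : w.length = n) (hn : 1 ≤ n) : w ≠ [] := by
  rintro rfl; simp at h; omega

theorem winv_inj {w w' : List (Lt F δ)} (h : winv w = winv w') : w = w' := by
  unfold winv at h
  exact List.map_injective_iff.2 (fun a b hab => ln_inj hab) (List.reverse_injective h)

theorem pair_inj (hδ : ¬ IsSquare δ) {m τ s : ℕ} {w w' u u' v v' x x' : List (Lt F δ)}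
    (h : PairOK m τ s w w' u u') (h' : PairOK m τ s v v' x x') (hτ : 1 ≤ τ) (hs : 1 ≤ s)
    (e : pw (w ++ u) * star (pw (w' ++ u')) = pw (v ++ x) * star (pw (v' ++ x'))) :
    w = v ∧ w' = v' ∧ u = x ∧ u' = x' := by
  obtain ⟨a1, a2, a3, a4, a5, a6, a7, a8⟩ := h
  obtain ⟨b1, b2, b3, b4, b5, b6, b7, b8⟩ := h'
  rw [← pw_winv, ← pw_winv, ← pw_append, ← pw_append] at e
  have f1 := append_facts (ne_nil_of_len a1 hτ) (ne_nil_of_len a3 hs)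
  have f2 := append_facts (ne_nil_of_len a2 hτ) (ne_nil_of_len a4 hs)
  have f3 := append_facts (ne_nil_of_len b1 hτ) (ne_nil_of_len b3 hs)
  have f4 := append_facts (ne_nil_of_len b2 hτ) (ne_nil_of_len b4 hs)
  have := pw_inj hδ _ _ (red_join a5 a6 (by rw [f1.2.1, f2.2.1]; exact a7))
    (red_join b5 b6 (by rw [f3.2.1, f4.2.1]; exact b7)) (by simp [winv_length, *]) e
  have h3 := List.append_inj this (by simp [*])
  have h4 := List.append_inj h3.1 (by simp [*])
  have h5 := List.append_inj (winv_inj h3.2) (by simp [*])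
  exact ⟨h4.1, h5.1, h4.2, h5.2⟩

theorem pair_single (hδ : ¬ IsSquare δ) {m τ s : ℕ} {w w' u u' : List (Lt F δ)}
    (h : PairOK m τ s w w' u u') (hh : w.head? ≠ w'.head?) (hτ : 1 ≤ τ) (hs : 1 ≤ s) :
    qN (pw (w ++ u) * star (pw (w' ++ u'))) = ((1 - X) ^ (τ + s)) ^ 2 ∧
    SDvd (X ^ m) (pw (w ++ u) * star (pw (w' ++ u')) - ((1 - X) ^ (τ + s) : F[X]) • 1) ∧
    ¬ (1 - X) ∣ (pw (w ++ u) * star (pw (w' ++ u'))).re := by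
  obtain ⟨a1, a2, a3, a4, a5, a6, a7, a8⟩ := h
  have f1 := append_facts (ne_nil_of_len a1 hτ) (ne_nil_of_len a3 hs)
  have f2 := append_facts (ne_nil_of_len a2 hτ) (ne_nil_of_len a4 hs)
  refine ⟨?_, ?_, ?_⟩
  · rw [qN_mul, qN_star, qN_pw, qN_pw, List.length_append, List.length_append, a1, a2, a3, a4, sq]
  · have := pw_star_congr (m := m) (u := w ++ u) (u' := w' ++ u') (by simp [*]) a8
    rwa [List.length_append, a1, a3] at this
  · rw [← pw_winv, ← pw_append]
    refine not_dvd_re hδ (by intro h; exact f1.2.2 (List.append_eq_nil_iff.1 h).1) (red_join2 a5 a6 ?_ ?_ f1.2.2 f2.2.2)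
    · rw [f1.2.1, f2.2.1]; exact a7
    · rw [f1.1, f2.1]; exact hh

theorem conj_re (a b c d e f : HQ F δ) (n : F[X]) (ha : star a * a = n • (1 : HQ F δ))
    (hb : star b * b = n • (1 : HQ F δ)) :
    (star ((a * c) * star (b * d)) * ((a * e) * star (b * f))).re =
      n ^ 2 * ((d * star c) * (e * star f)).re := by
  have e1 : star ((a * c) * star (b * d)) * ((a * e) * star (b * f)) =
      b * (d * (star c * ((star a * a) * (e * (star f * star b))))) := by
    simp only [star_mul, star_star, mul_assoc]
  rw [e1, re_mul_comm', ha]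
  have e2 : d * (star c * (n • (1 : HQ F δ) * (e * (star f * star b)))) * b =
      n • ((d * star c) * (e * star f)) * (star b * b) := by
    simp only [mul_assoc, smul_mul_assoc, one_mul, mul_smul_comm]
  rw [e2, hb, mul_smul_comm, mul_one]
  simp only [QuaternionAlgebra.re_smul, smul_eq_mul]
  ring

/-- the sextuples to be counted -/
def Six (F : Type*) [Field F] (δ : F) (m τ s : ℕ) :
    Set ((List (Lt F δ) × List (Lt F δ)) × (List (Lt F δ) × List (Lt F δ)) ×
      (List (Lt F δ) × List (Lt F δ))) :=
  {z | z.1.1.head? ≠ z.1.2.head? ∧ PairOK m τ s z.1.1 z.1.2 z.2.1.1 z.2.1.2 ∧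
    PairOK m τ s z.1.1 z.1.2 z.2.2.1 z.2.2.2}

theorem card_six [Fintype F] (hδ : ¬ IsSquare δ) (h2 : (2 : F) ≠ 0) {τ s m i t : ℕ} (hm : 1 ≤ m)
    (hs : 1 ≤ s) (hτ : 1 ≤ τ) (hst : s ≤ t) (ht : 2 * t = 3 * m) (hi : τ + i = t) :
    ∃ K, CardLE (Six F δ m τ s) K ∧ K * Fintype.card F ^ (2 * i) ≤
      1000 * (m + 1) ^ 3 * 1024 ^ m * Fintype.card F ^ 9 * Fintype.card F ^ (2 * s) := by
  obtain ⟨K, hK, hb⟩ := card_AA (δ := δ) hδ h2 hm hs hst ht hi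
  refine ⟨K, ?_, hb⟩
  refine CardLE.inj hK (fun z => (pw (z.1.1 ++ z.2.1.1) * star (pw (z.1.2 ++ z.2.1.2)),
    pw (z.1.1 ++ z.2.2.1) * star (pw (z.1.2 ++ z.2.2.2)))) ?_ ?_
  · rintro ⟨⟨w, w'⟩, ⟨u, u'⟩, ⟨v, v'⟩⟩ ⟨h1, h2, h3⟩
    simp only at h1 h2 h3
    have g1 := pair_single hδ h2 h1 hτ hs
    have g2 := pair_single hδ h3 h1 hτ hs
    refine ⟨g1.1, g2.1, g1.2.1, g2.2.1, g1.2.2, g2.2.2, ((pw u' * star (pw u)) * (pw v * star (pw v'))).re, ?_, ?_⟩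
    · simp only [pw_append]
      rw [conj_re _ _ _ _ _ _ ((1 - X) ^ τ) (by rw [star_mul_qN, qN_pw, h2.1])
        (by rw [star_mul_qN, qN_pw, h2.2.1]), ← pow_mul, mul_comm τ 2]
    · have := (qN_deg hδ ((pw u' * star (pw u)) * (pw v * star (pw v'))) (k := 4 * s) ?_).1
      · omega
      · obtain ⟨a1, a2, a3, a4, -⟩ := h2
        obtain ⟨b1, b2, b3, b4, -⟩ := h3
        simp only [qN_mul, qN_star, qN_pw, a3, a4, b3, b4, ← pow_add, l0_natDegree]
        omega
  · rintro ⟨⟨w, w'⟩, ⟨u, u'⟩, ⟨v, v'⟩⟩ ⟨h1, h2, h3⟩ ⟨⟨x, x'⟩, ⟨y, y'⟩, ⟨z, z'⟩⟩ ⟨k1, k2, k3⟩ e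
    simp only [Prod.mk.injEq] at h1 h2 h3 k1 k2 k3 e
    obtain ⟨rfl, rfl, rfl, rfl⟩ := pair_inj hδ h2 k2 hτ hs e.1
    obtain ⟨-, -, rfl, rfl⟩ := pair_inj hδ h3 k3 hτ hs e.2
    rfl

end

end

section
open Polynomial Quaternion

section
variable {F : Type*} [Field F] {δ : F}

noncomputable instance [Fintype F] : Fintype (Lt F δ) := by
  classical
  unfold Lt
  exact Fintype.ofFinite _

theorem card_Lt [Fintype F] (hδ : ¬ IsSquare δ) (h2 : (2 : F) ≠ 0) :
    Fintype.card (Lt F δ) = Fintype.card F + 1 := by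
  have hd : ∀ t : F, 1 - δ * t ^ 2 ≠ 0 := by
    intro t h
    have ht : t ≠ 0 := by rintro rfl; simp at h
    apply hδ
    refine ⟨1 / t, ?_⟩
    field_simp
    linear_combination -h
  let φ : Option F → Lt F δ := fun o => match o with
    | none => ⟨(-1, 0), by simp⟩
    | some t => ⟨((1 + δ * t ^ 2) / (1 - δ * t ^ 2), 2 * t / (1 - δ * t ^ 2)), by
      have := hd t
      simp only
      field_simp
      ring⟩
  have hφ1 : ∀ t, (φ (some t)).1.1 + 1 = 2 / (1 - δ * t ^ 2) := by
    intro t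
    have := hd t
    simp only [φ]
    field_simp
    ring
  have hφ2 : ∀ t, (φ (some t)).1.2 = t * ((φ (some t)).1.1 + 1) := by
    intro t
    have := hd t
    rw [hφ1]
    simp only [φ]
    field_simp
  have hφ3 : ∀ t, (φ (some t)).1.1 + 1 ≠ 0 := by
    intro t
    rw [hφ1]
    exact div_ne_zero h2 (hd t)
  have hφ4 : (φ none).1.1 + 1 = 0 := by simp [φ]
  have hbij : Function.Bijective φ := by
    constructor
    · intro a b hab
      cases a with
      | none =>
        cases b with
        | none => rfl
        | some t => exact absurd (by rw [← hab]; exact hφ4) (hφ3 t)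
      | some s =>
        cases b with
        | none => exact absurd (by rw [hab]; exact hφ4) (hφ3 s)
        | some t =>
          have e1 := hφ2 s
          have e2 := hφ2 t
          rw [hab, e2] at e1
          rw [mul_right_cancel₀ (hφ3 t) e1]
    · rintro ⟨⟨c, d⟩, h⟩
      by_cases hc : c + 1 = 0
      · refine ⟨none, ?_⟩
        have hc' : c = -1 := by linear_combination hc
        have hδ0 : δ ≠ 0 := by rintro rfl; exact hδ ⟨0, by simp⟩
        have hd0 : d = 0 := by
          simp only at h
          rw [hc'] at h
          have : δ * d ^ 2 = 0 := by linear_combination -h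
          simpa [hδ0] using this
        apply Subtype.ext
        simp [φ, hc', hd0]
      · refine ⟨some (d / (c + 1)), ?_⟩
        have e1 : 1 - δ * (d / (c + 1)) ^ 2 = 2 / (c + 1) := by
          field_simp
          linear_combination h
        have e2 := hφ1 (d / (c + 1))
        have e3 := hφ2 (d / (c + 1))
        rw [e1] at e2
        have e4 : (φ (some (d / (c + 1)))).1.1 + 1 = c + 1 := by
          rw [e2]; field_simp
        rw [e4] at e3
        apply Subtype.ext
        apply Prod.ext
        · exact add_right_cancel e4
        · rw [e3]; field_simp
  rw [← Fintype.card_of_bijective hbij, Fintype.card_option]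

theorem wd_finite (F : Type*) [Field F] [Fintype F] (δ : F) (n : ℕ) :
    {w : List (Lt F δ) | w.length = n ∧ Red w}.Finite :=
  Set.Finite.subset (List.finite_length_eq (Lt F δ) n) (fun _ h => h.1)

theorem wext_finite [Fintype F] (a : Lt F δ) (n : ℕ) :
    {w : List (Lt F δ) | w.length = n ∧ Red (a :: w)}.Finite :=
  Set.Finite.subset (List.finite_length_eq (Lt F δ) n) (fun _ h => h.1)

/-- reduced words of given length -/
noncomputable def wd (F : Type*) [Field F] [Fintype F] (δ : F) (n : ℕ) : Finset (List (Lt F δ)) :=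
  (wd_finite F δ n).toFinset

theorem mem_wd [Fintype F] {n : ℕ} {w : List (Lt F δ)} : w ∈ wd F δ n ↔ w.length = n ∧ Red w := by
  simp [wd]

/-- reduced extensions of a letter -/
noncomputable def wext [Fintype F] (a : Lt F δ) (n : ℕ) : Finset (List (Lt F δ)) :=
  (wext_finite a n).toFinset

theorem mem_wext [Fintype F] {a : Lt F δ} {n : ℕ} {w : List (Lt F δ)} :
    w ∈ wext a n ↔ w.length = n ∧ Red (a :: w) := by
  simp [wext]

theorem card_wext [Fintype F] (hδ : ¬ IsSquare δ) (h2 : (2 : F) ≠ 0) (n : ℕ) : ∀ a : Lt F δ,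
    (wext a n).card = Fintype.card F ^ n := by
  classical
  induction n with
  | zero =>
    intro a
    have : wext a 0 = {[]} := by
      ext w
      rw [mem_wext, Finset.mem_singleton, List.length_eq_zero_iff]
      constructor
      · exact fun h => h.1
      · rintro rfl; exact ⟨rfl, by unfold Red; simp⟩
    rw [this]; simp
  | succ n ih =>
    intro a
    have : wext a (n + 1) = (Finset.univ.erase (ln a)).biUnion (fun b => (wext b n).image (List.cons b)) := by
      ext w
      simp only [mem_wext, Finset.mem_biUnion, Finset.mem_erase, Finset.mem_univ, and_true, Finset.mem_image]
      constructor
      · rintro ⟨hl, hr⟩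
        cases w with
        | nil => simp at hl
        | cons b w =>
          unfold Red at hr
          rw [List.isChain_cons_cons] at hr
          exact ⟨b, hr.1, w, ⟨by simpa using hl, hr.2⟩, rfl⟩
      · rintro ⟨b, hb, w, ⟨hl, hr⟩, rfl⟩
        refine ⟨by simpa using hl, ?_⟩
        unfold Red
        rw [List.isChain_cons_cons]
        exact ⟨hb, hr⟩
    rw [this, Finset.card_biUnion]
    · rw [Finset.sum_congr rfl (g := fun _ => Fintype.card F ^ n)]
      · rw [Finset.sum_const, Finset.card_erase_of_mem (Finset.mem_univ _), Finset.card_univ, card_Lt hδ h2]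
        simp [pow_succ']
      · intro b _
        rw [Finset.card_image_of_injective _ (List.cons_injective), ih]
    · intro b _ c _ hbc
      rw [Function.onFun, Finset.disjoint_left]
      intro w hw hw'
      simp only [Finset.mem_image] at hw hw'
      obtain ⟨x, -, rfl⟩ := hw
      obtain ⟨y, -, hy⟩ := hw'
      exact hbc (List.cons.inj hy).1.symm

theorem card_wd [Fintype F] (hδ : ¬ IsSquare δ) (h2 : (2 : F) ≠ 0) (n : ℕ) :
    (wd F δ n).card ≤ 2 * Fintype.card F ^ n := by
  classical
  cases n with
  | zero =>
    have : wd F δ 0 ⊆ {[]} := by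
      intro w hw
      rw [mem_wd, List.length_eq_zero_iff] at hw
      simp [hw.1]
    have := Finset.card_le_card this
    simp at this ⊢
    omega
  | succ n =>
    have : wd F δ (n + 1) ⊆ Finset.univ.biUnion (fun b => (wext b n).image (List.cons b)) := by
      intro w hw
      rw [mem_wd] at hw
      cases w with
      | nil => simp at hw
      | cons b w =>
        simp only [Finset.mem_biUnion, Finset.mem_image, Finset.mem_univ, true_and]
        exact ⟨b, w, mem_wext.2 ⟨by simpa using hw.1, hw.2⟩, rfl⟩
    refine (Finset.card_le_card this).trans (Finset.card_biUnion_le.trans ?_)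
    have h3 : ∀ b ∈ (Finset.univ : Finset (Lt F δ)), ((wext b n).image (List.cons b)).card ≤ Fintype.card F ^ n := by
      intro b _
      exact Finset.card_image_le.trans (card_wext hδ h2 n b).le
    refine (Finset.sum_le_card_nsmul _ _ _ h3).trans ?_
    rw [Finset.card_univ, card_Lt hδ h2, smul_eq_mul, pow_succ']
    have : 1 ≤ Fintype.card F := Fintype.card_pos
    nlinarith [Nat.zero_le (Fintype.card F ^ n)]

theorem wd_CardLE [Fintype F] (hδ : ¬ IsSquare δ) (h2 : (2 : F) ≠ 0) (n : ℕ) :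
    CardLE {w : List (Lt F δ) | w.length = n ∧ Red w} (2 * Fintype.card F ^ n) := by
  have e : {w : List (Lt F δ) | w.length = n ∧ Red w} = ↑(wd F δ n) := by
    ext w; simp [mem_wd]
  rw [e]
  exact ⟨Finset.finite_toSet _, by rw [Set.ncard_coe_finset]; exact card_wd hδ h2 n⟩

theorem sdvd_of_smul {m T : ℕ} {z : HQ F δ} (h : SDvd (X ^ m) (((1 - X) ^ T : F[X]) • z)) : SDvd (X ^ m) z := by
  have hc : IsCoprime (X ^ m : F[X]) ((1 - X) ^ T) := X_coprime (by simp) m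
  rw [sdvd_iff] at h ⊢
  simp only [QuaternionAlgebra.re_smul, QuaternionAlgebra.imI_smul, QuaternionAlgebra.imJ_smul,
    QuaternionAlgebra.imK_smul, smul_eq_mul] at h
  exact ⟨hc.dvd_of_dvd_mul_left h.1, hc.dvd_of_dvd_mul_left h.2.1, hc.dvd_of_dvd_mul_left h.2.2.1,
    hc.dvd_of_dvd_mul_left h.2.2.2⟩

theorem sdvd_cancel_left {m : ℕ} {x a b : List (Lt F δ)}
    (h : SDvd (X ^ m) (pw (x ++ a) - pw (x ++ b))) : SDvd (X ^ m) (pw a - pw b) := by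
  rw [pw_append, pw_append, ← mul_sub] at h
  have := h.mul_left (star (pw x))
  rw [← mul_assoc, star_mul_qN, qN_pw, smul_mul_assoc, one_mul] at this
  exact sdvd_of_smul this

theorem sdvd_cancel_right {m : ℕ} {x a b : List (Lt F δ)}
    (h : SDvd (X ^ m) (pw (a ++ x) - pw (b ++ x))) : SDvd (X ^ m) (pw a - pw b) := by
  rw [pw_append, pw_append, ← sub_mul] at h
  have := h.mul_right (star (pw x))
  rw [mul_assoc, mul_star_qN, qN_pw, mul_smul_comm, mul_one] at this
  exact sdvd_of_smul this

theorem common_prefix {α : Type*} : ∀ w w' : List α, w.length = w'.length → w ≠ w' →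
    ∃ x v v', w = x ++ v ∧ w' = x ++ v' ∧ v.head? ≠ v'.head? ∧ v ≠ [] ∧ v' ≠ []
  | [], [], _, h => absurd rfl h
  | [], b :: w', h, _ => by simp at h
  | a :: w, [], h, _ => by simp at h
  | a :: w, b :: w', hl, h => by
    by_cases hab : a = b
    · subst hab
      obtain ⟨x, v, v', rfl, rfl, h1, h2, h3⟩ := common_prefix w w' (by simpa using hl) (by simpa using h)
      exact ⟨a :: x, v, v', rfl, rfl, h1, h2, h3⟩
    · exact ⟨[], a :: w, b :: w', rfl, rfl, by simpa using hab, by simp, by simp⟩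

theorem common_suffix {α : Type*} (w w' : List α) (hl : w.length = w'.length) (h : w ≠ w') :
    ∃ x v v', w = v ++ x ∧ w' = v' ++ x ∧ v.getLast? ≠ v'.getLast? ∧ v ≠ [] ∧ v' ≠ [] := by
  obtain ⟨x, v, v', h1, h2, h3, h4, h5⟩ := common_prefix w.reverse w'.reverse (by simpa using hl)
    (fun he => h (List.reverse_injective he))
  refine ⟨x.reverse, v.reverse, v'.reverse, ?_, ?_, ?_, by simpa using h4, by simpa using h5⟩
  · rw [← List.reverse_append, ← h1, List.reverse_reverse]
  · rw [← List.reverse_append, ← h2, List.reverse_reverse]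
  · simpa using h3

/-- all sextuples -/
def Six' (F : Type*) [Field F] (δ : F) (m τ s : ℕ) :
    Set ((List (Lt F δ) × List (Lt F δ)) × (List (Lt F δ) × List (Lt F δ)) ×
      (List (Lt F δ) × List (Lt F δ))) :=
  {z | PairOK m τ s z.1.1 z.1.2 z.2.1.1 z.2.1.2 ∧ PairOK m τ s z.1.1 z.1.2 z.2.2.1 z.2.2.2}

theorem PairOK.strip {m τ i s : ℕ} {x v v' u u' : List (Lt F δ)} (h : PairOK m (τ + i) s (x ++ v) (x ++ v') u u')
    (hx : x.length = i) : PairOK m τ s v v' u u' := by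
  obtain ⟨a1, a2, a3, a4, a5, a6, a7, a8⟩ := h
  rw [List.length_append] at a1 a2
  rw [List.append_assoc] at a5 a6
  rw [List.append_assoc, List.append_assoc] at a8
  refine ⟨by omega, by omega, a3, a4, ?_, ?_, a7, sdvd_cancel_left a8⟩
  · exact (List.isChain_append.1 a5).2.1
  · exact (List.isChain_append.1 a6).2.1

theorem card_six' [Fintype F] (hδ : ¬ IsSquare δ) (h2 : (2 : F) ≠ 0) {s m t : ℕ} (hm : 1 ≤ m)
    (hs : 1 ≤ s) (hst : s ≤ t) (ht : 2 * t = 3 * m) :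
    CardLE (Six' F δ m t s) (t * (2 *
      (1000 * (m + 1) ^ 3 * 1024 ^ m * Fintype.card F ^ 9 * Fintype.card F ^ (2 * s)))) := by
  have hq : 1 ≤ Fintype.card F := Fintype.card_pos
  set M := 1000 * (m + 1) ^ 3 * 1024 ^ m * Fintype.card F ^ 9 * Fintype.card F ^ (2 * s)
  let f : List (Lt F δ) → ((List (Lt F δ) × List (Lt F δ)) × (List (Lt F δ) × List (Lt F δ)) ×
      (List (Lt F δ) × List (Lt F δ))) → ((List (Lt F δ) × List (Lt F δ)) × (List (Lt F δ) × List (Lt F δ)) ×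
      (List (Lt F δ) × List (Lt F δ))) := fun x z => ((x ++ z.1.1, x ++ z.1.2), z.2)
  have hpiece : ∀ i ∈ Finset.range t, CardLE
      {y | ∃ x : List (Lt F δ), (x.length = i ∧ Red x) ∧ ∃ z ∈ Six F δ m (t - i) s, y = f x z} (2 * M) := by
    intro i hi
    rw [Finset.mem_range] at hi
    obtain ⟨K, hK, hb⟩ := card_six (δ := δ) hδ h2 hm hs (τ := t - i) (by omega) hst ht (i := i) (by omega)
    have := CardLE.biUnion (wd_CardLE hδ h2 i) (g := fun x => {y | ∃ z ∈ Six F δ m (t - i) s, y = f x z})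
      (l := K) (fun x _ => CardLE.image hK (f x) (fun y hy => hy))
      (s := {y | ∃ x : List (Lt F δ), (x.length = i ∧ Red x) ∧ ∃ z ∈ Six F δ m (t - i) s, y = f x z})
      (fun y hy => hy)
    refine this.mono subset_rfl ?_
    have h3 : Fintype.card F ^ i ≤ Fintype.card F ^ (2 * i) := Nat.pow_le_pow_right hq (by omega)
    calc 2 * Fintype.card F ^ i * K ≤ 2 * Fintype.card F ^ (2 * i) * K := by gcongr
      _ = 2 * (K * Fintype.card F ^ (2 * i)) := by ring
      _ ≤ 2 * M := Nat.mul_le_mul le_rfl hb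
  have := CardLE.sum (Finset.range t) hpiece (s := Six' F δ m t s) (by
    rintro ⟨⟨w, w'⟩, ⟨u, u'⟩, ⟨v, v'⟩⟩ ⟨h1, h3⟩
    simp only at h1 h3
    by_cases hw : w = w'
    · exfalso
      subst hw
      obtain ⟨a1, a2, a3, a4, a5, a6, a7, a8⟩ := h1
      have := word_inj hδ h2 hm (List.isChain_append.1 a5).2.1 (List.isChain_append.1 a6).2.1
        (by rw [a3, a4]) (by omega) (sdvd_cancel_left a8)
      exact a7 (by rw [this])
    · obtain ⟨x, y, y', rfl, rfl, h4, h5, h6⟩ := common_prefix w w' (by rw [h1.1, h1.2.1]) hw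
      have hl := h1.1
      rw [List.length_append] at hl
      have hy := List.length_pos_iff.2 h5
      refine ⟨x.length, Finset.mem_range.2 (by omega), x, ⟨rfl, ?_⟩, ((y, y'), (u, u'), (v, v')), ?_, rfl⟩
      · obtain ⟨a1, a2, a3, a4, a5, -⟩ := h1
        rw [List.append_assoc] at a5
        exact (List.isChain_append.1 a5).1
      · have e : t = (t - x.length) + x.length := by omega
        rw [e] at h1 h3
        exact ⟨h4, h1.strip rfl, h3.strip rfl⟩)
  rwa [Finset.sum_const, Finset.card_range, smul_eq_mul] at this

end

end

section
open Polynomial Quaternion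

theorem cs_fiber {α β : Type*} [DecidableEq α] [DecidableEq β] (A : Finset α) (B : Finset β) (f : α → β)
    (h : ∀ a ∈ A, f a ∈ B) :
    A.card ^ 2 ≤ B.card * ((A ×ˢ A).filter (fun z => f z.1 = f z.2)).card := by
  rw [Finset.card_eq_sum_card_fiberwise (f := f) (t := B) h]
  refine (sq_sum_le_card_mul_sum_sq).trans (Nat.mul_le_mul le_rfl ?_)
  rw [Finset.card_eq_sum_card_fiberwise (s := (A ×ˢ A).filter (fun z => f z.1 = f z.2)) (f := fun z => f z.1) (t := B)]
  · apply Finset.sum_le_sum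
    intro b _
    rw [sq, ← Finset.card_product]
    apply Finset.card_le_card
    intro z hz
    simp only [Finset.mem_product, Finset.mem_filter] at hz ⊢
    exact ⟨⟨⟨hz.1.1, hz.2.1⟩, by rw [hz.1.2, hz.2.2]⟩, hz.1.2⟩
  · intro z hz
    simp only [Finset.coe_filter, Finset.mem_product, Set.mem_ofPred_eq] at hz
    exact h _ hz.1.1

section
variable {F : Type*} [Field F] {δ : F}

/-- the loss constant -/
def HH (m q : ℕ) : ℕ := 55 * (m + 1) ^ 2 * 32 ^ m * q ^ 5

theorem HH_bound {m q t s : ℕ} (hq : 1 ≤ q) (ht : 2 * t = 3 * m) :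
    t * (2 * (1000 * (m + 1) ^ 3 * 1024 ^ m * q ^ 9 * q ^ (2 * s))) ≤ (HH m q * q ^ s) ^ 2 := by
  have e : (1024 : ℕ) ^ m = 32 ^ m * 32 ^ m := by rw [← mul_pow]; norm_num
  have e2 : q ^ (2 * s) = q ^ s * q ^ s := by rw [two_mul, pow_add]
  have h1 : q ^ 9 ≤ q ^ 10 := Nat.pow_le_pow_right hq (by norm_num)
  have h3 : 3 * m * (1000 * (m + 1) ^ 3) ≤ 3025 * (m + 1) ^ 4 := by
    have : m ≤ m + 1 := by omega
    calc 3 * m * (1000 * (m + 1) ^ 3) ≤ 3 * (m + 1) * (1000 * (m + 1) ^ 3) := by gcongr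
      _ = 3000 * (m + 1) ^ 4 := by ring
      _ ≤ _ := by gcongr; norm_num
  calc t * (2 * (1000 * (m + 1) ^ 3 * 1024 ^ m * q ^ 9 * q ^ (2 * s)))
      = (2 * t) * (1000 * (m + 1) ^ 3) * (1024 ^ m * q ^ (2 * s)) * q ^ 9 := by ring
    _ ≤ 3025 * (m + 1) ^ 4 * (1024 ^ m * q ^ (2 * s)) * q ^ 10 := by
      rw [ht]; gcongr
    _ = _ := by rw [e, e2]; unfold HH; ring

/-- quadruples -/
def Quad (S : Finset (List (Lt F δ))) (m t s : ℕ) :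
    Set ((List (Lt F δ) × List (Lt F δ)) × (List (Lt F δ) × List (Lt F δ))) :=
  {z | z.1.1 ∈ S ∧ z.1.2 ∈ S ∧ PairOK m t s z.1.1 z.1.2 z.2.1 z.2.2}

theorem card_quad [Fintype F] (hδ : ¬ IsSquare δ) (h2 : (2 : F) ≠ 0) {s m t : ℕ} (hm : 1 ≤ m)
    (hs : 1 ≤ s) (hst : s ≤ t) (ht : 2 * t = 3 * m) (S : Finset (List (Lt F δ))) :
    CardLE (Quad S m t s) (S.card * (HH m (Fintype.card F) * Fintype.card F ^ s)) := by
  classical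
  have hfin : (Quad S m t s).Finite := by
    have hl := List.finite_length_eq (Lt F δ) s
    refine Set.Finite.subset (((S.finite_toSet.prod S.finite_toSet).prod (hl.prod hl))) ?_
    rintro ⟨⟨w, w'⟩, u, u'⟩ ⟨h1, h3, h4⟩
    exact ⟨⟨h1, h3⟩, h4.2.2.1, h4.2.2.2.1⟩
  refine ⟨hfin, ?_⟩
  obtain ⟨h6f, h6⟩ := card_six' (δ := δ) hδ h2 hm hs hst ht
  have h7 := h6.trans (HH_bound Fintype.card_pos ht)
  rw [Set.ncard_eq_toFinset_card _ hfin]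
  have h8 := cs_fiber hfin.toFinset (S ×ˢ S) Prod.fst (by
    rintro ⟨⟨w, w'⟩, u, u'⟩ h
    rw [Set.Finite.mem_toFinset] at h
    exact Finset.mem_product.2 ⟨h.1, h.2.1⟩)
  have h9 : ((hfin.toFinset ×ˢ hfin.toFinset).filter (fun z => z.1.1 = z.2.1)).card ≤
      (Six' F δ m t s).ncard := by
    rw [← Set.ncard_coe_finset]
    refine Set.ncard_le_ncard_of_injOn (fun z => (z.1.1, z.1.2, z.2.2)) ?_ ?_ h6f
    · rintro ⟨⟨⟨w, w'⟩, u, u'⟩, ⟨⟨x, x'⟩, v, v'⟩⟩ h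
      simp only [Finset.coe_filter, Finset.mem_product, Set.mem_ofPred_eq, Set.Finite.mem_toFinset] at h
      obtain ⟨⟨ha, hb⟩, hc⟩ := h
      simp only [Prod.mk.injEq] at hc
      obtain ⟨rfl, rfl⟩ := hc
      exact ⟨ha.2.2, hb.2.2⟩
    · rintro ⟨⟨⟨w, w'⟩, u, u'⟩, ⟨⟨x, x'⟩, v, v'⟩⟩ h ⟨⟨⟨y, y'⟩, a, a'⟩, ⟨⟨z, z'⟩, b, b'⟩⟩ h' he
      simp only [Finset.coe_filter, Finset.mem_product, Set.mem_ofPred_eq, Set.Finite.mem_toFinset] at h h'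
      have h1 := h.2
      have h3 := h'.2
      simp only [Prod.mk.injEq] at he h1 h3 ⊢
      obtain ⟨⟨rfl, rfl⟩, ⟨rfl, rfl⟩, rfl, rfl⟩ := he
      obtain ⟨rfl, rfl⟩ := h1
      obtain ⟨rfl, rfl⟩ := h3
      simp
  have h10 := h8.trans (Nat.mul_le_mul le_rfl (h9.trans h7))
  rw [Finset.card_product, ← sq, ← mul_pow] at h10
  exact (Nat.pow_le_pow_iff_left (by norm_num)).1 h10

/-- pairs (w, u) with w in S and u a reduced continuation -/
noncomputable def PP [Fintype F] (S : Finset (List (Lt F δ))) (t : ℕ) : Finset (List (Lt F δ) × List (Lt F δ)) := by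
  classical
  exact (S ×ˢ wd F δ t).filter (fun z => Red (z.1 ++ z.2))

theorem mem_PP [Fintype F] {S : Finset (List (Lt F δ))} {t : ℕ} {z} :
    z ∈ PP S t ↔ z.1 ∈ S ∧ z.2.length = t ∧ Red (z.1 ++ z.2) := by
  unfold PP
  simp only [Finset.mem_filter, Finset.mem_product, mem_wd]
  constructor
  · rintro ⟨⟨a, b, c⟩, d⟩
    exact ⟨a, b, d⟩
  · rintro ⟨a, b, d⟩
    exact ⟨⟨a, b, (List.isChain_append.1 d).2.1⟩, d⟩

theorem card_PP [Fintype F] (hδ : ¬ IsSquare δ) (h2 : (2 : F) ≠ 0) {t : ℕ} (ht : 1 ≤ t)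
    {S : Finset (List (Lt F δ))} (hS : S ⊆ wd F δ t) :
    (PP S t).card = S.card * Fintype.card F ^ t := by
  classical
  have hne : ∀ w ∈ S, w ≠ [] := by
    rintro w hw rfl
    have := (mem_wd.1 (hS hw)).1
    simp at this; omega
  rw [Finset.card_eq_sum_card_fiberwise (f := Prod.fst) (t := S) (fun z hz => (mem_PP.1 hz).1)]
  rw [Finset.sum_congr rfl (g := fun _ => Fintype.card F ^ t), Finset.sum_const, smul_eq_mul]
  intro w hw
  rw [← card_wext hδ h2 t (w.getLast (hne w hw))]
  have hwr := (mem_wd.1 (hS hw)).2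
  have key : ∀ u, Red (w ++ u) ↔ Red (w.getLast (hne w hw) :: u) := by
    intro u
    unfold Red at *
    rw [List.isChain_append, List.isChain_cons]
    have := List.getLast?_eq_some_getLast (hne w hw)
    rw [this]
    simp only [Option.mem_def, Option.some.injEq, forall_eq']
    tauto
  refine Finset.card_bij (fun z _ => z.2) ?_ ?_ ?_
  · rintro ⟨w', u⟩ h
    simp only [Finset.mem_filter, mem_PP] at h
    obtain ⟨⟨h1, h3, h4⟩, rfl⟩ := h
    exact mem_wext.2 ⟨h3, (key u).1 h4⟩
  · rintro ⟨w', u⟩ h ⟨w'', u'⟩ h' he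
    simp only [Finset.mem_filter, mem_PP] at h h' he
    rw [h.2, h'.2, he]
  · intro u hu
    rw [mem_wext] at hu
    exact ⟨(w, u), by simp only [Finset.mem_filter, mem_PP]; exact ⟨⟨hw, hu.1, (key u).2 hu.2⟩, trivial⟩, rfl⟩

theorem energy [Fintype F] (hδ : ¬ IsSquare δ) (h2 : (2 : F) ≠ 0) {m t : ℕ} (hm : 1 ≤ m)
    (ht : 2 * t = 3 * m) {S : Finset (List (Lt F δ))} (hS : S ⊆ wd F δ t) :
    CardLE {z : (List (Lt F δ) × List (Lt F δ)) × (List (Lt F δ) × List (Lt F δ)) |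
      z.1 ∈ PP S t ∧ z.2 ∈ PP S t ∧ SDvd (X ^ m) (pw (z.1.1 ++ z.1.2) - pw (z.2.1 ++ z.2.2))}
      (S.card * Fintype.card F ^ t * (1 + 2 * t * HH m (Fintype.card F))) := by
  classical
  set q := Fintype.card F
  set H := HH m q
  have hP := card_PP hδ h2 (by omega : 1 ≤ t) hS
  have h0 : CardLE {z : (List (Lt F δ) × List (Lt F δ)) × (List (Lt F δ) × List (Lt F δ)) |
      z.1 ∈ PP S t ∧ z.1 = z.2} (S.card * q ^ t) := by
    refine CardLE.inj (t := (PP S t : Set _)) ⟨Finset.finite_toSet _, by rw [Set.ncard_coe_finset, hP]⟩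
      Prod.fst (fun z hz => hz.1) ?_
    rintro ⟨a, b⟩ h ⟨a', b'⟩ h' he
    simp only [Set.mem_ofPred_eq] at h h' he
    rw [← h.2, ← h'.2, he]
  let f : List (Lt F δ) → ((List (Lt F δ) × List (Lt F δ)) × (List (Lt F δ) × List (Lt F δ))) →
    ((List (Lt F δ) × List (Lt F δ)) × (List (Lt F δ) × List (Lt F δ))) := fun x z =>
      ((z.1.1, z.2.1 ++ x), (z.1.2, z.2.2 ++ x))
  have h1 : ∀ s ∈ Finset.Icc 1 t, CardLE {y | ∃ x : List (Lt F δ), (x.length = t - s ∧ Red x) ∧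
      ∃ z ∈ Quad S m t s, y = f x z} (S.card * q ^ t * (2 * H)) := by
    intro s hs
    rw [Finset.mem_Icc] at hs
    have := CardLE.biUnion (wd_CardLE (δ := δ) hδ h2 (t - s)) (g := fun x => {y | ∃ z ∈ Quad S m t s, y = f x z})
      (fun x _ => CardLE.image (card_quad hδ h2 hm hs.1 hs.2 ht S) (f x) (fun y hy => hy))
      (s := {y | ∃ x : List (Lt F δ), (x.length = t - s ∧ Red x) ∧ ∃ z ∈ Quad S m t s, y = f x z})
      (fun y hy => hy)
    refine this.mono subset_rfl (le_of_eq ?_)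
    have e : q ^ t = q ^ (t - s) * q ^ s := by rw [← pow_add]; congr 1; omega
    rw [e]; ring
  have h3 := CardLE.union h0 (CardLE.sum _ h1 (fun y hy => hy)) (s := {z : (List (Lt F δ) × List (Lt F δ)) × (List (Lt F δ) × List (Lt F δ)) |
      z.1 ∈ PP S t ∧ z.2 ∈ PP S t ∧ SDvd (X ^ m) (pw (z.1.1 ++ z.1.2) - pw (z.2.1 ++ z.2.2))}) ?_
  · refine h3.mono subset_rfl (le_of_eq ?_)
    rw [Finset.sum_const, Nat.card_Icc, smul_eq_mul]
    simp only [Nat.add_sub_cancel]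
    ring
  · rintro ⟨⟨w, u⟩, ⟨w', u'⟩⟩ ⟨ha, hb, hc⟩
    have ha' := ha
    rw [mem_PP] at ha hb
    obtain ⟨a1, a2, a3⟩ := ha
    obtain ⟨b1, b2, b3⟩ := hb
    simp only at a1 a2 a3 b1 b2 b3 hc
    have lw := mem_wd.1 (hS a1)
    have lw' := mem_wd.1 (hS b1)
    by_cases hu : u = u'
    · left
      subst hu
      have := word_inj hδ h2 hm lw.2 lw'.2 (by rw [lw.1, lw'.1]) (by omega) (sdvd_cancel_right hc)
      exact ⟨ha', by rw [this]⟩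
    · right
      obtain ⟨x, v, v', rfl, rfl, h4, h5, h6⟩ := common_suffix u u' (by rw [a2, b2]) hu
      have hv := List.length_pos_iff.2 h5
      rw [List.length_append] at a2 b2
      refine ⟨v.length, Finset.mem_Icc.2 ⟨hv, by omega⟩, x, ⟨by omega, ?_⟩, ((w, w'), (v, v')), ⟨a1, b1, ?_⟩, rfl⟩
      · exact (List.isChain_append.1 (List.isChain_append.1 a3).2.1).2.1
      · rw [← List.append_assoc] at a3 b3
        rw [← List.append_assoc, ← List.append_assoc] at hc
        exact ⟨lw.1, lw'.1, rfl, (by omega : v'.length = v.length), (List.isChain_append.1 a3).1, (List.isChain_append.1 b3).1, h4,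
          sdvd_cancel_right hc⟩

theorem expansion [Fintype F] (hδ : ¬ IsSquare δ) (h2 : (2 : F) ≠ 0) {m t : ℕ} (hm : 1 ≤ m)
    (ht : 2 * t = 3 * m) {S : Finset (List (Lt F δ))} (hS : S ⊆ wd F δ t)
    {V : Type*} [DecidableEq V] (y : List (Lt F δ) → V)
    (hy : ∀ x x', x.length = x'.length → y x = y x' → SDvd (X ^ m) (pw x - pw x')) :
    S.card * Fintype.card F ^ t ≤
      ((PP S t).image (fun z => y (z.1 ++ z.2))).card * (1 + 2 * t * HH m (Fintype.card F)) := by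
  classical
  obtain ⟨hf, he⟩ := energy hδ h2 hm ht hS
  have hP := card_PP hδ h2 (by omega : 1 ≤ t) hS
  have h1 := cs_fiber (PP S t) ((PP S t).image (fun z => y (z.1 ++ z.2))) (fun z => y (z.1 ++ z.2))
    (fun a ha => Finset.mem_image_of_mem _ ha)
  have h3 : ((PP S t ×ˢ PP S t).filter (fun z => y (z.1.1 ++ z.1.2) = y (z.2.1 ++ z.2.2))).card ≤
      S.card * Fintype.card F ^ t * (1 + 2 * t * HH m (Fintype.card F)) := by
    refine le_trans ?_ he
    rw [← Set.ncard_coe_finset]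
    refine Set.ncard_le_ncard ?_ hf
    rintro ⟨⟨w, u⟩, ⟨w', u'⟩⟩ h
    simp only [Finset.coe_filter, Finset.mem_product, Set.mem_ofPred_eq] at h
    obtain ⟨⟨h1, h3⟩, h4⟩ := h
    refine ⟨h1, h3, hy _ _ ?_ h4⟩
    have a := mem_PP.1 h1
    have b := mem_PP.1 h3
    simp only [List.length_append]
    rw [a.2.1, b.2.1, (mem_wd.1 (hS a.1)).1, (mem_wd.1 (hS b.1)).1]
  rw [hP] at h1
  have h4 := h1.trans (Nat.mul_le_mul le_rfl h3)
  rcases Nat.eq_zero_or_pos (S.card * Fintype.card F ^ t) with h0 | h0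
  · rw [h0]; exact Nat.zero_le _
  · refine Nat.le_of_mul_le_mul_left ?_ h0
    rw [sq] at h4
    refine h4.trans (le_of_eq (by ring))

end

end

section
open Polynomial Quaternion

/-- the cops, to move, can win in `n` rounds -/
def CWn {V : Type*} (G : SimpleGraph V) (k : ℕ) : ℕ → (Fin k → V) → V → Prop
  | 0, c, r => ∃ i, c i = r
  | n + 1, c, r => ∃ c' : Fin k → V, (∀ i, c' i = c i ∨ G.Adj (c i) (c' i)) ∧
      ((∃ i, c' i = r) ∨ ∀ r', (r' = r ∨ G.Adj r r') → CWn G k n c' r')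

theorem CWn_of_cap {V : Type*} {G : SimpleGraph V} {k : ℕ} {c : Fin k → V} {r : V} (h : ∃ i, c i = r) (n : ℕ) :
    CWn G k n c r := by
  cases n with
  | zero => exact h
  | succ n => exact ⟨c, fun i => Or.inl rfl, Or.inl h⟩

theorem copsWin_of_CWn {V : Type*} (G : SimpleGraph V) (k : ℕ) (c0 : Fin k → V)
    (h : ∀ r, ∃ n, CWn G k n c0 r) : CopsWin G k := by
  classical
  have hex : ∀ c r, ∃ c' : Fin k → V, (∀ i, c' i = c i ∨ G.Adj (c i) (c' i)) ∧
      ∀ n, CWn G k (n + 1) c r → ∃ N ≤ n, (∃ i, c' i = r) ∨ ∀ r', (r' = r ∨ G.Adj r r') → CWn G k N c' r' := by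
    intro c r
    by_cases hh : ∃ n, CWn G k (n + 1) c r
    · obtain ⟨c', h1, h2⟩ := Nat.find_spec hh
      exact ⟨c', h1, fun n hn => ⟨Nat.find hh, Nat.find_min' hh hn, h2⟩⟩
    · exact ⟨c, fun i => Or.inl rfl, fun n hn => absurd ⟨n, hn⟩ hh⟩
  choose mv hmv hmv2 using hex
  refine ⟨⟨c0, mv, hmv⟩, ?_⟩
  intro RS
  set CS : CopStrategy G k := ⟨c0, mv, hmv⟩
  have main : ∀ n a, CWn G k n (play CS RS a).1 (play CS RS a).2 →
      ∃ n, (∃ i, (play CS RS n).1 i = (play CS RS n).2) ∨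
         (∃ i, (play CS RS (n + 1)).1 i = (play CS RS n).2) := by
    intro n
    induction n using Nat.strong_induction_on with
    | _ n ih =>
      intro a ha
      cases n with
      | zero => exact ⟨a, Or.inl ha⟩
      | succ n =>
        obtain ⟨N, hN, hc⟩ := hmv2 _ _ n ha
        rcases hc with hc | hc
        · exact ⟨a, Or.inr hc⟩
        · exact ih N (by omega) (a + 1) (hc _ (RS.valid _ _))
  obtain ⟨n, hn⟩ := h (RS.init c0)
  exact main n 0 hn

theorem move_assign {V ι : Type*} {G : SimpleGraph V} {k : ℕ} (c : Fin k → V) (W : Set ι) (asg : ι → Fin k)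
    (hinj : Set.InjOn asg W) (T : ι → V) (hT : ∀ w ∈ W, T w = c (asg w) ∨ G.Adj (c (asg w)) (T w)) :
    ∃ c' : Fin k → V, (∀ i, c' i = c i ∨ G.Adj (c i) (c' i)) ∧ ∀ w ∈ W, c' (asg w) = T w := by
  classical
  refine ⟨fun i => if h : ∃ w ∈ W, asg w = i then T h.choose else c i, ?_, ?_⟩
  · intro i
    by_cases h : ∃ w ∈ W, asg w = i
    · simp only [h, dif_pos]
      have := hT _ h.choose_spec.1
      rwa [h.choose_spec.2] at this
    · simp only [h]
      left; rfl
  · intro w hw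
    have h : ∃ w' ∈ W, asg w' = asg w := ⟨w, hw, rfl⟩
    simp only [h, dif_pos]
    rw [hinj h.choose_spec.1 hw h.choose_spec.2]

section
variable {F : Type*} [Field F] {δ : F}

/-- walking along a word -/
def walk {V A : Type*} (step : V → A → V) (v : V) (w : List A) : V := w.foldl step v

theorem walk_append {V A : Type*} (step : V → A → V) (v : V) (w u : List A) :
    walk step v (w ++ u) = walk step (walk step v w) u := by simp [walk]

theorem walk_snoc {V A : Type*} (step : V → A → V) (v : V) (w : List A) (a : A) :
    walk step v (w ++ [a]) = step (walk step v w) a := by simp [walk]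

/-- a labelled graph -/
structure LabG (F : Type*) [Field F] (δ : F) {V : Type*} (G : SimpleGraph V) (step : V → Lt F δ → V) : Prop where
  back : ∀ v a, step (step v a) (ln a) = v
  adj : ∀ v w, G.Adj v w ↔ ∃ a, step v a = w

theorem red_snoc {w : List (Lt F δ)} {a : Lt F δ} (hw : Red w) (h : ∀ b ∈ w.getLast?, a ≠ ln b) :
    Red (w ++ [a]) := by
  unfold Red at *
  rw [List.isChain_append]
  refine ⟨hw, by simp, ?_⟩
  intro x hx y hy
  simp at hy
  subst hy
  exact h x hx

theorem LabG.robber {V : Type*} {G : SimpleGraph V} {step : V → Lt F δ → V} (hG : LabG F δ G step) {v r r' : V}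
    {x : List (Lt F δ)} (hx : Red x) (hr : walk step v x = r) (h : r' = r ∨ G.Adj r r') :
    ∃ x', Red x' ∧ x'.length ≤ x.length + 1 ∧ walk step v x' = r' := by
  rcases h with rfl | h
  · exact ⟨x, hx, by omega, hr⟩
  · obtain ⟨a, rfl⟩ := (hG.adj _ _).1 h
    by_cases hc : ∀ b ∈ x.getLast?, a ≠ ln b
    · exact ⟨x ++ [a], red_snoc hx hc, by simp, by rw [walk_snoc, hr]⟩
    · push Not at hc
      obtain ⟨b, hb, rfl⟩ := hc
      obtain ⟨y, rfl⟩ := List.getLast?_eq_some_iff.1 hb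
      refine ⟨y, (List.isChain_append.1 hx).1, by simp; omega, ?_⟩
      rw [← hr, walk_snoc, hG.back]

theorem LabG.drop {V : Type*} {G : SimpleGraph V} {step : V → Lt F δ → V} (hG : LabG F δ G step) (v : V)
    (x : List (Lt F δ)) (a : Lt F δ) : G.Adj (walk step v (x ++ [a])) (walk step v x) := by
  rw [hG.adj]
  exact ⟨ln a, by rw [walk_snoc, hG.back]⟩

theorem LabG.stratA {V : Type*} {G : SimpleGraph V} {step : V → Lt F δ → V} (hG : LabG F δ G step)
    (h2 : (2 : F) ≠ 0) {k : ℕ} (v : V) (j : ℕ) : ∀ (c : Fin k → V) (asg : List (Lt F δ) → Fin k)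
      (_ : Set.InjOn asg {w | w.length = j ∧ Red w})
      (_ : ∀ w, w.length = j → Red w → c (asg w) = walk step v w)
      (r : V) (x : List (Lt F δ)) (_ : Red x) (_ : x.length ≤ j) (_ : walk step v x = r), CWn G k j c r := by
  induction j with
  | zero =>
    intro c asg hi hc r x hx hl hr
    exact ⟨asg x, by rw [hc x (by omega) hx, hr]⟩
  | succ j ih =>
    intro c asg hi hc r x hx hl hr
    rcases hl.eq_or_lt with hl | hl
    · exact CWn_of_cap ⟨asg x, by rw [hc x hl hx, hr]⟩ _
    · let lt (w : List (Lt F δ)) : Lt F δ := w.getLast?.getD ⟨(1, 0), by simp⟩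
      have hred : ∀ w, Red w → Red (w ++ [lt w]) := by
        intro w hw
        apply red_snoc hw
        intro b hb
        rw [Option.mem_def] at hb
        simp only [lt, hb, Option.getD_some]
        exact (ln_ne h2 b).symm
      have hi' : Set.InjOn (fun w => asg (w ++ [lt w])) {w | w.length = j ∧ Red w} := by
        intro w hw w' hw' he
        have := hi (by simpa using ⟨hw.1, hred w hw.2⟩) (by simpa using ⟨hw'.1, hred w' hw'.2⟩) he
        exact (List.append_inj' this rfl).1
      have hcc : ∀ w ∈ {w : List (Lt F δ) | w.length = j ∧ Red w},
          c (asg (w ++ [lt w])) = walk step v (w ++ [lt w]) :=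
        fun w hw => hc _ (by simpa using hw.1) (hred w hw.2)
      obtain ⟨c', h1, h3⟩ := move_assign (G := G) c _ _ hi' (fun w => walk step v w) (by
        intro w hw
        right
        rw [hcc w hw]
        exact hG.drop _ _ _)
      refine ⟨c', h1, ?_⟩
      by_cases hj : x.length = j
      · left
        exact ⟨_, (h3 x ⟨hj, hx⟩).trans hr⟩
      · right
        intro r' hr'
        obtain ⟨x', a1, a2, a3⟩ := hG.robber hx hr hr'
        exact ih c' _ hi' (fun w hw hw' => h3 w ⟨hw, hw'⟩) r' x' a1 (by omega) a3

theorem LabG.stratB {V : Type*} {G : SimpleGraph V} {step : V → Lt F δ → V} (hG : LabG F δ G step)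
    (h2 : (2 : F) ≠ 0) {k : ℕ} (v : V) (j : ℕ) (asg : List (Lt F δ) → Fin k)
    (hi : Set.InjOn asg {w | w.length = j ∧ Red w}) (l : ℕ) : ∀ (c : Fin k → V)
      (_ : ∀ w, w.length = j → Red w → ∃ u : List (Lt F δ), u.length = l ∧ c (asg w) = walk step v (w ++ u))
      (r : V) (x : List (Lt F δ)) (_ : Red x) (_ : x.length + l ≤ j) (_ : walk step v x = r),
      CWn G k (j + l) c r := by
  induction l with
  | zero =>
    intro c hc r x hx hl hr
    refine hG.stratA h2 v j c asg hi ?_ r x hx hl hr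
    intro w hw hw'
    obtain ⟨u, hu, he⟩ := hc w hw hw'
    rw [List.length_eq_zero_iff] at hu
    rw [he, hu, List.append_nil]
  | succ l ih =>
    intro c hc r x hx hl hr
    have hc' : ∀ w, ∃ u : List (Lt F δ), ∃ a, w.length = j → Red w →
        u.length = l ∧ c (asg w) = walk step v ((w ++ u) ++ [a]) := by
      intro w
      by_cases hw : w.length = j ∧ Red w
      · obtain ⟨u, hu, he⟩ := hc w hw.1 hw.2
        rcases List.eq_nil_or_concat u with rfl | ⟨u', a, rfl⟩
        · simp at hu
        · exact ⟨u', a, fun _ _ => ⟨by simpa using hu, by rw [he]; simp⟩⟩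
      · exact ⟨[], ⟨(1, 0), by simp⟩, fun h1 h2 => absurd ⟨h1, h2⟩ hw⟩
    choose u a hu using hc'
    obtain ⟨c', h1, h3⟩ := move_assign (G := G) c _ _ hi (fun w => walk step v (w ++ u w)) (by
        intro w hw
        right
        rw [(hu w hw.1 hw.2).2]
        exact hG.drop _ _ _)
    refine ⟨c', h1, Or.inr ?_⟩
    intro r' hr'
    obtain ⟨x', a1, a2, a3⟩ := hG.robber hx hr hr'
    exact ih c' (fun w hw hw' => ⟨u w, (hu w hw hw').1, h3 w ⟨hw, hw'⟩⟩) r' x' a1 (by omega) a3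

theorem LabG.copsWin {V : Type*} {G : SimpleGraph V} {step : V → Lt F δ → V} (hG : LabG F δ G step)
    (h2 : (2 : F) ≠ 0) {k t : ℕ} (c : Fin k → V)
    (h : ∀ v, ∃ asg : List (Lt F δ) → Fin k, Set.InjOn asg {w | w.length = t ∧ Red w} ∧
      ∀ w, w.length = t → Red w → ∃ u : List (Lt F δ), u.length = t ∧ c (asg w) = walk step v (w ++ u)) :
    CopsWin G k := by
  refine copsWin_of_CWn G k c ?_
  intro r
  obtain ⟨asg, h1, h3⟩ := h r
  exact ⟨t + t, hG.stratB h2 r t asg h1 t c h3 r [] (by unfold Red; simp) (by simp) rfl⟩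

end

end

section
open Polynomial Quaternion

section
variable {V ι : Type*} [Fintype V] [DecidableEq V] [Fintype ι] [DecidableEq ι]

theorem card_avoid [Nonempty V] (N : Finset V) (C s : ℕ) (g : Fin s → Fin C) (hs : 2 * s ≤ C) :
    ((Fintype.piFinset (fun i : Fin C => if i ∈ Finset.univ.image g then Finset.univ else Nᶜ)).card : ℝ) ≤
      (Fintype.card V : ℝ) ^ C * Real.exp (- (N.card * C / (2 * Fintype.card V))) := by
  have hn : (0 : ℝ) < Fintype.card V := by exact_mod_cast Fintype.card_pos
  set n : ℝ := ((Fintype.card V : ℕ) : ℝ)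
  set R := Finset.univ.image g
  rw [Fintype.card_piFinset]
  push_cast
  have h1 : ∀ i ∈ (Finset.univ : Finset (Fin C)), (((if i ∈ R then Finset.univ else Nᶜ : Finset V).card : ℕ) : ℝ) ≤
      n * (if i ∈ R then 1 else Real.exp (- (N.card / n))) := by
    intro i _
    split_ifs
    · simp [n]
    · rw [Finset.card_compl, Nat.cast_sub (Finset.card_le_univ _)]
      have := Real.add_one_le_exp (- ((N.card : ℝ) / n))
      calc n - N.card = n * (-((N.card : ℝ) / n) + 1) := by field_simp; ring
        _ ≤ _ := by gcongr
  refine (Finset.prod_le_prod (fun i _ => Nat.cast_nonneg _) h1).trans ?_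
  rw [Finset.prod_mul_distrib, Finset.prod_const, Finset.card_univ, Fintype.card_fin]
  gcongr
  rw [Finset.prod_ite, Finset.prod_const_one, one_mul, Finset.prod_const, ← Real.exp_nat_mul]
  apply Real.exp_le_exp.2
  have hR : R.card ≤ s := Finset.card_image_le.trans (by simp)
  have h2 : (Finset.univ.filter (fun i => i ∉ R)).card + R.card = C := by
    have := Finset.card_filter_add_card_filter_not (s := (Finset.univ : Finset (Fin C))) (fun i => i ∈ R)
    rw [Finset.card_univ, Fintype.card_fin, Finset.filter_mem_eq_inter, Finset.univ_inter] at this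
    omega
  have h3 : (C : ℝ) / 2 ≤ (Finset.univ.filter (fun i => i ∉ R)).card := by
    have : C ≤ 2 * (Finset.univ.filter (fun i => i ∉ R)).card := by omega
    have : (C : ℝ) ≤ 2 * (Finset.univ.filter (fun i => i ∉ R)).card := by exact_mod_cast this
    linarith
  have h4 : (0 : ℝ) ≤ N.card / n := by positivity
  have e : (N.card : ℝ) * C / (2 * n) = C / 2 * (N.card / n) := by field_simp
  rw [e]
  nlinarith

theorem card_bad [Nonempty V] (N : Finset V) (C s : ℕ) (hs : 2 * s ≤ C) (hs1 : 1 ≤ s) :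
    (((Finset.univ : Finset (Fin C → V)).filter (fun c => (Finset.univ.filter (fun i => c i ∈ N)).card < s)).card : ℝ) ≤
      (C : ℝ) ^ s * ((Fintype.card V : ℝ) ^ C * Real.exp (- (N.card * C / (2 * Fintype.card V)))) := by
  classical
  have hsub : (Finset.univ : Finset (Fin C → V)).filter (fun c => (Finset.univ.filter (fun i => c i ∈ N)).card < s) ⊆
      (Finset.univ : Finset (Fin s → Fin C)).biUnion (fun g =>
        Fintype.piFinset (fun i : Fin C => if i ∈ Finset.univ.image g then Finset.univ else Nᶜ)) := by
    intro c hc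
    simp only [Finset.mem_filter, Finset.mem_univ, true_and] at hc
    simp only [Finset.mem_biUnion, Finset.mem_univ, true_and, Fintype.mem_piFinset]
    set T := Finset.univ.filter (fun i => c i ∈ N)
    let e := T.equivFin
    refine ⟨fun i => if h : i.1 < T.card then (e.symm ⟨i.1, h⟩).1 else ⟨0, by omega⟩, ?_⟩
    intro i
    split_ifs with h
    · exact Finset.mem_univ _
    · rw [Finset.mem_compl]
      intro hi
      apply h
      have hiT : i ∈ T := by simp [T, hi]
      rw [Finset.mem_image]
      refine ⟨⟨(e ⟨i, hiT⟩).1, lt_trans (e ⟨i, hiT⟩).2 hc⟩, Finset.mem_univ _, ?_⟩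
      simp
  have h1 := (Finset.card_le_card hsub).trans Finset.card_biUnion_le
  have h2 : (((Finset.univ : Finset (Fin C → V)).filter (fun c => (Finset.univ.filter (fun i => c i ∈ N)).card < s)).card : ℝ) ≤ ∑ g : Fin s → Fin C, ((Fintype.piFinset (fun i : Fin C => if i ∈ Finset.univ.image g then Finset.univ else Nᶜ)).card : ℝ) := by
    exact_mod_cast h1
  refine h2.trans ((Finset.sum_le_sum (fun g _ => card_avoid N C s g hs)).trans ?_)
  rw [Finset.sum_const, Finset.card_univ, nsmul_eq_mul]
  simp

theorem placement [Nonempty V] (n : V → ι → Finset V) (β : ℝ)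
    (hexp : ∀ v (S : Finset ι), β * S.card ≤ (S.biUnion (n v)).card) (C : ℕ) (hC : 2 * Fintype.card ι ≤ C)
    (hbig : 2 * Fintype.card V * (Fintype.card ι * C) < Real.exp (β * C / (2 * Fintype.card V))) :
    ∃ c : Fin C → V, ∀ v, ∃ f : ι → Fin C, Function.Injective f ∧ ∀ w, c (f w) ∈ n v w := by
  classical
  have hn1 : (1 : ℝ) ≤ Fintype.card V := by exact_mod_cast Fintype.card_pos
  by_contra hcon
  push Not at hcon
  have hbad : ∀ c : Fin C → V, ∃ v, ∃ S : Finset ι, (Finset.univ.filter (fun i => c i ∈ S.biUnion (n v))).card < S.card := by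
    intro c
    obtain ⟨v, hv⟩ := hcon c
    refine ⟨v, ?_⟩
    by_contra hh
    push Not at hh
    obtain ⟨f, hf, hf2⟩ := (Finset.all_card_le_biUnion_card_iff_exists_injective
      (fun w : ι => Finset.univ.filter (fun i => c i ∈ n v w))).1 (by
        intro S
        refine (hh S).trans (Finset.card_le_card ?_)
        intro i hi
        simp only [Finset.mem_filter, Finset.mem_univ, true_and, Finset.mem_biUnion] at hi ⊢
        exact hi)
    obtain ⟨w, hw⟩ := hv f hf
    apply hw
    simpa using hf2 w
  set W := Fintype.card ι
  set z : ℝ := C * Real.exp (-(β * C / (2 * Fintype.card V))) with hz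
  have hz0 : 0 ≤ z := by positivity
  have hcover : (Finset.univ : Finset (Fin C → V)) ⊆ (Finset.univ : Finset V).biUnion (fun v =>
      ((Finset.univ : Finset ι).powerset.erase ∅).biUnion (fun S =>
        Finset.univ.filter (fun c => (Finset.univ.filter (fun i => c i ∈ S.biUnion (n v))).card < S.card))) := by
    intro c _
    obtain ⟨v, S, h⟩ := hbad c
    rw [Finset.mem_biUnion]
    refine ⟨v, Finset.mem_univ _, ?_⟩
    rw [Finset.mem_biUnion]
    refine ⟨S, ?_, Finset.mem_filter.2 ⟨Finset.mem_univ _, h⟩⟩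
    rw [Finset.mem_erase]
    refine ⟨?_, by simp⟩
    rintro rfl
    simp at h
  have h1 : ((Fintype.card V : ℝ)) ^ C ≤ ∑ v : V, ∑ S ∈ (Finset.univ : Finset ι).powerset.erase ∅,
      (Fintype.card V : ℝ) ^ C * z ^ S.card := by
    have e : ((Fintype.card V : ℝ)) ^ C = ((Finset.univ : Finset (Fin C → V)).card : ℝ) := by
      rw [Finset.card_univ]; simp
    have h2 := (Finset.card_le_card hcover).trans (Finset.card_biUnion_le.trans
      (Finset.sum_le_sum (fun v _ => Finset.card_biUnion_le)))
    rw [e]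
    refine le_trans (Nat.cast_le.2 h2) ?_
    push_cast
    refine Finset.sum_le_sum (fun v _ => Finset.sum_le_sum (fun S hS => ?_))
    have hS0 : S.Nonempty := Finset.nonempty_iff_ne_empty.2 (Finset.ne_of_mem_erase hS)
    have hSW : S.card ≤ W := Finset.card_le_univ S
    refine (card_bad _ C S.card (by omega) hS0.card_pos).trans ?_
    rw [hz, mul_pow, ← Real.exp_nat_mul]
    have h3 : Real.exp (-(((S.biUnion (n v)).card : ℝ) * C / (2 * Fintype.card V))) ≤
        Real.exp (S.card * -(β * C / (2 * Fintype.card V))) := by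
      apply Real.exp_le_exp.2
      have h4 := hexp v S
      have h5 : (S.card : ℝ) * (β * C / (2 * Fintype.card V)) ≤ ((S.biUnion (n v)).card : ℝ) * C / (2 * Fintype.card V) := by
        calc (S.card : ℝ) * (β * C / (2 * Fintype.card V)) = (β * S.card) * C / (2 * Fintype.card V) := by ring
          _ ≤ _ := by gcongr
      linarith
    calc (C : ℝ) ^ S.card * ((Fintype.card V : ℝ) ^ C * Real.exp (-(((S.biUnion (n v)).card : ℝ) * C / (2 * Fintype.card V))))
        ≤ (C : ℝ) ^ S.card * ((Fintype.card V : ℝ) ^ C * Real.exp (S.card * -(β * C / (2 * Fintype.card V)))) := by gcongr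
      _ = _ := by simp only [Finset.card_univ, Fintype.card_pi_const, Fintype.card_fin, Nat.cast_pow]; ring
  have h6 : ∑ S ∈ (Finset.univ : Finset ι).powerset.erase ∅, z ^ S.card = (1 + z) ^ W - 1 := by
    have h7 := Finset.sum_erase_add (Finset.univ : Finset ι).powerset (fun S => z ^ S.card) (Finset.empty_mem_powerset _)
    have h8 := Finset.sum_pow_mul_eq_add_pow z 1 (Finset.univ : Finset ι)
    simp only [one_pow, mul_one, Finset.card_univ] at h8
    simp only [Finset.card_empty, pow_zero] at h7
    rw [h8] at h7
    rw [add_comm 1 z]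
    linarith
  simp only [← Finset.mul_sum, h6, Finset.sum_const, Finset.card_univ, nsmul_eq_mul] at h1
  set n0 : ℝ := ((Fintype.card V : ℕ) : ℝ)
  have hpos : 0 < n0 ^ C := by positivity
  have h9 : 1 ≤ n0 * ((1 + z) ^ W - 1) := by
    have : n0 ^ C * 1 ≤ n0 ^ C * (n0 * ((1 + z) ^ W - 1)) := by linarith
    exact le_of_mul_le_mul_left this hpos
  have h10 : 2 * n0 * (W * z) < 1 := by
    rw [hz, Real.exp_neg]
    have hE := Real.exp_pos (β * C / (2 * n0))
    rw [show 2 * n0 * (W * (C * (Real.exp (β * C / (2 * n0)))⁻¹)) = (2 * n0 * (W * C)) / Real.exp (β * C / (2 * n0)) by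
      rw [div_eq_mul_inv]; ring]
    rw [div_lt_one hE]
    exact hbig
  have hWz : 0 ≤ (W : ℝ) * z := by positivity
  have h11 : (1 + z) ^ W ≤ Real.exp (W * z) := by
    rw [Real.exp_nat_mul]
    gcongr
    linarith [Real.add_one_le_exp z]
  have h12 : Real.exp (W * z) * (1 - W * z) ≤ 1 := by
    have := Real.one_sub_le_exp_neg (W * z)
    rw [Real.exp_neg] at this
    have hE := Real.exp_pos (W * z)
    calc Real.exp (W * z) * (1 - W * z) ≤ Real.exp (W * z) * (Real.exp (W * z))⁻¹ := by gcongr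
      _ = 1 := mul_inv_cancel₀ hE.ne'
  have h13 : W * z ≤ 1 / 2 := by nlinarith
  set E := Real.exp (W * z)
  have h14 : E - 1 ≤ 2 * (W * z) := by
    have hE2 : E ≤ 2 := by nlinarith [Real.exp_pos (W * z)]
    nlinarith
  nlinarith

end

end

section
open Polynomial Quaternion

theorem D_bound {m q t : ℕ} (hq : 1 ≤ q) (ht : 2 * t = 3 * m) :
    1 + 2 * t * HH m q ≤ 166 * (m + 1) ^ 3 * 32 ^ m * q ^ 5 := by
  rw [ht]
  unfold HH
  have h1 : 1 ≤ (m + 1) ^ 3 * 32 ^ m * q ^ 5 := Nat.one_le_iff_ne_zero.2 (by positivity)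
  have h2 : 3 * m * (55 * (m + 1) ^ 2 * 32 ^ m * q ^ 5) ≤ 3 * (m + 1) * (55 * (m + 1) ^ 2 * 32 ^ m * q ^ 5) := by
    gcongr; omega
  calc 1 + 3 * m * (55 * (m + 1) ^ 2 * 32 ^ m * q ^ 5)
      ≤ (m + 1) ^ 3 * 32 ^ m * q ^ 5 + 3 * (m + 1) * (55 * (m + 1) ^ 2 * 32 ^ m * q ^ 5) := by omega
    _ = _ := by ring

section
variable {F : Type*} [Field F] {δ : F}

theorem cop_bound [Fintype F] (hδ : ¬ IsSquare δ) (h2 : (2 : F) ≠ 0) {m t : ℕ} (hm : 1 ≤ m)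
    (ht : 2 * t = 3 * m) {V : Type*} [Fintype V] [Nonempty V] {G : SimpleGraph V} {step : V → Lt F δ → V}
    (hG : LabG F δ G step)
    (hy : ∀ v x x', x.length = x'.length → walk step v x = walk step v x' → SDvd (X ^ m) (pw x - pw x'))
    (hV : Fintype.card V ≤ 2 * Fintype.card F ^ (2 * t))
    (hA : 32 * 166 * Fintype.card F ^ 5 * (6 * Fintype.card F + 6) * (m + 1) ^ 4 < 2 ^ m) :
    copNumber G ≤ Fintype.card F ^ t * 64 ^ m := by
  classical
  have hq : 1 ≤ Fintype.card F := Fintype.card_pos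
  have hD := D_bound (m := m) (q := Fintype.card F) hq ht
  have hexp := fun v (S : Finset (List (Lt F δ))) hS => expansion (S := S) hδ h2 hm ht hS (walk step v) (hy v)
  set q := Fintype.card F
  have hDpos : 1 ≤ 1 + 2 * t * HH m q := by omega
  set D := 1 + 2 * t * HH m q
  set L := (6 * q + 6) * m with hL
  have hL1 : 1 ≤ L := Nat.one_le_iff_ne_zero.2 (by positivity)
  set C := 4 * D * q ^ t * L with hC
  have hqt : 1 ≤ q ^ t := Nat.one_le_pow _ _ hq
  have hAm : 32 * 166 * q ^ 5 * (6 * q + 6) * ((m + 1) ^ 3 * m) ≤ 2 ^ m := by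
    refine le_trans ?_ hA.le
    rw [pow_succ (m + 1) 3]
    gcongr; omega
  have hC2 : C ≤ q ^ t * 64 ^ m := by
    calc C ≤ 4 * (166 * (m + 1) ^ 3 * 32 ^ m * q ^ 5) * q ^ t * L := by rw [hC]; gcongr
      _ = 4 * 166 * q ^ 5 * (6 * q + 6) * ((m + 1) ^ 3 * m) * (q ^ t * 32 ^ m) := by rw [hL]; ring
      _ ≤ 32 * 166 * q ^ 5 * (6 * q + 6) * ((m + 1) ^ 3 * m) * (q ^ t * 32 ^ m) := by gcongr; norm_num
      _ ≤ 2 ^ m * (q ^ t * 32 ^ m) := by gcongr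
      _ = q ^ t * (2 * 32) ^ m := by rw [mul_pow]; ring
      _ = _ := by norm_num
  have hbigN : 32 * q ^ (4 * t) * D * L < 2 ^ L := by
    have e1 : q ^ (4 * t) ≤ 2 ^ (6 * q * m) := by
      rw [show 4 * t = 6 * m by omega, show 6 * q * m = q * (6 * m) by ring, pow_mul]
      rw [pow_mul]
      rw [← pow_mul 2]
      rw [pow_mul 2, ← pow_mul q]
      exact Nat.pow_le_pow_left (Nat.lt_two_pow_self).le _
    have hAm' : 32 * 166 * q ^ 5 * (6 * q + 6) * ((m + 1) ^ 3 * m) < 2 ^ m := by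
      refine lt_of_le_of_lt ?_ hA
      rw [pow_succ (m + 1) 3]
      gcongr; omega
    calc 32 * q ^ (4 * t) * D * L ≤ 32 * 2 ^ (6 * q * m) * (166 * (m + 1) ^ 3 * 32 ^ m * q ^ 5) * L := by gcongr
      _ = 32 * 166 * q ^ 5 * (6 * q + 6) * ((m + 1) ^ 3 * m) * (2 ^ (6 * q * m) * 32 ^ m) := by rw [hL]; ring
      _ < 2 ^ m * (2 ^ (6 * q * m) * 32 ^ m) := by
        apply Nat.mul_lt_mul_of_pos_right hAm'
        positivity
      _ = 2 ^ L := by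
        rw [show (32 : ℕ) = 2 ^ 5 by norm_num, ← pow_mul, ← pow_add, ← pow_add, hL]
        congr 1; ring
  have hcop : CopsWin G C := by
    have hW : Fintype.card {w // w ∈ wd F δ t} ≤ 2 * q ^ t := by
      rw [Fintype.card_coe]; exact card_wd hδ h2 t
    have hn0 : (0 : ℝ) < Fintype.card V := by exact_mod_cast Fintype.card_pos
    have hDr : (0 : ℝ) < D := by exact_mod_cast hDpos
    have hVr : (Fintype.card V : ℝ) ≤ 2 * (q : ℝ) ^ (2 * t) := by exact_mod_cast hV
    obtain ⟨c, hc⟩ := placement (V := V) (ι := {w // w ∈ wd F δ t})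
      (fun v w => (PP {w.1} t).image (fun z => walk step v (z.1 ++ z.2))) ((q : ℝ) ^ t / D) (by
        intro v S
        have h3 := hexp v (S.map (Function.Embedding.subtype _)) (by
          intro w hw
          rw [Finset.mem_map] at hw
          obtain ⟨a, -, rfl⟩ := hw
          exact a.2)
        rw [Finset.card_map] at h3
        have h4 : (PP (S.map (Function.Embedding.subtype _)) t).image (fun z => walk step v (z.1 ++ z.2)) ⊆
            S.biUnion (fun w => (PP {w.1} t).image (fun z => walk step v (z.1 ++ z.2))) := by
          intro y hy
          rw [Finset.mem_image] at hy
          obtain ⟨z, hz, rfl⟩ := hy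
          rw [mem_PP, Finset.mem_map] at hz
          obtain ⟨⟨a, ha, haz⟩, hz2, hz3⟩ := hz
          rw [Finset.mem_biUnion]
          refine ⟨a, ha, Finset.mem_image.2 ⟨z, mem_PP.2 ⟨?_, hz2, hz3⟩, rfl⟩⟩
          rw [Finset.mem_singleton]
          exact haz.symm
        have h5 := h3.trans (Nat.mul_le_mul (Finset.card_le_card h4) le_rfl)
        rw [div_mul_eq_mul_div, div_le_iff₀ hDr]
        rw [mul_comm ((q : ℝ) ^ t)]
        exact_mod_cast h5) C (by
        calc 2 * Fintype.card {w // w ∈ wd F δ t} ≤ 2 * (2 * q ^ t) := by gcongr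
          _ = 4 * 1 * q ^ t * 1 := by ring
          _ ≤ C := by rw [hC]; gcongr) (by
        have s1 : (2 * Fintype.card V * (Fintype.card {w // w ∈ wd F δ t} * C) : ℝ) < 2 ^ L := by
          have : 2 * Fintype.card V * (Fintype.card {w // w ∈ wd F δ t} * C) < 2 ^ L := by
            refine lt_of_le_of_lt ?_ hbigN
            calc 2 * Fintype.card V * (Fintype.card {w // w ∈ wd F δ t} * C)
                ≤ 2 * (2 * q ^ (2 * t)) * ((2 * q ^ t) * C) := by gcongr
              _ = 32 * q ^ (4 * t) * D * L := by
                rw [hC, show 4 * t = 2 * t + t + t by ring, pow_add, pow_add]; ring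
          exact_mod_cast this
        refine s1.trans_le ?_
        have s2 : (2 : ℝ) ^ L ≤ Real.exp L := by
          have : (2 : ℝ) ≤ Real.exp 1 := by linarith [Real.add_one_le_exp (1 : ℝ)]
          calc (2 : ℝ) ^ L ≤ (Real.exp 1) ^ L := by gcongr
            _ = Real.exp L := by rw [← Real.exp_nat_mul, mul_one]
        refine s2.trans (Real.exp_le_exp.2 ?_)
        rw [le_div_iff₀ (by positivity), hC]
        push_cast
        have e : (q : ℝ) ^ t / D * (4 * D * (q : ℝ) ^ t * L) = L * (4 * (q : ℝ) ^ (2 * t)) := by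
          rw [two_mul, pow_add]; field_simp
        rw [e]
        exact mul_le_mul_of_nonneg_left (by linarith) (Nat.cast_nonneg _))
    have hC0 : 0 < C := by rw [hC]; positivity
    refine hG.copsWin h2 (t := t) c ?_
    intro v
    obtain ⟨f, hf, hf2⟩ := hc v
    refine ⟨fun w => if h : w ∈ wd F δ t then f ⟨w, h⟩ else ⟨0, hC0⟩, ?_, ?_⟩
    · intro w hw w' hw' he
      have h3 : w ∈ wd F δ t := mem_wd.2 hw
      have h4 : w' ∈ wd F δ t := mem_wd.2 hw'
      simp only [h3, h4, dif_pos] at he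
      simpa using hf he
    · intro w hw hw'
      have h3 : w ∈ wd F δ t := mem_wd.2 ⟨hw, hw'⟩
      simp only [h3, dif_pos]
      have h4 := hf2 ⟨w, h3⟩
      rw [Finset.mem_image] at h4
      obtain ⟨⟨a, u⟩, hz, he⟩ := h4
      rw [mem_PP, Finset.mem_singleton] at hz
      obtain ⟨rfl, hz2, -⟩ := hz
      exact ⟨u, hz2, he.symm⟩
  exact (Nat.sInf_le hcop).trans hC2

end

end

section
open Polynomial Quaternion

section
variable {F : Type*} [Field F] {δ : F}

/-- coordinatewise reduction modulo `X ^ m` -/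
noncomputable def rdc (m : ℕ) (z : HQ F δ) : HQ F δ :=
  ⟨z.re %ₘ X ^ m, z.imI %ₘ X ^ m, z.imJ %ₘ X ^ m, z.imK %ₘ X ^ m⟩

theorem sdvd_rdc (m : ℕ) (z : HQ F δ) : SDvd (X ^ m) (z - rdc m z) := by
  have h : ∀ f : F[X], X ^ m ∣ f - f %ₘ X ^ m := fun f => ⟨f /ₘ X ^ m, by
    linear_combination -(modByMonic_add_div f (X ^ m))⟩
  rw [sdvd_iff]
  exact ⟨h _, h _, h _, h _⟩

theorem rdc_eq_iff (m : ℕ) (z z' : HQ F δ) : rdc m z = rdc m z' ↔ SDvd (X ^ m) (z - z') := by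
  constructor
  · intro h
    have h1 := sdvd_rdc m z
    have h3 := sdvd_rdc m z'
    rw [h] at h1
    have := h1.sub h3
    rwa [sub_sub_sub_cancel_right] at this
  · intro h
    rw [sdvd_iff] at h
    have hm : (X ^ m : F[X]).Monic := monic_X_pow m
    unfold rdc
    rw [modByMonic_eq_of_dvd_sub hm h.1, modByMonic_eq_of_dvd_sub hm h.2.1,
      modByMonic_eq_of_dvd_sub hm h.2.2.1, modByMonic_eq_of_dvd_sub hm h.2.2.2]

/-- inverse of `1 - X` modulo `X ^ m` -/
noncomputable def Ei (F : Type*) [Field F] (m : ℕ) : F[X] := ∑ i ∈ Finset.range m, X ^ i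

theorem Ei_pow (m a : ℕ) : (X ^ m : F[X]) ∣ ((1 - X) ^ a * Ei F m ^ a) - 1 := by
  rw [← mul_pow]
  refine dvd_trans ?_ (sub_one_dvd_pow_sub_one _ a)
  unfold Ei
  rw [mul_neg_geom_sum]
  exact ⟨-1, by ring⟩

theorem Ei_eval {m : ℕ} (hm : 1 ≤ m) : (Ei F m).eval 0 = 1 := by
  have := congrArg (eval 0) (mul_neg_geom_sum (X : F[X]) m)
  simp only [eval_mul, eval_sub, eval_one, eval_X, eval_pow] at this
  rw [sub_zero, one_mul, zero_pow (by omega), sub_zero] at this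
  exact this

/-- the vertex reached by a word -/
noncomputable def vx (m : ℕ) (w : List (Lt F δ)) : HQ F δ × ℕ :=
  (rdc m ((Ei F m ^ (w.length / 2)) • pw w), w.length % 2)

theorem vx_eq_iff (m : ℕ) (w w' : List (Lt F δ)) : vx m w = vx m w' ↔ w.length % 2 = w'.length % 2 ∧
    SDvd (X ^ m) (((1 - X) ^ (w'.length / 2) : F[X]) • pw w - ((1 - X) ^ (w.length / 2) : F[X]) • pw w') := by
  unfold vx
  rw [Prod.mk.injEq, rdc_eq_iff, and_comm]
  apply and_congr Iff.rfl
  set a := w.length / 2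
  set b := w'.length / 2
  set E := Ei F m
  set P := pw w
  set Q := pw w'
  have key : SDvd (X ^ m) (((1 - X) ^ (a + b) : F[X]) • (E ^ a • P - E ^ b • Q) -
      (((1 - X) ^ b : F[X]) • P - ((1 - X) ^ a : F[X]) • Q)) := by
    have e : ((1 - X) ^ (a + b) : F[X]) • (E ^ a • P - E ^ b • Q) -
      (((1 - X) ^ b : F[X]) • P - ((1 - X) ^ a : F[X]) • Q) =
      ((1 - X) ^ b * ((1 - X) ^ a * E ^ a - 1) : F[X]) • P - ((1 - X) ^ a * ((1 - X) ^ b * E ^ b - 1) : F[X]) • Q := by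
      rw [smul_sub, smul_smul, smul_smul, pow_add]
      rw [show (1 - X) ^ b * ((1 - X) ^ a * E ^ a - 1) = (1 - X) ^ a * (1 - X) ^ b * E ^ a - (1 - X) ^ b by ring,
        show (1 - X) ^ a * ((1 - X) ^ b * E ^ b - 1) = (1 - X) ^ a * (1 - X) ^ b * E ^ b - (1 - X) ^ a by ring,
        sub_smul, sub_smul]
      abel
    rw [e]
    exact (SDvd.smul ((Ei_pow m a).mul_left _) _).sub (SDvd.smul ((Ei_pow m b).mul_left _) _)
  constructor
  · rintro ⟨y, hy⟩
    have h1 : SDvd (X ^ m) (((1 - X) ^ (a + b) : F[X]) • (E ^ a • P - E ^ b • Q)) :=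
      ⟨((1 - X) ^ (a + b) : F[X]) • y, by rw [hy, smul_comm]⟩
    have := h1.sub key
    rwa [sub_sub_cancel] at this
  · intro h
    have := key.add h
    rw [sub_add_cancel] at this
    exact sdvd_of_smul this

theorem pw_eval (w : List (Lt F δ)) : (pw w).re.eval 0 = 1 ∧ (pw w).imI.eval 0 = 0 := by
  induction w with
  | nil => rw [pw_nil]; simp
  | cons a w ih =>
    rw [pw_cons]
    obtain ⟨h1, h3⟩ := ih
    simp only [QuaternionAlgebra.re_mul, QuaternionAlgebra.imI_mul, xi]
    simp [h1, h3]

theorem qN_congr {f : F[X]} {x y : HQ F δ} (h : SDvd f (x - y)) : f ∣ qN x - qN y := by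
  rw [sdvd_iff] at h
  simp only [QuaternionAlgebra.re_sub, QuaternionAlgebra.imI_sub, QuaternionAlgebra.imJ_sub,
    QuaternionAlgebra.imK_sub] at h
  obtain ⟨⟨a, ha⟩, ⟨b, hb⟩, ⟨c, hc⟩, ⟨d, hd⟩⟩ := h
  rw [qN_eq, qN_eq]
  refine ⟨a * (x.re + y.re) - C δ * (b * (x.imI + y.imI)) - X * (c * (x.imJ + y.imJ) - C δ * (d * (x.imK + y.imK))), ?_⟩
  linear_combination (x.re + y.re) * ha - C δ * (x.imI + y.imI) * hb - X * (x.imJ + y.imJ) * hc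
    + X * C δ * (x.imK + y.imK) * hd

theorem vx_qN (m : ℕ) (w : List (Lt F δ)) : X ^ m ∣ qN (vx m w).1 - (1 - X) ^ (vx m w).2 := by
  unfold vx
  simp only
  set a := w.length / 2
  have h1 := qN_congr (sdvd_rdc m (Ei F m ^ a • pw w))
  rw [qN_smul, qN_pw] at h1
  have h3 := Ei_pow (F := F) m (a * 2)
  have e : w.length = a * 2 + w.length % 2 := by omega
  have h4 : (X ^ m : F[X]) ∣ (Ei F m ^ a) ^ 2 * (1 - X) ^ w.length - (1 - X) ^ (w.length % 2) := by
    have : (Ei F m ^ a) ^ 2 * (1 - X) ^ w.length - (1 - X) ^ (w.length % 2) =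
      (1 - X) ^ (w.length % 2) * ((1 - X) ^ (a * 2) * Ei F m ^ (a * 2) - 1) := by
      conv_lhs => rw [e]
      rw [pow_add]
      have : (a * 2 + w.length % 2) % 2 = w.length % 2 := by omega
      rw [this]
      ring
    rw [this]
    exact h3.mul_left _
  have := h4.sub h1
  rwa [sub_sub_sub_cancel_left] at this

theorem vx_eval {m : ℕ} (hm : 1 ≤ m) (w : List (Lt F δ)) : (vx m w).1.re.eval 0 = 1 := by
  unfold vx
  simp only
  set a := w.length / 2
  have h1 := ((sdvd_iff _ _).1 (sdvd_rdc m (Ei F m ^ a • pw w))).1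
  have h3 : (X : F[X]) ∣ _ := (dvd_pow_self X (by omega)).trans h1
  rw [X_dvd_iff, coeff_zero_eq_eval_zero] at h3
  simp only [QuaternionAlgebra.re_sub, QuaternionAlgebra.re_smul, smul_eq_mul, eval_sub, eval_mul, eval_pow,
    Ei_eval hm, (pw_eval w).1] at h3
  rw [one_pow, one_mul, sub_eq_zero] at h3
  exact h3.symm

theorem card_vx [Fintype F] (h2 : (2 : F) ≠ 0) {m t : ℕ} (hm : 1 ≤ m) (ht : 2 * t = 3 * m) :
    CardLE (Set.range (vx (δ := δ) m)) (2 * Fintype.card F ^ (2 * t)) := by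
  have hdeg : ∀ f : F[X], (f %ₘ X ^ m).degree < m := by
    intro f
    have := degree_modByMonic_lt f (monic_X_pow (R := F) m)
    rwa [degree_X_pow] at this
  have hc := card_degree_lt (F := F) m
  have h2' : CardLE ((Finset.range 2 : Finset ℕ) : Set ℕ) 2 :=
    ⟨Finset.finite_toSet _, by rw [Set.ncard_coe_finset]; simp⟩
  have hp := h2'.prod (hc.prod (hc.prod hc))
  have e : 2 * (Fintype.card F ^ m * (Fintype.card F ^ m * Fintype.card F ^ m)) = 2 * Fintype.card F ^ (2 * t) := by
    rw [ht, ← pow_add, ← pow_add]; congr 2; omega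
  rw [e] at hp
  refine CardLE.inj hp (fun x => (x.2, x.1.imI, x.1.imJ, x.1.imK)) ?_ ?_
  · rintro x ⟨w, rfl⟩
    refine ⟨?_, hdeg _, hdeg _, hdeg _⟩
    simp only [vx, Finset.coe_range, Set.mem_Iio]
    omega
  · rintro x ⟨w, rfl⟩ y ⟨w', rfl⟩ he
    simp only [Prod.mk.injEq] at he
    obtain ⟨h1, h3, h4, h5⟩ := he
    have a1 := vx_qN m w
    have a2 := vx_qN m w'
    rw [qN_eq] at a1 a2
    rw [h1, h3, h4, h5] at a1
    have a3 := a1.sub a2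
    have a4 : X ^ m ∣ ((vx m w).1.re + (vx m w').1.re) * ((vx m w).1.re - (vx m w').1.re) := by
      convert a3 using 1
      ring
    have a5 : X ^ m ∣ (vx m w).1.re - (vx m w').1.re := by
      refine (X_coprime ?_ m).dvd_of_dvd_mul_left a4
      rw [eval_add, vx_eval hm, vx_eval hm]
      convert h2 using 1
      norm_num
    have a6 : (vx m w).1.re - (vx m w').1.re = 0 := by
      refine eq_zero_of_dvd_of_degree_lt a5 ?_
      rw [degree_X_pow]
      exact lt_of_le_of_lt (degree_sub_le _ _) (max_lt (hdeg _) (hdeg _))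
    refine Prod.ext ?_ h1
    ext1
    · exact sub_eq_zero.1 a6
    · exact h3
    · exact h4
    · exact h5

theorem exists_phi [Fintype F] (h2 : (2 : F) ≠ 0) {m t : ℕ} (hm : 1 ≤ m) (ht : 2 * t = 3 * m) :
    ∃ (n : ℕ) (φ : List (Lt F δ) → Fin n), n ≤ 2 * Fintype.card F ^ (2 * t) ∧ Function.Surjective φ ∧
      ∀ w w', φ w = φ w' ↔ vx m w = vx m w' := by
  obtain ⟨hf, hc⟩ := card_vx (δ := δ) h2 hm ht
  have : Finite (Set.range (vx (δ := δ) m)) := hf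
  let e := Finite.equivFin (Set.range (vx (δ := δ) m))
  refine ⟨_, fun w => e ⟨vx m w, w, rfl⟩, hc, ?_, ?_⟩
  · intro i
    obtain ⟨w, hw⟩ := (e.symm i).2
    refine ⟨w, ?_⟩
    simp only [hw]
    exact e.apply_symm_apply i
  · intro w w'
    exact e.injective.eq_iff.trans Subtype.mk_eq_mk

end

end

section
open Polynomial Quaternion

section
variable {F : Type*} [Field F] {δ : F}

theorem vx_same {m : ℕ} {w x x' : List (Lt F δ)} (hl : x.length = x'.length)
    (h : vx m (w ++ x) = vx m (w ++ x')) : SDvd (X ^ m) (pw x - pw x') := by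
  have h1 := ((vx_eq_iff _ _ _).1 h).2
  rw [List.length_append, List.length_append, hl, ← smul_sub] at h1
  exact sdvd_cancel_left (sdvd_of_smul h1)

theorem vx_snoc {m : ℕ} {w w' : List (Lt F δ)} (a : Lt F δ)
    (h : vx m w = vx m w') : vx m (w ++ [a]) = vx m (w' ++ [a]) := by
  obtain ⟨h0, h1⟩ := (vx_eq_iff _ _ _).1 h
  rw [vx_eq_iff]
  simp only [List.length_append, List.length_singleton]
  refine ⟨by omega, ?_⟩
  have h3 := h1.mul_right (xi a)
  rw [sub_mul, smul_mul_assoc, smul_mul_assoc] at h3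
  rw [pw_append, pw_append, pw_cons, pw_nil, mul_one]
  rcases Nat.mod_two_eq_zero_or_one w.length with he | he
  · rw [show (w.length + 1) / 2 = w.length / 2 by omega, show (w'.length + 1) / 2 = w'.length / 2 by omega]
    exact h3
  · rw [show (w.length + 1) / 2 = w.length / 2 + 1 by omega, show (w'.length + 1) / 2 = w'.length / 2 + 1 by omega]
    obtain ⟨y, hy⟩ := h3
    refine ⟨(1 - X : F[X]) • y, ?_⟩
    rw [smul_comm, ← hy, pow_succ', pow_succ', mul_smul, mul_smul, smul_sub]

theorem vx_back {m : ℕ} (w : List (Lt F δ)) (a : Lt F δ) : vx m ((w ++ [a]) ++ [ln a]) = vx m w := by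
  rw [vx_eq_iff]
  simp only [List.length_append, List.length_singleton]
  refine ⟨by omega, ?_⟩
  rw [pw_append, pw_append, pw_cons, pw_nil, mul_one, pw_cons, pw_nil, mul_one, ← star_xi, mul_assoc,
    mul_star_qN, qN_xi, mul_smul_comm, mul_one, show (w.length + 1 + 1) / 2 = w.length / 2 + 1 by omega,
    pow_succ, mul_smul, sub_self]
  exact ⟨0, by rw [smul_zero]⟩

theorem vx_close {m T : ℕ} {w x : List (Lt F δ)} (hl : x.length = 2 * T)
    (h : vx m (w ++ x) = vx m w) : SDvd (X ^ m) (pw x - ((1 - X) ^ T : F[X]) • 1) := by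
  have h1 := ((vx_eq_iff _ _ _).1 h).2
  rw [List.length_append, hl, show (w.length + 2 * T) / 2 = w.length / 2 + T by omega, pow_add, mul_smul,
    ← smul_sub] at h1
  have h3 := sdvd_of_smul h1
  rw [pw_append] at h3
  have h4 := h3.mul_left (star (pw w))
  rw [mul_sub, ← mul_assoc, mul_smul_comm, star_mul_qN, qN_pw, smul_mul_assoc, one_mul, smul_comm, ← smul_sub] at h4
  exact sdvd_of_smul h4

/-- trails give reduced words -/
theorem LabG.trail {V : Type*} {G : SimpleGraph V} {step : V → Lt F δ → V} (hG : LabG F δ G step) {v u : V}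
    (p : G.Walk v u) (hp : p.IsTrail) : ∃ x : List (Lt F δ), Red x ∧ x.length = p.length ∧ walk step v x = u ∧
      ∀ b ∈ x.head?, s(v, step v b) ∈ p.edges := by
  induction p with
  | nil => exact ⟨[], by unfold Red; simp, rfl, rfl, by simp⟩
  | @cons v v' u h p ih =>
    rw [SimpleGraph.Walk.isTrail_cons] at hp
    obtain ⟨x, h1, h2, h3, h4⟩ := ih hp.1
    obtain ⟨a, ha⟩ := (hG.adj _ _).1 h
    refine ⟨a :: x, ?_, by simp [h2], ?_, ?_⟩
    · unfold Red at *
      rw [List.isChain_cons]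
      refine ⟨?_, h1⟩
      rintro b hb rfl
      have := h4 _ hb
      have e : step v' (ln a) = v := by rw [← ha, hG.back]
      rw [e] at this
      exact hp.2 (by rw [Sym2.eq_swap]; exact this)
    · unfold walk at *
      rw [List.foldl_cons, ha, h3]
    · intro b hb
      simp at hb
      subst hb
      rw [ha]
      simp

theorem graph_exists [Fintype F] (hδ : ¬ IsSquare δ) (h2 : (2 : F) ≠ 0) {m t : ℕ} (hm : 1 ≤ m)
    (ht : 2 * t = 3 * m)
    (hA : 32 * 166 * Fintype.card F ^ 5 * (6 * Fintype.card F + 6) * (m + 1) ^ 4 < 2 ^ m) :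
    ∃ (n : ℕ) (G : SimpleGraph (Fin n)), G.Connected ∧
      (∀ v : Fin n, (G.neighborSet v).ncard = Fintype.card F + 1) ∧
      ∃ g : ℕ, G.egirth = (g : ℕ∞) ∧ 4 * m ≤ g ∧ copNumber G ≤ Fintype.card F ^ t * 64 ^ m := by
  classical
  obtain ⟨n, φ, hn, hsur, hφ⟩ := exists_phi (δ := δ) h2 hm ht
  obtain ⟨σ, hσ⟩ := hsur.hasRightInverse
  obtain ⟨step, hstep⟩ : ∃ step : Fin n → Lt F δ → Fin n, ∀ w a, step (φ w) a = φ (w ++ [a]) := by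
    refine ⟨fun i a => φ (σ i ++ [a]), ?_⟩
    intro w a
    show φ (σ (φ w) ++ [a]) = _
    rw [hφ]
    apply vx_snoc
    rw [← hφ, hσ]
  have hwalk : ∀ x w, walk step (φ w) x = φ (w ++ x) := by
    intro x
    induction x with
    | nil => intro w; simp [walk]
    | cons a x ih =>
      intro w
      have := ih (w ++ [a])
      unfold walk at *
      rw [List.foldl_cons, hstep, this]
      simp
  have hback : ∀ v a, step (step v a) (ln a) = v := by
    intro v a
    obtain ⟨w, rfl⟩ := hsur v
    rw [hstep, hstep, hφ]
    exact vx_back w a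
  have hpar : ∀ w w', φ w = φ w' → w.length % 2 = w'.length % 2 := by
    intro w w' h
    exact ((vx_eq_iff _ _ _).1 ((hφ _ _).1 h)).1
  have hloop : ∀ v a, step v a ≠ v := by
    intro v a ha
    obtain ⟨w, rfl⟩ := hsur v
    rw [hstep] at ha
    have := hpar _ _ ha
    rw [List.length_append, List.length_singleton] at this
    omega
  obtain ⟨G, hadj⟩ : ∃ G : SimpleGraph (Fin n), ∀ v w, G.Adj v w ↔ ∃ a, step v a = w :=
    ⟨{ Adj := fun v w => ∃ a, step v a = w
       symm := ⟨by
         rintro v w ⟨a, rfl⟩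
         exact ⟨ln a, hback v a⟩⟩
       loopless := ⟨by
         rintro v ⟨a, ha⟩
         exact hloop v a ha⟩ }, fun v w => Iff.rfl⟩
  have hG : LabG F δ G step := ⟨hback, hadj⟩
  have hy : ∀ v x x', x.length = x'.length → walk step v x = walk step v x' → SDvd (X ^ m) (pw x - pw x') := by
    intro v x x' hl h
    obtain ⟨w, rfl⟩ := hsur v
    rw [hwalk, hwalk, hφ] at h
    exact vx_same hl h
  have hne : Nonempty (Fin n) := ⟨φ []⟩
  have hcop := cop_bound hδ h2 hm ht hG hy (by rwa [Fintype.card_fin]) hA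
  have hconn : G.Connected := by
    rw [SimpleGraph.connected_iff_exists_forall_reachable]
    refine ⟨φ [], ?_⟩
    intro v
    obtain ⟨w, rfl⟩ := hsur v
    induction w using List.reverseRecOn with
    | nil => exact SimpleGraph.Reachable.refl _
    | append_singleton w a ih =>
      refine ih.trans (SimpleGraph.Adj.reachable ((hadj _ _).2 ⟨a, hstep w a⟩))
  have hreg : ∀ v : Fin n, (G.neighborSet v).ncard = Fintype.card F + 1 := by
    intro v
    have e : G.neighborSet v = Set.range (step v) := by
      ext w; rw [SimpleGraph.mem_neighborSet, hadj, Set.mem_range]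
    rw [e, Set.ncard_range_of_injective, Nat.card_eq_fintype_card, card_Lt hδ h2]
    intro a b hab
    have h1 := hy v [a] [b] rfl (by simpa [walk] using hab)
    have hr : ∀ a : Lt F δ, Red [a] := by intro a; unfold Red; exact List.isChain_singleton _
    have hlen : ([a] : List (Lt F δ)).length < 2 * m := by rw [List.length_singleton]; omega
    have := word_inj hδ h2 hm (hr a) (hr b) rfl hlen h1
    exact (List.cons.inj this).1
  have hfin : G.egirth ≠ ⊤ := by
    rw [ne_eq, SimpleGraph.egirth_eq_top]
    intro hac
    have htree : G.IsTree := ⟨hconn, hac⟩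
    have hq : 1 ≤ Fintype.card F := Fintype.card_pos
    have hnt : Nontrivial (Fin n) := by
      have h1 := hreg (φ [])
      obtain ⟨w, hw⟩ := Set.nonempty_of_ncard_ne_zero (s := G.neighborSet (φ [])) (by omega)
      exact ⟨φ [], w, G.ne_of_adj hw⟩
    have h1 := htree.minDegree_eq_one_of_nontrivial
    obtain ⟨v, hv⟩ := G.exists_minimal_degree_vertex
    have h3 := hreg v
    rw [← SimpleGraph.coe_neighborFinset, Set.ncard_coe_finset, SimpleGraph.card_neighborFinset_eq_degree] at h3
    omega
  obtain ⟨g, hg⟩ := ENat.ne_top_iff_exists.1 hfin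
  refine ⟨n, G, hconn, hreg, g, hg.symm, ?_, hcop⟩
  have hle : ((4 * m : ℕ) : ℕ∞) ≤ G.egirth := by
    rw [SimpleGraph.le_egirth]
    intro v p hp
    obtain ⟨x, h1, h3, h4, -⟩ := hG.trail p hp.isCircuit.isTrail
    have hl := hp.three_le_length
    rw [← h3] at hl ⊢
    obtain ⟨w, rfl⟩ := hsur v
    rw [hwalk] at h4
    have h5 := hpar _ _ h4
    rw [List.length_append] at h5
    obtain ⟨T, hT⟩ : ∃ T, x.length = 2 * T := ⟨x.length / 2, by omega⟩
    rw [hφ] at h4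
    have h6 := vx_close hT h4
    by_contra hcon
    rw [not_le] at hcon
    have h7 : x.length < 4 * m := by exact_mod_cast hcon
    exact girth_word hδ h2 hm (by omega) (by omega) h1 hT h6
  rw [← hg] at hle
  exact_mod_cast hle

end

theorem exists_big (A : ℕ) : ∃ N : ℕ, ∀ m ≥ N, A * (m + 1) ^ 4 < 2 ^ m := by
  have h := tendsto_pow_const_div_const_pow_of_one_lt 4 (by norm_num : (1 : ℝ) < 2)
  have h1 : ∀ᶠ n : ℕ in Filter.atTop, (n : ℝ) ^ 4 / 2 ^ n < 1 / (2 * (A + 1)) :=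
    h.eventually_lt_const (by positivity)
  obtain ⟨N, hN⟩ := Filter.eventually_atTop.1 h1
  refine ⟨N, ?_⟩
  intro m hm
  have h3 := hN (m + 1) (by omega)
  rw [div_lt_div_iff₀ (by positivity) (by positivity), pow_succ (2 : ℝ) m] at h3
  push_cast at h3
  have h4 : (A : ℝ) * ((m : ℝ) + 1) ^ 4 < 2 ^ m := by
    have : (0 : ℝ) ≤ ((m : ℝ) + 1) ^ 4 := by positivity
    nlinarith
  exact_mod_cast h4

end

/-- Let `p` be a prime with `p ≡ 1 (mod 4)` and `d = p + 1`.
For every real `ε > 0` and every integer `g₀` there exists a finite connected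
`d`-regular graph `X` whose girth `g` is finite, satisfies `g ≥ g₀`, and whose
cop number satisfies `c(X) ≤ p ^ ((3/8) * (1 + 2 * log_p 4 + ε) * g)`. -/
theorem exists_regular_graph_large_girth_small_copNumber
    (p : ℕ) (hp : p.Prime) (hp4 : p % 4 = 1) :
    ∀ ε : ℝ, 0 < ε → ∀ g₀ : ℕ, ∃ (n : ℕ) (X : SimpleGraph (Fin n)),
      X.Connected ∧ (∀ v : Fin n, (X.neighborSet v).ncard = p + 1) ∧
      ∃ g : ℕ, X.egirth = (g : ℕ∞) ∧ g₀ ≤ g ∧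
        (copNumber X : ℝ) ≤
          (p : ℝ) ^ ((3 / 8 : ℝ) * (1 + 2 * Real.logb p 4 + ε) * g) := by
  intro ε hε g₀
  have : Fact p.Prime := ⟨hp⟩
  have hp2 : p ≠ 2 := by rintro rfl; simp at hp4
  have hchar : ringChar (ZMod p) ≠ 2 := by rwa [ZMod.ringChar_zmod_n]
  obtain ⟨δ, hδ⟩ := FiniteField.exists_nonsquare hchar
  have h2 : (2 : ZMod p) ≠ 0 := Ring.two_ne_zero hchar
  obtain ⟨N, hN⟩ := exists_big (32 * 166 * p ^ 5 * (6 * p + 6))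
  set μ := N + g₀ + 1
  obtain ⟨n, G, h1, h3, g, h4, h5, h6⟩ := graph_exists (F := ZMod p) (δ := δ) hδ h2 (m := 2 * μ) (t := 3 * μ)
    (by omega) (by omega) (by
      rw [ZMod.card]
      exact hN _ (by omega))
  rw [ZMod.card] at h3 h6
  refine ⟨n, G, h1, h3, g, h4, by omega, ?_⟩
  have hp1 : (1 : ℝ) < p := by exact_mod_cast hp.one_lt
  have hp0 : (0 : ℝ) < p := by linarith
  have h7 : (copNumber G : ℝ) ≤ (p : ℝ) ^ (3 * μ) * 64 ^ (2 * μ) := by exact_mod_cast h6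
  refine h7.trans ?_
  have hlog : (0 : ℝ) ≤ Real.logb p 4 := Real.logb_nonneg hp1 (by norm_num)
  have e : (p : ℝ) ^ (3 * μ) * 64 ^ (2 * μ) = (p : ℝ) ^ ((3 / 8 : ℝ) * (1 + 2 * Real.logb p 4) * (8 * μ)) := by
    have e1 : (3 / 8 : ℝ) * (1 + 2 * Real.logb p 4) * (8 * μ) = ((3 * μ : ℕ) : ℝ) + Real.logb p 4 * ((6 * μ : ℕ) : ℝ) := by
      push_cast; ring
    rw [e1, Real.rpow_add hp0, Real.rpow_natCast, Real.rpow_mul hp0.le, Real.rpow_logb hp0 hp1.ne' (by norm_num),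
      Real.rpow_natCast]
    congr 1
    rw [show 6 * μ = 3 * (2 * μ) by ring, pow_mul (4 : ℝ) 3]
    norm_num
  rw [e]
  apply Real.rpow_le_rpow_of_exponent_le hp1.le
  have hg : (8 * μ : ℝ) ≤ g := by exact_mod_cast (by omega : 8 * μ ≤ g)
  have hg0 : (0 : ℝ) ≤ g := Nat.cast_nonneg _
  have : (3 / 8 : ℝ) * (1 + 2 * Real.logb p 4) ≤ (3 / 8 : ℝ) * (1 + 2 * Real.logb p 4 + ε) := by linarith
  exact mul_le_mul this hg (by positivity) (by positivity)
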